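/- arXiv:math/0701591 — 2 statements merged into one kernel-verified Lean document; each statement's English description precedes it below -/
import Mathlib

section
/- Assume E_S is T-torsion-free. Let c ∈ R be an element whose image in S is a parameter test element. Then the parameter test ideal τ̄ of S is given by τ̄ = ((cJ + I)^{⋆u} :_R J)·S, where (cJ+I)^{⋆u} denotes the ⋆-closure (cJ+I)^{⋆^1 u}. -/
open IsLocalRing

/-- The `q`-th Frobenius power of an ideal: the ideal generated by `q`-th powers of elements. -/
def Ideal.frobPow {R : Type*} [CommSemiring R] (q : ℕ) (I : Ideal R) : Ideal R :=
  Ideal.span ((fun a => a ^ q) '' (I : Set R))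

/-- A `q`-Frobenius map on a module `M`: additive, with `ψ (r • x) = r ^ q • ψ x`. -/
structure FrobeniusMap (R : Type*) [CommSemiring R] (M : Type*) [AddCommMonoid M]
    [Module R M] (q : ℕ) where
  toFun : M → M
  map_add' : ∀ x y, toFun (x + y) = toFun x + toFun y
  map_smul' : ∀ (r : R) (x : M), toFun (r • x) = r ^ q • toFun x

/-- `E` is an injective hull of the residue field of the local ring `R`. -/
def IsInjectiveHullOfResidueField (R : Type*) [CommRing R] [IsLocalRing R]
    (E : Type*) [AddCommGroup E] [Module R E] : Prop :=
  Module.Injective R E ∧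
    ∃ ι : ResidueField R →ₗ[R] E, Function.Injective ι ∧
      ∀ N : Submodule R E, N ≠ ⊥ → ∃ x, x ≠ 0 ∧ x ∈ N ∧ x ∈ LinearMap.range ι

/-- Regularity for a Noetherian local ring: the maximal ideal is generated by
`dim R` elements. -/
def IsRegularLocal (R : Type*) [CommRing R] [IsLocalRing R] : Prop :=
  ∃ (n : ℕ) (x : Fin n → R), maximalIdeal R = Ideal.span (Set.range x) ∧
    ringKrullDim R = n

/-- `φ` is (up to normalization) the natural Frobenius on `E = E_R(R/m)`: every `e`-th
Frobenius map on `E` is uniquely of the form `u • φ^[e]`. -/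
def IsNaturalFrobenius {R : Type*} [CommRing R] (p : ℕ) (E : Type*) [AddCommGroup E]
    [Module R E] (φ : FrobeniusMap R E p) : Prop :=
  ∀ e : ℕ, 1 ≤ e → ∀ θ : FrobeniusMap R E (p ^ e),
    ∃! u : R, ∀ x : E, θ.toFun x = u • (φ.toFun)^[e] x

/-- The annihilator of an ideal `I` inside a module `E`, as a submodule of `E`. -/
def annIn {R : Type*} [CommRing R] (I : Ideal R) (E : Type*) [AddCommGroup E]
    [Module R E] : Submodule R E where
  carrier := { x | ∀ a ∈ I, a • x = 0 }
  add_mem' hx hy := fun a ha => by rw [smul_add, hx a ha, hy a ha, add_zero]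
  zero_mem' := fun a _ => smul_zero a
  smul_mem' := fun r x hx a ha => by rw [smul_comm, hx a ha, smul_zero]

/-- `ν_e = 1 + p + ⋯ + p^{e-1}`. -/
def nuExp (p e : ℕ) : ℕ := ∑ i ∈ Finset.range e, p ^ i


/-- `Ã^{(e)}`: the intersection of all ideals `L` with `A ⊆ L^{[q]}`. -/
def Ideal.tilde {T : Type*} [CommSemiring T] (q : ℕ) (A : Ideal T) : Ideal T :=
  sInf { L : Ideal T | A ≤ Ideal.frobPow q L }

/-- The ascending chain `A_0 = A`, `A_{i+1} = (u A_i)~ + A_i` defining the `⋆`-closure. -/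
def Ideal.starChain {T : Type*} [CommRing T] (u : T) (q : ℕ) (A : Ideal T) : ℕ → Ideal T
  | 0 => A
  | i + 1 =>
      Ideal.tilde q (Ideal.span {u} * Ideal.starChain u q A i) + Ideal.starChain u q A i

/-- The `⋆`-closure `A^{⋆u}`: the stable value of the chain `A_i`. -/
def Ideal.starClosure {T : Type*} [CommRing T] (u : T) (q : ℕ) (A : Ideal T) : Ideal T :=
  ⨆ i, Ideal.starChain u q A i

/-- An ideal generated by a (full) system of parameters of the local ring `S`. -/
def IsSOPIdeal (S : Type*) [CommRing S] [IsLocalRing S] (A : Ideal S) : Prop :=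
  ∃ (d : ℕ) (x : Fin d → S), ringKrullDim S = d ∧ A = Ideal.span (Set.range x) ∧
    A.radical = maximalIdeal S

/-- Membership in the tight closure of an ideal `A` of a ring of characteristic `p`. -/
def InTightClosure (p : ℕ) {S : Type*} [CommRing S] (A : Ideal S) (a : S) : Prop :=
  ∃ c : S, (∀ P ∈ minimalPrimes S, c ∉ P) ∧
    ∃ E₀ : ℕ, ∀ e, E₀ ≤ e → c * a ^ p ^ e ∈ Ideal.frobPow (p ^ e) A

/-- A parameter test element of the local ring `S` of characteristic `p`. -/
def IsParamTestElement (p : ℕ) {S : Type*} [CommRing S] [IsLocalRing S] (c : S) : Prop :=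
  (∀ P ∈ minimalPrimes S, c ∉ P) ∧
    ∀ A : Ideal S, IsSOPIdeal S A → ∀ a : S,
      (InTightClosure p A a ↔ ∀ e : ℕ, c * a ^ p ^ e ∈ Ideal.frobPow (p ^ e) A)

/-- The parameter test ideal: the ideal generated by all parameter test elements. -/
def paramTestIdeal (p : ℕ) (S : Type*) [CommRing S] [IsLocalRing S] : Ideal S :=
  Ideal.span { c : S | IsParamTestElement p c }

/-- Cohen–Macaulayness of a Noetherian local ring: some system of parameters is a
regular sequence. -/
def IsCMLocal (S : Type*) [CommRing S] [IsLocalRing S] : Prop :=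
  ∃ (d : ℕ) (rs : List S), ringKrullDim S = d ∧ rs.length = d ∧
    (∀ r ∈ rs, r ∈ maximalIdeal S) ∧ RingTheory.Sequence.IsRegular S rs

section
open CategoryTheory Limits

universe u
namespace LCx
variable {R : Type u} [CommRing R]

/-- cocycles -/
def coc {X : ModuleCat.{u} R} (P : ProjectiveResolution X) (n : ℕ) (Y : ModuleCat.{u} R) :
    Submodule R (P.complex.X n ⟶ Y) where
  carrier := {f | P.complex.d (n+1) n ≫ f = 0}
  add_mem' := by
    intro a b ha hb
    simp only [Set.mem_ofPred_eq] at *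
    rw [Preadditive.comp_add, ha, hb, add_zero]
  zero_mem' := by simp
  smul_mem' := by
    intro c x hx
    simp only [Set.mem_ofPred_eq] at *
    rw [Linear.comp_smul, hx, smul_zero]

noncomputable abbrev FY (Y : ModuleCat.{u} R) : ModuleCat.{u} R ⥤ (ModuleCat.{u} R)ᵒᵖ :=
  ((linearYoneda R (ModuleCat.{u} R)).obj Y).rightOp

noncomputable abbrev KK {X : ModuleCat.{u} R} (P : ProjectiveResolution X) (Y : ModuleCat.{u} R) :
    ChainComplex (ModuleCat.{u} R)ᵒᵖ ℕ :=
  ((FY Y).mapHomologicalComplex _).obj P.complex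

noncomputable def cocIncl {X : ModuleCat.{u} R} (P : ProjectiveResolution X) (n : ℕ)
    (Y : ModuleCat.{u} R) : (KK P Y).X n ⟶ Opposite.op (ModuleCat.of R (coc P n Y)) :=
  Quiver.Hom.op (ModuleCat.ofHom (coc P n Y).subtype :
    ModuleCat.of R (coc P n Y) ⟶ ((linearYoneda R (ModuleCat.{u} R)).obj Y).obj (.op (P.complex.X n)))

lemma d_cocIncl {X : ModuleCat.{u} R} (P : ProjectiveResolution X) (n : ℕ)
    (Y : ModuleCat.{u} R) : (KK P Y).d (n+1) n ≫ cocIncl P n Y = 0 := by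
  apply Quiver.Hom.unop_inj
  ext f
  exact f.2

noncomputable def dO {X : ModuleCat.{u} R} (P : ProjectiveResolution X) (n : ℕ)
    (Y : ModuleCat.{u} R) : (KK P Y).opcycles n ⟶ Opposite.op (ModuleCat.of R (coc P n Y)) :=
  (KK P Y).descOpcycles (cocIncl P n Y) (n+1) (by simp) (d_cocIncl P n Y)

lemma p_dO {X : ModuleCat.{u} R} (P : ProjectiveResolution X) (n : ℕ)
    (Y : ModuleCat.{u} R) : (KK P Y).pOpcycles n ≫ dO P n Y = cocIncl P n Y :=
  HomologicalComplex.p_descOpcycles _ _ _ _ _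

noncomputable abbrev ExtO (X Y : ModuleCat.{u} R) (n : ℕ) : ModuleCat.{u} R :=
  ((Ext R (ModuleCat.{u} R) n).obj (Opposite.op X)).obj Y

noncomputable def isoK {X : ModuleCat.{u} R} (P : ProjectiveResolution X) (n : ℕ)
    (Y : ModuleCat.{u} R) : ((FY Y).leftDerived n).obj X ≅ (KK P Y).homology n :=
  P.isoLeftDerivedObj (FY Y) n

noncomputable def cl' {X : ModuleCat.{u} R} (P : ProjectiveResolution X) (n : ℕ)
    (Y : ModuleCat.{u} R) : ((FY Y).leftDerived n).obj X ⟶ Opposite.op (ModuleCat.of R (coc P n Y)) :=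
  (isoK P n Y).hom ≫ (KK P Y).homologyι n ≫ dO P n Y

noncomputable def cl {X : ModuleCat.{u} R} (P : ProjectiveResolution X) (n : ℕ)
    (Y : ModuleCat.{u} R) : coc P n Y →ₗ[R] ExtO X Y n :=
  (cl' P n Y).unop.hom

lemma isIso_dO {X : ModuleCat.{u} R} (P : ProjectiveResolution X) (n : ℕ)
    (Y : ModuleCat.{u} R) : IsIso (dO P n Y) := by
  have h1 : (KK P Y).d (n+1) n ≫ (KK P Y).pOpcycles n = 0 := HomologicalComplex.d_pOpcycles _ _ _
  have h2 : ∀ z, ((KK P Y).pOpcycles n).unop.hom z ∈ coc P n Y := by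
    intro z
    have := congrArg (fun f => f.unop.hom z) h1
    exact this
  let ψ : Opposite.op (ModuleCat.of R (coc P n Y)) ⟶ (KK P Y).opcycles n :=
    Quiver.Hom.op (ModuleCat.ofHom (LinearMap.codRestrict (coc P n Y) ((KK P Y).pOpcycles n).unop.hom h2))
  have h3 : cocIncl P n Y ≫ ψ = (KK P Y).pOpcycles n := rfl
  refine ⟨ψ, ?_, ?_⟩
  · rw [← cancel_epi ((KK P Y).pOpcycles n), ← Category.assoc, p_dO, h3, Category.comp_id]
  · have : Epi (cocIncl P n Y) := by
      have : Mono (cocIncl P n Y).unop := by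
        rw [ModuleCat.mono_iff_injective]
        exact Subtype.val_injective
      exact unop_mono_iff _ |>.1 this
    rw [← cancel_epi (cocIncl P n Y), ← Category.assoc, h3, p_dO, Category.comp_id]

lemma cl_surj {X : ModuleCat.{u} R} (P : ProjectiveResolution X) (n : ℕ)
    (Y : ModuleCat.{u} R) : Function.Surjective (cl P n Y) := by
  have := isIso_dO P n Y
  have h : Mono (cl' P n Y) := by
    unfold cl'
    exact mono_comp _ _
  have h2 : Epi (cl' P n Y).unop := inferInstance
  exact (ModuleCat.epi_iff_surjective _).1 h2

lemma cl_eq_zero {X : ModuleCat.{u} R} (P : ProjectiveResolution X) (n j : ℕ)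
    (hj : (ComplexShape.down ℕ).next n = j)
    (Y : ModuleCat.{u} R) (f : coc P n Y) : cl P n Y f = 0 ↔
      ∃ g : P.complex.X j ⟶ Y, f.1 = P.complex.d n j ≫ g := by
  have := isIso_dO P n Y
  let S : ShortComplex (ModuleCat.{u} R)ᵒᵖ := ShortComplex.mk (cl' P n Y)
    (inv (dO P n Y) ≫ (KK P Y).fromOpcycles n j) (by
      unfold cl'
      rw [Category.assoc, Category.assoc, IsIso.hom_inv_id_assoc, HomologicalComplex.homologyι_comp_fromOpcycles, comp_zero])
  have hS : S.Exact := by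
    let S' : ShortComplex (ModuleCat.{u} R)ᵒᵖ := ShortComplex.mk ((KK P Y).homologyι n)
       ((KK P Y).fromOpcycles n j) (by simp)
    have h' : S'.Exact := ShortComplex.exact_of_f_is_kernel _ ((KK P Y).homologyIsKernel n j hj)
    refine (ShortComplex.exact_iff_of_iso (S₁ := S') (S₂ := S) ?_).1 h'
    refine ShortComplex.isoMk (isoK P n Y).symm (asIso (dO P n Y)) (Iso.refl _) ?_ ?_
    · change (isoK P n Y).inv ≫ cl' P n Y = (KK P Y).homologyι n ≫ dO P n Y
      unfold cl'
      rw [Iso.inv_hom_id_assoc]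
    · simp [S, S']
  have hS2 := (ShortComplex.moduleCat_exact_iff _).1 hS.unop
  have key : ∀ g : P.complex.X j ⟶ Y, ((inv (dO P n Y) ≫ (KK P Y).fromOpcycles n j).unop.hom g : coc P n Y).1
      = P.complex.d n j ≫ g := by
    intro g
    have : cocIncl P n Y ≫ (inv (dO P n Y) ≫ (KK P Y).fromOpcycles n j) = (KK P Y).d n j := by
      rw [← p_dO, Category.assoc, IsIso.hom_inv_id_assoc, HomologicalComplex.p_fromOpcycles]
    exact congrArg (fun h => h.unop.hom g) this
  constructor
  · intro h
    obtain ⟨g, hg⟩ := hS2 f h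
    refine ⟨g, ?_⟩
    rw [← key g]
    exact congrArg Subtype.val hg.symm
  · rintro ⟨g, hg⟩
    have h1 : f = ((inv (dO P n Y) ≫ (KK P Y).fromOpcycles n j).unop.hom g : coc P n Y) := by
      apply Subtype.ext
      rw [key, hg]
    have h2 : S.g.unop ≫ S.f.unop = 0 := by
      rw [← unop_comp, S.zero]; rfl
    rw [h1]
    exact congrArg (fun h => h.hom g) h2

/-- pull back of cocycles -/
lemma coc_pull {X X' : ModuleCat.{u} R} (P : ProjectiveResolution X) (Q : ProjectiveResolution X')
    (l : P.complex ⟶ Q.complex) (n : ℕ) (Y : ModuleCat.{u} R) {f : Q.complex.X n ⟶ Y}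
    (hf : f ∈ coc Q n Y) : l.f n ≫ f ∈ coc P n Y := by
  change P.complex.d (n+1) n ≫ l.f n ≫ f = 0
  rw [← HomologicalComplex.Hom.comm_assoc]
  have : Q.complex.d (n+1) n ≫ f = 0 := hf
  rw [this, comp_zero]

lemma cl_nat {X X' : ModuleCat.{u} R} (P : ProjectiveResolution X) (Q : ProjectiveResolution X')
    (a : X ⟶ X') (l : P.complex ⟶ Q.complex) (comm : l.f 0 ≫ Q.π.f 0 = P.π.f 0 ≫ a)
    (n : ℕ) (Y : ModuleCat.{u} R) (f : coc Q n Y) :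
    (((Ext R (ModuleCat.{u} R) n).map a.op).app Y).hom (cl Q n Y f) =
      cl P n Y ⟨l.f n ≫ f.1, coc_pull P Q l n Y f.2⟩ := by
  let ρ : Opposite.op (ModuleCat.of R (coc P n Y)) ⟶ Opposite.op (ModuleCat.of R (coc Q n Y)) :=
    Quiver.Hom.op (ModuleCat.ofHom
      { toFun := fun f => ⟨l.f n ≫ f.1, coc_pull P Q l n Y f.2⟩
        map_add' := fun x y => Subtype.ext (Preadditive.comp_add _ _ _ _ _ _)
        map_smul' := fun r x => Subtype.ext (Linear.comp_smul _ _ _ _ _ _) })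
  have h1 := ProjectiveResolution.isoLeftDerivedObj_hom_naturality a P Q l comm (FY Y) n
  have h2 : ((FY Y).leftDerived n).map a ≫ cl' Q n Y = cl' P n Y ≫ ρ := by
    have h1' : ((FY Y).leftDerived n).map a ≫ (isoK Q n Y).hom = (isoK P n Y).hom ≫
      HomologicalComplex.homologyMap (((FY Y).mapHomologicalComplex _).map l) n := h1
    unfold cl'
    rw [reassoc_of% h1', Category.assoc, Category.assoc, HomologicalComplex.homologyι_naturality_assoc]
    congr 2
    rw [← cancel_epi ((KK P Y).pOpcycles n)]
    rw [HomologicalComplex.p_opcyclesMap_assoc, p_dO, reassoc_of% (p_dO P n Y)]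
    rfl
  exact congrArg (fun h => h.unop.hom f) h2

lemma smul_aux {A B : ModuleCat.{u} R} (r : R) (f : A ⟶ B) : (r • 𝟙 A) ≫ f = f ≫ (r • 𝟙 B) := by
  simp

lemma zero_aux {A B : ModuleCat.{u} R} (f : A ⟶ B) : (0 : A ⟶ A) ≫ f = f ≫ (0 : B ⟶ B) := by
  simp

/-- augmentation -/
noncomputable def aug {X : ModuleCat.{u} R} (P : ProjectiveResolution X) : P.complex.X 0 ⟶ X :=
  P.π.f 0

lemma cl_torsion {X : ModuleCat.{u} R} (P : ProjectiveResolution X) (n : ℕ)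
    (Y : ModuleCat.{u} R) (r : R) (hr : ∀ x : X, r • x = 0) (f : coc P n Y) :
    r • cl P n Y f = 0 := by
  have h0 : r • (𝟙 X) = 0 := by ext x; exact hr x
  have h := cl_nat P P (r • 𝟙 X) (r • 𝟙 _) (smul_aux r (aug P)) n Y f
  have h1 : (⟨(r • 𝟙 P.complex : P.complex ⟶ P.complex).f n ≫ f.1, coc_pull P P _ n Y f.2⟩ : coc P n Y) = r • f := by
    apply Subtype.ext
    simp
  rw [h1, map_smul] at h
  rw [← h, h0]
  rw [cl_nat P P 0 0 (zero_aux (aug P)) n Y f]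
  have h2 : (⟨(0 : P.complex ⟶ P.complex).f n ≫ f.1, coc_pull P P _ n Y f.2⟩ : coc P n Y) = 0 := by
    apply Subtype.ext
    simp
  rw [h2, map_zero]

end LCx
end

section
open CategoryTheory Limits

universe u
namespace LCx
variable {R : Type u} [CommRing R] (m : Ideal R)

noncomputable def Xt (t : ℕ) : ModuleCat.{u} R := ModuleCat.of R (R ⧸ m ^ t)

noncomputable def Pt (t : ℕ) : ProjectiveResolution (Xt m t) := projectiveResolution (Xt m t)

noncomputable def qt {t s : ℕ} (h : t ≤ s) : Xt m s ⟶ Xt m t :=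
  ModuleCat.ofHom (Submodule.mapQ (m ^ s) (m ^ t) LinearMap.id (Ideal.pow_le_pow_right h))

noncomputable def lam {t s : ℕ} (h : t ≤ s) : (Pt m s).complex ⟶ (Pt m t).complex :=
  ProjectiveResolution.lift (qt m h) _ _

lemma lam_aug {t s : ℕ} (h : t ≤ s) : (lam m h).f 0 ≫ aug (Pt m t) = aug (Pt m s) ≫ qt m h :=
  ProjectiveResolution.lift_commutes_zero _ _ _

noncomputable abbrev HL (n : ℕ) (Y : ModuleCat.{u} R) : ModuleCat.{u} R :=
  (localCohomology m n).obj Y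

noncomputable abbrev dg (n : ℕ) : (ℕᵒᵖ)ᵒᵖ ⥤ ModuleCat.{u} R ⥤ ModuleCat.{u} R :=
  localCohomology.diagram (localCohomology.idealPowersDiagram m) n

noncomputable def cocone (n : ℕ) : Cocone (dg m n) :=
  have := localCohomology.hasColimitDiagram.{u, 0} (localCohomology.idealPowersDiagram m) n
  colimit.cocone (dg m n)

noncomputable def coconeIs (n : ℕ) : IsColimit (cocone m n) :=
  have := localCohomology.hasColimitDiagram.{u, 0} (localCohomology.idealPowersDiagram m) n
  colimit.isColimit (dg m n)

noncomputable def coconeY (n : ℕ) (Y : ModuleCat.{u} R) : Cocone (dg m n ⋙ (evaluation _ _).obj Y) :=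
  ((evaluation _ _).obj Y).mapCocone (cocone m n)

noncomputable def coconeYIs (n : ℕ) (Y : ModuleCat.{u} R) : IsColimit (coconeY m n Y) :=
  isColimitOfPreserves _ (coconeIs m n)

noncomputable def iot (n t : ℕ) (Y : ModuleCat.{u} R) : ExtO (Xt m t) Y n →ₗ[R] HL m n Y :=
  ((coconeY m n Y).ι.app (Opposite.op (Opposite.op t))).hom

noncomputable def Cl (n t : ℕ) (Y : ModuleCat.{u} R) : coc (Pt m t) n Y →ₗ[R] HL m n Y :=
  (iot m n t Y).comp (cl (Pt m t) n Y)

instance filt : IsFiltered (ℕᵒᵖ)ᵒᵖ :=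
  IsFiltered.of_equivalence (opOpEquivalence ℕ).symm

instance presForget : PreservesFilteredColimitsOfSize.{0, 0} (forget (ModuleCat.{u} R)) :=
  preservesFilteredColimitsOfSize_shrink.{0, u, 0, u} _

lemma Cl_surj (n : ℕ) (Y : ModuleCat.{u} R) (h : HL m n Y) : ∃ t f, Cl m n t Y f = h := by
  obtain ⟨j, y, hy⟩ := Concrete.isColimit_exists_rep _ (coconeYIs m n Y) h
  obtain ⟨f, hf⟩ := cl_surj (Pt m j.unop.unop) n Y y
  refine ⟨j.unop.unop, f, ?_⟩
  rw [← hy]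
  change iot m n _ Y (cl _ n Y f) = _
  rw [hf]
  rfl

lemma Cl_lam (n : ℕ) (Y : ModuleCat.{u} R) {t s : ℕ} (h : t ≤ s) (f : coc (Pt m t) n Y) :
    Cl m n s Y ⟨(lam m h).f n ≫ f.1, coc_pull _ _ _ n Y f.2⟩ = Cl m n t Y f := by
  change iot m n s Y (cl _ n Y _) = iot m n t Y (cl _ n Y _)
  rw [← cl_nat (Pt m s) (Pt m t) (qt m h) (lam m h) (lam_aug m h)]
  have := (coconeY m n Y).w (homOfLE h).op.op
  exact congrArg (fun k => k.hom (cl _ n Y f)) this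

lemma Cl_eq_zero' (n : ℕ) (Y : ModuleCat.{u} R) {t : ℕ} (f : coc (Pt m t) n Y)
    (hf : Cl m n t Y f = 0) (j : ℕ) (hj : (ComplexShape.down ℕ).next n = j) :
    ∃ s, ∃ h : t ≤ s, ∃ g : (Pt m s).complex.X j ⟶ Y,
      (lam m h).f n ≫ f.1 = (Pt m s).complex.d n j ≫ g := by
  have h0 : (coconeY m n Y).ι.app (Opposite.op (Opposite.op t)) (cl (Pt m t) n Y f) =
    (coconeY m n Y).ι.app (Opposite.op (Opposite.op t)) (cl (Pt m t) n Y 0) := by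
    have : Cl m n t Y f = Cl m n t Y 0 := by rw [hf, map_zero]
    exact this
  obtain ⟨k, a, b, hab⟩ := Concrete.isColimit_exists_of_rep_eq _ (coconeYIs m n Y) _ _ h0
  have hts : t ≤ k.unop.unop := leOfHom a.unop.unop
  refine ⟨k.unop.unop, hts, ?_⟩
  have ha : a = (homOfLE hts).op.op := rfl
  have hb : b = (homOfLE hts).op.op := rfl
  have h1 : ((dg m n ⋙ (evaluation _ _).obj Y).map (homOfLE hts).op.op).hom (cl _ n Y f) = 0 := by
    rw [ha, hb, map_zero] at hab
    exact hab.trans (map_zero ((dg m n ⋙ (evaluation _ _).obj Y).map (homOfLE hts).op.op).hom)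
  have h2 := cl_nat (Pt m k.unop.unop) (Pt m t) (qt m hts) (lam m hts) (lam_aug m hts) n Y f
  have h3 := h2.symm.trans h1
  exact (cl_eq_zero _ n j hj _ _).1 h3

lemma Cl_bdry (n : ℕ) (Y : ModuleCat.{u} R) {t : ℕ} (f : coc (Pt m t) n Y)
    (j : ℕ) (hj : (ComplexShape.down ℕ).next n = j) (g : (Pt m t).complex.X j ⟶ Y)
    (hg : f.1 = (Pt m t).complex.d n j ≫ g) : Cl m n t Y f = 0 := by
  have : cl _ n Y f = 0 := (cl_eq_zero _ n j hj Y f).2 ⟨g, hg⟩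
  change iot m n t Y (cl _ n Y _) = 0
  rw [this, map_zero]

lemma Cl_tors (n : ℕ) (Y : ModuleCat.{u} R) {t : ℕ} (f : coc (Pt m t) n Y) (r : R) (hr : r ∈ m ^ t) :
    r • Cl m n t Y f = 0 := by
  have : r • cl _ n Y f = 0 := by
    apply cl_torsion
    intro x
    obtain ⟨y, rfl⟩ := Submodule.Quotient.mk_surjective _ (x : R ⧸ m ^ t)
    exact (Submodule.Quotient.mk_eq_zero (m ^ t)).2 (Ideal.mul_mem_right _ _ hr)
  change r • iot m n t Y (cl _ n Y _) = 0
  rw [← map_smul, this, map_zero]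

end LCx
end

section
open CategoryTheory Limits

universe u
namespace LCx
variable {R : Type u} [CommRing R] (m : Ideal R)

lemma equiv_of_rel {A B : Type*} [AddCommGroup A] [Module R A] [AddCommGroup B] [Module R B]
    (Γ : Submodule R (A × B)) (h1 : ∀ a, ∃ b, (a, b) ∈ Γ) (h2 : ∀ b, ∃ a, (a, b) ∈ Γ)
    (h3 : ∀ a, (a, (0 : B)) ∈ Γ → a = 0) (h4 : ∀ b, ((0 : A), b) ∈ Γ → b = 0) :
    Nonempty (A ≃ₗ[R] B) := by
  let f : Γ →ₗ[R] A := (LinearMap.fst R A B).comp Γ.subtype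
  let g : Γ →ₗ[R] B := (LinearMap.snd R A B).comp Γ.subtype
  have hf : Function.Bijective f := by
    constructor
    · rw [injective_iff_map_eq_zero]
      rintro ⟨⟨a, b⟩, h⟩ h'
      have : a = 0 := h'
      subst this
      have := h4 b h
      subst this
      rfl
    · intro a
      obtain ⟨b, hb⟩ := h1 a
      exact ⟨⟨(a, b), hb⟩, rfl⟩
  have hg : Function.Bijective g := by
    constructor
    · rw [injective_iff_map_eq_zero]
      rintro ⟨⟨a, b⟩, h⟩ h'
      have : b = 0 := h'
      subst this
      have := h3 a h
      subst this
      rfl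
    · intro b
      obtain ⟨a, hb⟩ := h2 b
      exact ⟨⟨(a, b), hb⟩, rfl⟩
  exact ⟨(LinearEquiv.ofBijective f hf).symm.trans (LinearEquiv.ofBijective g hg)⟩

/-- data for multiplication by x -/
structure XD (x : R) {M N : ModuleCat.{u} R} (π : M ⟶ N) : Prop where
  reg : ∀ y : M, x • y = 0 → y = 0
  surj : Function.Surjective π.hom
  ker : ∀ y : M, π.hom y = 0 → ∃ z : M, y = x • z
  ker' : ∀ z : M, π.hom (x • z) = 0

variable {m}

section
variable {x : R} {M N : ModuleCat.{u} R} {π : M ⟶ N} (D : XD x π)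
include D

lemma XD.lift {A : ModuleCat.{u} R} (g : A ⟶ M) (hg : g ≫ π = 0) : ∃ g', g = x • g' := by
  have h : ∀ a : A, ∃ z : M, g.hom a = x • z := fun a =>
    D.ker _ (congrArg (fun k => k.hom a) hg)
  choose z hz using h
  have cancel : ∀ y y' : M, x • y = x • y' → y = y' := by
    intro y y' h
    rw [← sub_eq_zero]
    apply D.reg
    rw [smul_sub, h, sub_self]
  refine ⟨ModuleCat.ofHom
    { toFun := z
      map_add' := fun a b => cancel _ _ (by rw [smul_add, ← hz, ← hz, ← hz, map_add])
      map_smul' := fun r a => cancel _ _ (by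
        rw [RingHom.id_apply, smul_comm, ← hz, ← hz, map_smul]) }, ?_⟩
  ext a
  exact hz a

lemma XD.cancel {A : ModuleCat.{u} R} (g g' : A ⟶ M) (h : x • g = x • g') : g = g' := by
  rw [← sub_eq_zero]
  have h1 : x • (g - g') = 0 := by rw [smul_sub, h, sub_self]
  ext a
  exact D.reg _ (congrArg (fun k => k.hom a) h1)

lemma XD.comp_zero {A : ModuleCat.{u} R} (g : A ⟶ M) : (x • g) ≫ π = 0 := by
  ext a
  exact D.ker' _

lemma XD.proj {A : ModuleCat.{u} R} [Projective A] (b : A ⟶ N) : ∃ g, g ≫ π = b := by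
  have : Epi π := (ModuleCat.epi_iff_surjective _).2 D.surj
  exact ⟨Projective.factorThru b π, Projective.factorThru_comp _ _⟩

lemma XD.coc1 {n t : ℕ} {g : (Pt m t).complex.X n ⟶ M} {a : (Pt m t).complex.X (n+1) ⟶ M}
    (h : (Pt m t).complex.d (n+1) n ≫ g = x • a) : a ∈ coc (Pt m t) (n+1) M := by
  change _ ≫ _ = 0
  apply D.cancel
  rw [← Linear.comp_smul, ← h, HomologicalComplex.d_comp_d_assoc, zero_comp, smul_zero]

lemma XD.coc2 {n t : ℕ} {g : (Pt m t).complex.X n ⟶ M} {a : (Pt m t).complex.X (n+1) ⟶ M}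
    (h : (Pt m t).complex.d (n+1) n ≫ g = x • a) : g ≫ π ∈ coc (Pt m t) n N := by
  change _ ≫ _ = 0
  rw [← Category.assoc, h, D.comp_zero]

/-- the relation -/
noncomputable def XD.rel {n t : ℕ} {g : (Pt m t).complex.X n ⟶ M} {a : (Pt m t).complex.X (n+1) ⟶ M}
    (h : (Pt m t).complex.d (n+1) n ≫ g = x • a) : HL m (n+1) M × HL m n N :=
  (Cl m (n+1) t M ⟨a, D.coc1 h⟩, Cl m n t N ⟨g ≫ π, D.coc2 h⟩)

lemma pull_eq {n t s : ℕ} (hts : t ≤ s) {g : (Pt m t).complex.X n ⟶ M} {a : (Pt m t).complex.X (n+1) ⟶ M}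
    (h : (Pt m t).complex.d (n+1) n ≫ g = x • a) :
    (Pt m s).complex.d (n+1) n ≫ ((lam m hts).f n ≫ g) = x • ((lam m hts).f (n+1) ≫ a) := by
  rw [← HomologicalComplex.Hom.comm_assoc, h, Linear.comp_smul]

lemma XD.rel_pull {n t s : ℕ} (hts : t ≤ s) {g : (Pt m t).complex.X n ⟶ M}
    {a : (Pt m t).complex.X (n+1) ⟶ M}
    (h : (Pt m t).complex.d (n+1) n ≫ g = x • a) :
    D.rel h = D.rel (pull_eq D hts h) := by
  unfold XD.rel
  rw [← Cl_lam m (n+1) M hts, ← Cl_lam m n N hts]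
  congr 3

/-- the relation -/
def XD.Gam (n : ℕ) : Submodule R (HL m (n+1) M × HL m n N) where
  carrier := {z | ∃ t, ∃ g : (Pt m t).complex.X n ⟶ M, ∃ a : (Pt m t).complex.X (n+1) ⟶ M,
    ∃ h : (Pt m t).complex.d (n+1) n ≫ g = x • a, D.rel h = z}
  add_mem' := by
    rintro _ _ ⟨t, g, a, h, rfl⟩ ⟨t', g', a', h', rfl⟩
    rw [D.rel_pull (le_max_left t t') h, D.rel_pull (le_max_right t t') h']
    have e := pull_eq D (le_max_left t t') h
    have e' := pull_eq D (le_max_right t t') h'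
    refine ⟨max t t', (lam m (le_max_left t t')).f n ≫ g + (lam m (le_max_right t t')).f n ≫ g',
      (lam m (le_max_left t t')).f (n+1) ≫ a + (lam m (le_max_right t t')).f (n+1) ≫ a', ?_, ?_⟩
    · rw [Preadditive.comp_add, e, e', smul_add]
    · unfold XD.rel
      rw [Prod.mk_add_mk, ← map_add, ← map_add]
      congr 2
      apply Subtype.ext
      exact Preadditive.add_comp _ _ _ _ _ _
  zero_mem' := by
    refine ⟨0, 0, 0, by simp, ?_⟩
    unfold XD.rel
    refine Prod.ext ?_ ?_
    · exact (map_zero _)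
    · refine Eq.trans ?_ (map_zero (Cl m n 0 N))
      dsimp only
      congr 1
      apply Subtype.ext
      exact zero_comp
  smul_mem' := by
    rintro r _ ⟨t, g, a, h, rfl⟩
    refine ⟨t, r • g, r • a, by rw [Linear.comp_smul, h, smul_comm], ?_⟩
    have e : (⟨(r • g) ≫ π, D.coc2 (a := r • a) (by rw [Linear.comp_smul, h, smul_comm])⟩ :
        coc (Pt m t) n N) = r • ⟨g ≫ π, D.coc2 h⟩ :=
      Subtype.ext (Linear.smul_comp _ _ _ _ _ _)
    unfold XD.rel
    rw [Prod.smul_mk, ← map_smul, ← map_smul, e]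
    rfl

lemma XD.g1 (n : ℕ) (a : HL m (n+1) M) (ha : x • a = 0) : ∃ b, (a, b) ∈ D.Gam (m := m) n := by
  obtain ⟨t, f, rfl⟩ := Cl_surj m _ _ a
  rw [← map_smul] at ha
  obtain ⟨s, hs, g, hg⟩ := Cl_eq_zero' m _ _ _ ha n (by simp)
  have h : (Pt m s).complex.d (n+1) n ≫ g = x • ((lam m hs).f (n+1) ≫ f.1) := by
    rw [← hg]
    exact Linear.comp_smul _ _ _ _ _ _
  refine ⟨_, s, g, _, h, Prod.ext ?_ rfl⟩
  exact Cl_lam m _ _ hs f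

lemma XD.g1' (n : ℕ) (a : HL m (n+1) M) (b) (h : (a, b) ∈ D.Gam (m := m) n) : x • a = 0 := by
  obtain ⟨t, g, a, h, hr⟩ := h
  have hr1 := (Prod.ext_iff.1 hr).1
  dsimp only at hr1
  rw [← hr1]
  unfold XD.rel
  dsimp only
  rw [← map_smul]
  exact Cl_bdry m _ _ _ n (by simp) g h.symm

lemma XD.g2 (n : ℕ) (b : HL m n N) : ∃ a, (a, b) ∈ D.Gam (m := m) n := by
  obtain ⟨t, f, rfl⟩ := Cl_surj m _ _ b
  obtain ⟨g, hg⟩ := D.proj f.1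
  have h0 : (Pt m t).complex.d (n+1) n ≫ f.1 = 0 := f.2
  rw [← hg, ← Category.assoc] at h0
  obtain ⟨a, ha⟩ := D.lift _ h0
  refine ⟨_, t, g, a, ha, Prod.ext rfl ?_⟩
  unfold XD.rel
  dsimp only
  congr 1
  exact Subtype.ext hg

lemma XD.g3 (n : ℕ) (a : HL m (n+1) M) (h : (a, 0) ∈ D.Gam (m := m) n) : a = 0 := by
  obtain ⟨t, g, a, h, hr⟩ := h
  obtain ⟨hr1, hr2⟩ := Prod.ext_iff.1 hr
  dsimp only at hr1 hr2
  rw [← hr1]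
  unfold XD.rel at hr2 ⊢
  dsimp only at hr2 ⊢
  obtain ⟨s, hs, k, hk⟩ := Cl_eq_zero' m _ _ _ hr2 _ rfl
  obtain ⟨k', hk'⟩ := D.proj k
  have h1 : ((lam m hs).f n ≫ g - (Pt m s).complex.d n _ ≫ k') ≫ π = 0 := by
    rw [Preadditive.sub_comp, Category.assoc, Category.assoc, hk', hk, sub_self]
  obtain ⟨g', hg'⟩ := D.lift _ h1
  rw [← Cl_lam m _ _ hs]
  refine Cl_bdry m _ _ _ n (by simp) g' ?_
  apply D.cancel
  dsimp only
  rw [← Linear.comp_smul, ← Linear.comp_smul, ← hg', ← h, Preadditive.comp_sub,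
    HomologicalComplex.d_comp_d_assoc, zero_comp, sub_zero, HomologicalComplex.Hom.comm_assoc]

lemma XD.g4 (n : ℕ) (hv : ∀ z : HL m n M, z = 0) (b : HL m n N)
    (h : (0, b) ∈ D.Gam (m := m) n) : b = 0 := by
  obtain ⟨t, g, a, h, hr⟩ := h
  obtain ⟨hr1, hr2⟩ := Prod.ext_iff.1 hr
  dsimp only at hr1 hr2
  rw [← hr2]
  unfold XD.rel at hr1 ⊢
  dsimp only at hr1 ⊢
  obtain ⟨s, hs, g', hg'⟩ := Cl_eq_zero' m _ _ _ hr1 n (by simp)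
  have h1 : (lam m hs).f n ≫ g - x • g' ∈ coc (Pt m s) n M := by
    change _ ≫ _ = 0
    rw [Preadditive.comp_sub, Linear.comp_smul, ← hg', pull_eq D hs h, sub_self]
  obtain ⟨s', hs', k, hk⟩ := Cl_eq_zero' m _ _ _ (hv (Cl m n s M ⟨_, h1⟩)) _ rfl
  rw [← Cl_lam m _ _ hs, ← Cl_lam m _ _ hs']
  refine Cl_bdry m _ _ _ _ rfl (k ≫ π) ?_
  dsimp only at hk ⊢
  rw [← Category.assoc ((Pt m s').complex.d _ _), ← hk, Category.assoc, Preadditive.sub_comp,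
    D.comp_zero, sub_zero, Category.assoc]

end

end LCx
end

section
open CategoryTheory Limits
open scoped Pointwise

universe u
namespace LCx
variable {R : Type u} [CommRing R] {m : Ideal R}

lemma HL_tors {n : ℕ} {Y : ModuleCat.{u} R} (h : HL m n Y) : ∃ t, ∀ r ∈ m ^ t, r • h = 0 := by
  obtain ⟨t, f, rfl⟩ := Cl_surj m _ _ h
  exact ⟨t, fun r hr => Cl_tors m n Y f r hr⟩

/-- elements killed by a list -/
def kl (rs : List R) (H : Type*) [AddCommGroup H] [Module R H] : Submodule R H where
  carrier := {h | ∀ r ∈ rs, r • h = 0}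
  add_mem' hx hy := fun a ha => by rw [smul_add, hx a ha, hy a ha, add_zero]
  zero_mem' := fun a _ => smul_zero a
  smul_mem' := fun r x hx a ha => by rw [smul_comm, hx a ha, smul_zero]

lemma vanish_aux {n : ℕ} {Y : ModuleCat.{u} R} {x : R} (hx : x ∈ m)
    (H : ∀ h : HL m n Y, x • h = 0 → h = 0) (h : HL m n Y) : h = 0 := by
  obtain ⟨t, ht⟩ := HL_tors h
  have h1 : ∀ k, x ^ k • h = 0 → h = 0 := by
    intro k
    induction k with
    | zero => intro h; simpa using h
    | succ k ih =>
      intro h'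
      apply ih
      apply H
      rw [smul_smul, ← pow_succ', h']
  exact h1 t (ht _ (Ideal.pow_mem_pow hx t))

lemma vanish0 {x : R} (hx : x ∈ m) {M : ModuleCat.{u} R} (reg : ∀ y : M, x • y = 0 → y = 0)
    (h : HL m 0 M) : h = 0 := by
  refine vanish_aux hx ?_ h
  clear h
  intro h hh
  obtain ⟨t, f, rfl⟩ := Cl_surj m _ _ h
  rw [← map_smul] at hh
  obtain ⟨s, hs, g, hg⟩ := Cl_eq_zero' m _ _ _ hh 0 (by simp)
  have h0 : (Pt m s).complex.d 0 0 = 0 := HomologicalComplex.shape _ _ _ (by simp)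
  rw [h0, zero_comp] at hg
  rw [← Cl_lam m _ _ hs]
  refine Cl_bdry m _ _ _ 0 (by simp) 0 ?_
  dsimp only
  rw [comp_zero]
  ext a
  apply reg
  exact congrArg (fun k => k.hom a) hg

lemma xd_quot {x : R} (M : Type u) [AddCommGroup M] [Module R M] (hx : IsSMulRegular M x) :
    XD x (ModuleCat.ofHom (Submodule.mkQ (x • (⊤ : Submodule R M))) :
      ModuleCat.of R M ⟶ ModuleCat.of R (QuotSMulTop x M)) where
  reg := fun y hy => hx (by simpa using hy)
  surj := Submodule.mkQ_surjective _
  ker := by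
    intro y hy
    have : y ∈ x • (⊤ : Submodule R M) := (Submodule.Quotient.mk_eq_zero _).1 hy
    obtain ⟨z, -, hz⟩ := this
    exact ⟨z, hz.symm⟩
  ker' := by
    intro z
    exact (Submodule.Quotient.mk_eq_zero _).2 (Submodule.smul_mem_pointwise_smul _ _ _ trivial)

open RingTheory.Sequence

lemma vanish {rs : List R} : ∀ (M : Type u) [AddCommGroup M] [Module R M],
    IsWeaklyRegular M rs → (∀ r ∈ rs, r ∈ m) → ∀ n, n < rs.length →
    ∀ h : HL m n (ModuleCat.of R M), h = 0 := by
  induction rs with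
  | nil => intro M _ _ _ _ n hn; simp at hn
  | cons x rs ih =>
    intro M _ _ hreg hm n hn h
    rw [isWeaklyRegular_cons_iff] at hreg
    have hx : x ∈ m := hm x (by simp)
    have D := xd_quot M hreg.1
    cases n with
    | zero => exact vanish0 hx D.reg h
    | succ n =>
      refine vanish_aux hx ?_ h
      intro h hh
      obtain ⟨b, hb⟩ := D.g1 (m := m) n h hh
      have := ih (QuotSMulTop x M) hreg.2 (fun r hr => hm r (by simp [hr])) n (by simpa using hn) b
      subst this
      exact D.g3 n h hb

lemma base_equiv (M : Type u) [AddCommGroup M] [Module R M] (k : ℕ)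
    (hk : ∀ r ∈ m ^ k, ∀ y : M, r • y = 0) :
    Nonempty (M ≃ₗ[R] HL m 0 (ModuleCat.of R M)) := by
  have hks : ∀ s, k ≤ s → ∀ r ∈ m ^ s, ∀ y : M, r • y = 0 :=
    fun s hs r hr y => hk r (Ideal.pow_le_pow_right hs hr) y
  let ρ : ∀ s, k ≤ s → M → (Xt m s ⟶ ModuleCat.of R M) := fun s hs y =>
    ModuleCat.ofHom (Submodule.liftQ (m ^ s) (LinearMap.toSpanSingleton R M y)
      (fun r hr => by simpa using hks s hs r hr y))
  have hcoc : ∀ s (q : Xt m s ⟶ ModuleCat.of R M), aug (Pt m s) ≫ q ∈ coc (Pt m s) 0 (ModuleCat.of R M) := by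
    intro s q
    change _ ≫ _ = 0
    rw [← Category.assoc]
    have : (Pt m s).complex.d 1 0 ≫ aug (Pt m s) = 0 := (Pt m s).complex_d_comp_π_f_zero
    rw [this, zero_comp]
  have epi : ∀ s, Epi (aug (Pt m s)) := fun s => inferInstanceAs (Epi ((Pt m s).π.f 0))
  have ex : ∀ s (f : (Pt m s).complex.X 0 ⟶ ModuleCat.of R M), f ∈ coc (Pt m s) 0 (ModuleCat.of R M) →
      ∃ q : Xt m s ⟶ ModuleCat.of R M, f = aug (Pt m s) ≫ q := by
    intro s f hf
    have := epi s
    have h0 : (Pt m s).complex.d 1 0 ≫ aug (Pt m s) = 0 := (Pt m s).complex_d_comp_π_f_zero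
    have he : (ShortComplex.mk _ _ h0).Exact := (Pt m s).exact₀
    exact ⟨he.desc f hf, (he.g_desc f hf).symm⟩
  have ρadd : ∀ s hs a b, ρ s hs (a + b) = ρ s hs a + ρ s hs b := by
    intro s hs a b
    apply ModuleCat.hom_ext
    apply LinearMap.ext
    intro z
    obtain ⟨z, rfl⟩ := Submodule.Quotient.mk_surjective _ z
    exact smul_add z a b
  have ρsmul : ∀ s hs (r : R) b, ρ s hs (r • b) = r • ρ s hs b := by
    intro s hs r b
    apply ModuleCat.hom_ext
    apply LinearMap.ext
    intro z
    obtain ⟨z, rfl⟩ := Submodule.Quotient.mk_surjective _ z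
    exact smul_comm z r b
  let Ψ : M →ₗ[R] HL m 0 (ModuleCat.of R M) := (Cl m 0 k (ModuleCat.of R M)).comp
    ({ toFun := fun y => ⟨aug (Pt m k) ≫ ρ k le_rfl y, hcoc k _⟩
       map_add' := by
        intro a b
        apply Subtype.ext
        change _ = _ ≫ _ + _ ≫ _
        rw [← Preadditive.comp_add, ρadd k le_rfl]
       map_smul' := by
        intro r b
        apply Subtype.ext
        change _ = r • (_ ≫ _)
        rw [← Linear.comp_smul, ρsmul k le_rfl] } : M →ₗ[R] coc (Pt m k) 0 (ModuleCat.of R M))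
  have hΨ : ∀ s (hs : k ≤ s) y, Cl m 0 s (ModuleCat.of R M) ⟨aug (Pt m s) ≫ ρ s hs y, hcoc s _⟩ = Ψ y := by
    intro s hs y
    change _ = Cl m 0 k (ModuleCat.of R M) ⟨aug (Pt m k) ≫ ρ k le_rfl y, hcoc k _⟩
    rw [← Cl_lam m _ _ hs]
    congr 1
    apply Subtype.ext
    dsimp only
    rw [← Category.assoc, lam_aug, Category.assoc]
    congr 1
    ext z
    obtain ⟨z, rfl⟩ := Submodule.Quotient.mk_surjective _ z
    rfl
  refine ⟨LinearEquiv.ofBijective Ψ ⟨?_, ?_⟩⟩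
  · rw [injective_iff_map_eq_zero]
    intro y hy
    obtain ⟨s, hs, g, hg⟩ := Cl_eq_zero' m _ _ _ hy 0 (by simp)
    have h0 : (Pt m s).complex.d 0 0 = 0 := HomologicalComplex.shape _ _ _ (by simp)
    rw [h0, zero_comp] at hg
    have hg' : (lam m hs).f 0 ≫ aug (Pt m k) ≫ ρ k le_rfl y = 0 := hg
    rw [← Category.assoc, lam_aug, Category.assoc] at hg'
    have := epi s
    have h1 : qt m hs ≫ ρ k le_rfl y = 0 := by
      rw [← cancel_epi (aug (Pt m s)), hg', comp_zero]
    have h2 := congrArg (fun q => q.hom (Submodule.Quotient.mk (1 : R) : R ⧸ m ^ s)) h1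
    have h3 : (1 : R) • y = 0 := h2
    simpa using h3
  · intro h
    obtain ⟨t, f, rfl⟩ := Cl_surj m _ _ h
    rw [← Cl_lam m _ _ (le_max_right k t)]
    obtain ⟨q, hq⟩ := ex _ _ (coc_pull (Pt m (max k t)) (Pt m t) (lam m (le_max_right k t)) 0 (ModuleCat.of R M) f.2)
    let y : M := q.hom (Submodule.Quotient.mk (1 : R) : R ⧸ m ^ (max k t))
    refine ⟨y, ?_⟩
    rw [← hΨ _ (le_max_left k t) y]
    congr 1
    apply Subtype.ext
    dsimp only
    rw [hq]
    congr 1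
    ext z
    obtain ⟨z, rfl⟩ := Submodule.Quotient.mk_surjective _ z
    change z • q.hom (Submodule.Quotient.mk (1 : R) : R ⧸ m ^ (max k t)) = _
    refine (map_smul q.hom z (Submodule.Quotient.mk (1 : R) : R ⧸ m ^ (max k t))).symm.trans ?_
    refine congrArg q.hom ?_
    exact (Submodule.Quotient.mk_smul (m ^ (max k t)) (r := z) (x := (1:R))).symm.trans (by rw [smul_eq_mul, mul_one])

theorem socle_equiv {rs : List R} : ∀ (M : Type u) [AddCommGroup M] [Module R M],
    IsWeaklyRegular M rs → (∀ r ∈ rs, r ∈ m) →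
    (∃ k : ℕ, ∀ r ∈ m ^ k, ∀ y : M, r • y ∈ Ideal.ofList rs • (⊤ : Submodule R M)) →
    Nonempty ((M ⧸ (Ideal.ofList rs • (⊤ : Submodule R M))) ≃ₗ[R]
      kl rs (HL m rs.length (ModuleCat.of R M))) := by
  induction rs with
  | nil =>
    intro M _ _ _ _ ⟨k, hk⟩
    obtain ⟨e⟩ := base_equiv (m := m) M k (fun r hr y => by simpa using hk r hr y)
    have h1 : kl ([] : List R) (HL m 0 (ModuleCat.of R M)) = ⊤ := by
      exact eq_top_iff.2 (fun h _ r hr => absurd hr List.not_mem_nil)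
    have h2 : Ideal.ofList ([] : List R) • (⊤ : Submodule R M) = ⊥ := by simp
    exact ⟨(Submodule.quotEquivOfEqBot _ h2).trans (e.trans (LinearEquiv.ofTop _ h1).symm)⟩
  | cons x rs ih =>
    intro M _ _ hreg hm ⟨k, hk⟩
    have hv := vanish (m := m) M hreg hm
    rw [isWeaklyRegular_cons_iff] at hreg
    have hx : x ∈ m := hm x (by simp)
    have D := xd_quot M hreg.1
    let e2 := Submodule.quotOfListConsSMulTopEquivQuotSMulTopInner M x rs
    obtain ⟨e1⟩ := ih (QuotSMulTop x M) hreg.2 (fun r hr => hm r (by simp [hr])) (by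
      refine ⟨k, fun r hr y => ?_⟩
      rw [← Submodule.Quotient.mk_eq_zero]
      obtain ⟨z, hz⟩ := e2.surjective (Submodule.Quotient.mk y)
      rw [Submodule.Quotient.mk_smul, ← hz, ← map_smul]
      obtain ⟨z, rfl⟩ := Submodule.Quotient.mk_surjective _ z
      rw [← Submodule.Quotient.mk_smul, (Submodule.Quotient.mk_eq_zero _).2 (hk r hr z), map_zero])
    let G := D.Gam (m := m) rs.length
    let A := kl (x :: rs) (HL m (rs.length + 1) (ModuleCat.of R M))
    let B := kl rs (HL m rs.length (ModuleCat.of R (QuotSMulTop x M)))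
    have hAB : ∀ a b, (a, b) ∈ G → (a ∈ A ↔ b ∈ B) := by
      intro a b hab
      constructor
      · intro ha r hr
        apply D.g4 (m := m) rs.length (hv _ (by simp)) 
        have := G.smul_mem r hab
        rw [Prod.smul_mk, ha r (by simp [hr])] at this
        exact this
      · intro hb r hr
        rcases List.mem_cons.1 hr with rfl | hr
        · exact D.g1' _ a b hab
        · apply D.g3 (m := m) rs.length
          have := G.smul_mem r hab
          rw [Prod.smul_mk, hb r hr] at this
          exact this
    obtain ⟨e3⟩ := equiv_of_rel (G.comap (A.subtype.prodMap B.subtype))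
      (by
        rintro ⟨a, ha⟩
        obtain ⟨b, hb⟩ := D.g1 (m := m) rs.length a (ha x (by simp))
        exact ⟨⟨b, (hAB a b hb).1 ha⟩, hb⟩)
      (by
        rintro ⟨b, hb⟩
        obtain ⟨a, ha⟩ := D.g2 (m := m) rs.length b
        exact ⟨⟨a, (hAB a b ha).2 hb⟩, ha⟩)
      (by
        rintro ⟨a, ha⟩ h
        exact Subtype.ext (D.g3 _ a h))
      (by
        rintro ⟨b, hb⟩ h
        exact Subtype.ext (D.g4 _ (hv _ (by simp)) b h))
    exact ⟨e2.trans (e1.trans e3.symm)⟩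

end LCx
end

section
open CategoryTheory Limits Abelian
open scoped Pointwise
open RingTheory.Sequence IsLocalRing

universe u
namespace LCx
variable {R : Type u} [CommRing R] [IsLocalRing R] [IsNoetherianRing R]

lemma ass_step (M : Type u) [AddCommGroup M] [Module R M] [Module.Finite R M] {x : R}
    (hxm : x ∈ maximalIdeal R) (hx : IsSMulRegular M x) {P : Ideal R} (hP : IsAssociatedPrime P M) :
    ∃ Q : Ideal R, IsAssociatedPrime Q (QuotSMulTop x M) ∧ P ≤ Q ∧ x ∈ Q ∧ x ∉ P := by
  have hxP : ∀ (y : M), x • y = 0 → y = 0 := fun y hy => hx (by simpa using hy)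
  obtain ⟨hpr, n, hn⟩ := isAssociatedPrime_iff.1 hP
  have hn' : ∀ r, r ∈ P ↔ r • n = 0 := by
    intro r; rw [hn, Submodule.mem_colon_singleton, Submodule.mem_bot]
  have hn0 : n ≠ 0 := by
    rintro rfl
    apply hpr.ne_top
    rw [Ideal.eq_top_iff_one, hn']; simp
  have hxnP : x ∉ P := fun h => hn0 (hxP n ((hn' x).1 h))
  let K := annIn P M
  have hK : ¬ K ≤ Ideal.span {x} • K := by
    intro h
    have := Submodule.eq_bot_of_le_smul_of_le_jacobson_bot (Ideal.span {x}) K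
      (IsNoetherian.noetherian K) h (by
        rw [IsLocalRing.jacobson_eq_maximalIdeal _ bot_ne_top, Ideal.span_le]
        simpa using hxm)
    have hnK : n ∈ K := fun r hr => (hn' r).1 hr
    rw [this] at hnK
    exact hn0 (by simpa using hnK)
  obtain ⟨k, hk, hk'⟩ := Set.not_subset.1 hK
  have hkx : (Submodule.Quotient.mk k : QuotSMulTop x M) ≠ 0 := by
    intro h
    obtain ⟨y, -, hy⟩ := (Submodule.Quotient.mk_eq_zero _).1 h
    change x • y = k at hy
    apply hk'
    rw [← hy]
    refine Submodule.smul_mem_smul (Ideal.mem_span_singleton_self x) ?_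
    intro r hr
    apply hxP
    rw [smul_comm, hy]
    exact hk r hr
  obtain ⟨Q, hQ, hQ'⟩ := exists_le_isAssociatedPrime_of_isNoetherianRing R _ hkx
  refine ⟨Q, hQ, ?_, ?_, hxnP⟩
  · intro r hr
    apply hQ'
    rw [Submodule.mem_colon_singleton, ← Submodule.Quotient.mk_smul, hk r hr]
    simp
  · apply hQ'
    rw [Submodule.mem_colon_singleton, ← Submodule.Quotient.mk_smul, Submodule.mem_bot,
      Submodule.Quotient.mk_eq_zero]
    exact Submodule.smul_mem_pointwise_smul _ _ _ trivial

lemma ass_dim {rs : List R} : ∀ (M : Type u) [AddCommGroup M] [Module R M] [Module.Finite R M],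
    IsWeaklyRegular M rs → (∀ r ∈ rs, r ∈ maximalIdeal R) → ∀ P : Ideal R, IsAssociatedPrime P M →
    (rs.length : WithBot ℕ∞) ≤ ringKrullDim (R ⧸ P) := by
  induction rs with
  | nil =>
    intro M _ _ _ _ _ P hP
    have := hP.isPrime
    simp only [List.length_nil, Nat.cast_zero]
    exact ringKrullDim_nonneg_of_nontrivial
  | cons x rs ih =>
    intro M _ _ _ hreg hm P hP
    rw [isWeaklyRegular_cons_iff] at hreg
    obtain ⟨Q, hQ, hPQ, hxQ, hxP⟩ := ass_step M (hm x (by simp)) hreg.1 hP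
    have h1 := ih (QuotSMulTop x M) hreg.2 (fun r hr => hm r (by simp [hr])) Q hQ
    have := hP.isPrime
    have h2 : ringKrullDim (R ⧸ Q) + 1 ≤ ringKrullDim (R ⧸ P) :=
      ringKrullDim_succ_le_of_surjective (Ideal.Quotient.factor hPQ)
        (Ideal.Quotient.factor_surjective hPQ) (r := Ideal.Quotient.mk P x)
        (mem_nonZeroDivisors_of_ne_zero (by rwa [Ne, Ideal.Quotient.eq_zero_iff_mem]))
        (by simpa [Ideal.Quotient.eq_zero_iff_mem] using hxQ)
    refine le_trans ?_ h2
    push_cast [List.length_cons]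
    gcongr

lemma dim_le {P : Ideal R} [P.IsPrime] {as : List R} (hm : ∀ r ∈ as, r ∈ maximalIdeal R)
    (h : ∀ Q : Ideal R, Q.IsPrime → P ≤ Q → (∀ r ∈ as, r ∈ Q) → Q = maximalIdeal R) :
    ringKrullDim (R ⧸ P) ≤ as.length := by
  classical
  let s : Finset (R ⧸ P) := (as.map (Ideal.Quotient.mk P)).toFinset
  have hloc : IsLocalRing (R ⧸ P) := IsLocalRing.of_surjective' _ Ideal.Quotient.mk_surjective
  have hmm : (s : Set (R ⧸ P)) ⊆ Ring.jacobson (R ⧸ P) := by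
    rw [IsLocalRing.ringJacobson_eq_maximalIdeal]
    intro y hy
    simp only [s, List.coe_toFinset, List.mem_map, Set.mem_ofPred_eq] at hy
    obtain ⟨a, ha, rfl⟩ := hy
    have : IsLocalHom (Ideal.Quotient.mk P) := IsLocalHom.of_surjective _ Ideal.Quotient.mk_surjective
    exact fun hu => (hm a ha) (isUnit_of_map_unit (Ideal.Quotient.mk P) a hu)
  have h1 := ringKrullDim_le_ringKrullDim_quotient_add_card s hmm
  have h2 : ringKrullDim ((R ⧸ P) ⧸ Ideal.span (s : Set (R ⧸ P))) ≤ 0 := by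
    rw [ringKrullDim_quotient]
    have : Subsingleton (PrimeSpectrum.zeroLocus (R := R ⧸ P) (Ideal.span (s : Set (R ⧸ P)))) := by
      have key : ∀ Q : PrimeSpectrum (R ⧸ P), Q ∈ PrimeSpectrum.zeroLocus (R := R ⧸ P) (Ideal.span (s : Set (R ⧸ P))) →
          Q.asIdeal.comap (Ideal.Quotient.mk P) = maximalIdeal R := by
        intro Q hQ
        refine h _ (Ideal.IsPrime.comap _) ?_ ?_
        · intro r hr
          rw [Ideal.mem_comap, (Ideal.Quotient.eq_zero_iff_mem).2 hr]; simp
        · intro r hr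
          exact hQ (Ideal.subset_span (by
            simp only [s, List.coe_toFinset, List.mem_map, Set.mem_ofPred_eq]
            exact ⟨r, hr, rfl⟩))
      constructor
      rintro ⟨Q, hQ⟩ ⟨Q', hQ'⟩
      have := (key Q hQ).trans (key Q' hQ').symm
      apply Subtype.ext
      apply PrimeSpectrum.ext
      exact Ideal.comap_injective_of_surjective _ Ideal.Quotient.mk_surjective this
    exact Order.krullDim_nonpos_of_subsingleton
  refine h1.trans ?_
  have h3 : (s.card : WithBot ℕ∞) ≤ as.length := by
    have : s.card ≤ as.length := (List.toFinset_card_le _).trans (by simp)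
    exact_mod_cast this
  calc _ ≤ (0 : WithBot ℕ∞) + as.length := add_le_add h2 h3
    _ = _ := zero_add _

lemma depth_exch (M : Type u) [AddCommGroup M] [Module R M] [Module.Finite R M] [Nontrivial M]
    {rs : List R} {a : R} (hreg : IsWeaklyRegular M rs) (hm : ∀ r ∈ rs, r ∈ maximalIdeal R)
    (ham : a ∈ maximalIdeal R) (ha : IsSMulRegular M a) (d : ℕ) (hd : rs.length = d + 1) :
    ∃ rs' : List R, rs'.length = d ∧ (∀ r ∈ rs', r ∈ maximalIdeal R) ∧
      IsWeaklyRegular (QuotSMulTop a M) rs' := by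
  have lt : ∀ (N : Type u) [AddCommGroup N] [Module R N] [Module.Finite R N] [Nontrivial N],
      maximalIdeal R • (⊤ : Submodule R N) < ⊤ := fun N _ _ _ _ =>
    (Submodule.top_ne_ideal_smul_of_le_jacobson_annihilator (maximalIdeal_le_jacobson _)).symm.lt_top
  have h1 := (ModuleCat.exists_isRegular_tfae (maximalIdeal R) (d + 1) (ModuleCat.of R M) (lt M)).out 3 1
  have h2 := h1.1 ⟨rs, hd, hm, IsRegular.of_isWeaklyRegular_of_mem_maximalIdeal M hm hreg⟩
  have : Nontrivial (QuotSMulTop a M) := nontrivial_quotSMulTop_of_mem_maximalIdeal M ham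
  obtain ⟨rs', h3, h4, h5⟩ := ((ModuleCat.exists_isRegular_tfae (maximalIdeal R) d
    (ModuleCat.of R (QuotSMulTop a M)) (lt _)).out 1 3).1 (by
      intro i hi
      have zero1 := AddCommGrpCat.isZero_of_iff_subsingleton.mpr (h2 i (by omega))
      have zero2 := AddCommGrpCat.isZero_of_iff_subsingleton.mpr (h2 (i + 1) (by omega))
      exact AddCommGrpCat.subsingleton_of_isZero <| ShortComplex.Exact.isZero_of_both_zeros
        ((Ext.covariant_sequence_exact₃' _ (IsSMulRegular.smulShortComplex_shortExact (M := ModuleCat.of R M) ha)) i (i + 1) rfl)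
        (zero1.eq_zero_of_src _) (zero2.eq_zero_of_tgt _))
  exact ⟨rs', h3, h4, h5.1⟩

theorem sop_regular {as : List R} : ∀ (M : Type u) [AddCommGroup M] [Module R M] [Module.Finite R M]
    (rs : List R), IsWeaklyRegular M rs → (∀ r ∈ rs, r ∈ maximalIdeal R) →
    rs.length = as.length → (∀ r ∈ as, r ∈ maximalIdeal R) →
    (∀ Q : Ideal R, Q.IsPrime → Module.annihilator R M ≤ Q → (∀ r ∈ as, r ∈ Q) → Q = maximalIdeal R) →
    IsWeaklyRegular M as := by
  induction as with
  | nil => intro M _ _ _ rs _ _ _ _ _; exact IsWeaklyRegular.nil R M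
  | cons a as ih =>
    intro M _ _ _ rs hreg hm hl ham hQ
    rw [isWeaklyRegular_cons_iff]
    have haM : IsSMulRegular M a := by
      by_contra h
      have h1 : a ∈ ⋃ p ∈ associatedPrimes R M, (p : Set R) := by
        rw [biUnion_associatedPrimes_eq_compl_regular]; exact h
      simp only [Set.mem_iUnion] at h1
      obtain ⟨P, hP, haP⟩ := h1
      have := hP.isPrime
      have h2 := ass_dim M hreg hm P hP
      have h3 : ringKrullDim (R ⧸ P) ≤ as.length := dim_le (fun r hr => ham r (by simp [hr])) (by
        intro Q hQp hPQ hr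
        refine hQ Q hQp (Submodule.annihilator_top.symm.le.trans (hP.annihilator_le.trans hPQ)) ?_
        intro r hr'
        rcases List.mem_cons.1 hr' with rfl | h
        · exact hPQ haP
        · exact hr r h)
      have h4 := h2.trans h3
      have h5 : rs.length ≤ as.length := by exact_mod_cast h4
      simp at hl
      omega
    refine ⟨haM, ?_⟩
    rcases subsingleton_or_nontrivial M with hs | hnt
    · have : Subsingleton (QuotSMulTop a M) := inferInstance
      exact ⟨fun i hi y z _ => Subsingleton.elim _ _⟩
    obtain ⟨rs', h1, h2, h3⟩ := depth_exch M hreg hm (ham a (by simp)) haM as.length (by simpa using hl)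
    refine ih (QuotSMulTop a M) rs' h3 h2 h1 (fun r hr => ham r (by simp [hr])) ?_
    intro Q hQp hann hr
    refine hQ Q hQp ?_ ?_
    · refine le_trans ?_ hann
      exact LinearMap.annihilator_le_of_surjective (Submodule.mkQ _) (Submodule.mkQ_surjective _)
    · intro r hr'
      rcases List.mem_cons.1 hr' with rfl | h
      · apply hann
        rw [Module.mem_annihilator]
        intro y
        obtain ⟨y, rfl⟩ := Submodule.Quotient.mk_surjective _ y
        rw [← Submodule.Quotient.mk_smul, Submodule.Quotient.mk_eq_zero]
        exact Submodule.smul_mem_pointwise_smul _ _ _ trivial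
      · exact hr r h

end LCx
end

section
open scoped Pointwise
open RingTheory.Sequence IsLocalRing

universe u
namespace LCx

theorem reg_domain (n : ℕ) : ∀ (R : Type u) [CommRing R] [IsLocalRing R] [IsNoetherianRing R]
    (y : Fin n → R), maximalIdeal R = Ideal.span (Set.range y) → ringKrullDim R = n →
    IsDomain R ∧ ∃ rs : List R, rs.length = n ∧ (∀ r ∈ rs, r ∈ maximalIdeal R) ∧ IsWeaklyRegular R rs := by
  induction n with
  | zero =>
    intro R _ _ _ y hy hd
    refine ⟨?_, [], rfl, by simp, IsWeaklyRegular.nil R R⟩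
    have hy' : maximalIdeal R = ⊥ := by rw [hy, Set.range_eq_empty]; simp
    exact ((IsLocalRing.isField_iff_maximalIdeal_eq).2 hy').isDomain
  | succ n ih =>
    intro R _ _ _ y hy hd
    have hfin : ({maximalIdeal R ^ 2} ∪ minimalPrimes R : Set (Ideal R)).Finite :=
      (Set.finite_singleton _).union (minimalPrimes.finite_of_isNoetherianRing R)
    have hym : ∀ i, y i ∈ maximalIdeal R := fun i => by rw [hy]; exact Ideal.subset_span ⟨i, rfl⟩
    have hnmin : maximalIdeal R ∉ minimalPrimes R := by
      intro h
      have h0 : ringKrullDim R ≤ 0 := by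
        have : Subsingleton (PrimeSpectrum R) := by
          constructor
          intro a b
          have key : ∀ a : PrimeSpectrum R, a.asIdeal = maximalIdeal R := fun a =>
            le_antisymm (le_maximalIdeal a.2.ne_top) (h.2 ⟨a.2, bot_le⟩ (le_maximalIdeal a.2.ne_top))
          exact PrimeSpectrum.ext ((key a).trans (key b).symm)
        exact Order.krullDim_nonpos_of_subsingleton
      rw [hd] at h0
      have : n + 1 ≤ 0 := by exact_mod_cast h0
      omega
    obtain ⟨x, hxm, hx⟩ : ∃ x ∈ maximalIdeal R, ∀ Q ∈ ({maximalIdeal R ^ 2} ∪ minimalPrimes R : Set (Ideal R)), x ∉ Q := by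
      by_contra! hcon
      have h1 : (maximalIdeal R : Set R) ⊆ ⋃ Q ∈ ({maximalIdeal R ^ 2} ∪ minimalPrimes R : Set (Ideal R)), (Q : Set R) := by
        intro x hx
        obtain ⟨Q, hQ, hxQ⟩ := hcon x hx
        exact Set.mem_biUnion hQ hxQ
      obtain ⟨Q, hQ, hle⟩ := (Ideal.subset_union_prime_finite hfin (f := fun Q => Q) (maximalIdeal R ^ 2) (maximalIdeal R ^ 2) (by
        intro Q hQ hne _
        rcases hQ with hQ | hQ
        · exact absurd hQ hne
        · exact hQ.1.1)).1 h1
      have hmQ : maximalIdeal R ≤ Q := hle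
      rcases hQ with hQ | hQ
      · rw [Set.mem_singleton_iff.1 hQ] at hmQ
        have hbot : maximalIdeal R = ⊥ := Submodule.eq_bot_of_le_smul_of_le_jacobson_bot (maximalIdeal R) _
          (IsNoetherian.noetherian _) (by rwa [smul_eq_mul, ← pow_two])
          (IsLocalRing.jacobson_eq_maximalIdeal _ bot_ne_top).ge
        have hF := (IsLocalRing.isField_iff_maximalIdeal_eq).2 hbot
        rw [ringKrullDim_eq_zero_of_isField hF] at hd
        have : 0 = n + 1 := by exact_mod_cast hd
        omega
      · have : maximalIdeal R = Q := le_antisymm hmQ (le_maximalIdeal hQ.1.1.ne_top)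
        exact hnmin (this ▸ hQ)
    have hx2 : x ∉ maximalIdeal R ^ 2 := hx _ (Or.inl rfl)
    obtain ⟨a, ha⟩ := (Ideal.mem_span_range_iff_exists_fun).1 (hy ▸ hxm)
    obtain ⟨i, hi⟩ : ∃ i, IsUnit (a i) := by
      by_contra! hcon
      apply hx2
      rw [← ha, pow_two]
      exact Ideal.sum_mem _ fun i _ => Ideal.mul_mem_mul (hcon i) (hym i)
    rw [Fin.sum_univ_succAbove _ i] at ha
    let z : Fin n → R ⧸ Ideal.span {x} := fun j => Ideal.Quotient.mk _ (y (i.succAbove j))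
    have hnt : Nontrivial (R ⧸ Ideal.span {x}) := Ideal.Quotient.nontrivial_iff.2 (by
      intro h
      have : Ideal.span {x} ≤ maximalIdeal R := by simpa [Ideal.span_le] using hxm
      rw [h] at this
      exact (maximalIdeal.isMaximal R).ne_top (top_le_iff.1 this))
    have hloc : IsLocalRing (R ⧸ Ideal.span {x}) := IsLocalRing.of_surjective' _ Ideal.Quotient.mk_surjective
    have hlh : IsLocalHom (Ideal.Quotient.mk (Ideal.span {x})) := IsLocalHom.of_surjective _ Ideal.Quotient.mk_surjective
    have hmax : ∀ r, Ideal.Quotient.mk (Ideal.span {x}) r ∈ maximalIdeal _ ↔ r ∈ maximalIdeal R := by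
      intro r
      rw [mem_maximalIdeal, mem_maximalIdeal, mem_nonunits_iff, mem_nonunits_iff, isUnit_map_iff]
    have hz : maximalIdeal (R ⧸ Ideal.span {x}) = Ideal.span (Set.range z) := by
      apply le_antisymm
      · intro r hr
        obtain ⟨r, rfl⟩ := Ideal.Quotient.mk_surjective r
        have hr' := (hmax r).1 hr
        rw [hy] at hr'
        have : Ideal.span (Set.range y) ≤ (Ideal.span (Set.range z)).comap (Ideal.Quotient.mk (Ideal.span {x})) := by
          rw [Ideal.span_le]
          rintro _ ⟨j, rfl⟩
          have hz' : ∀ j, Ideal.Quotient.mk (Ideal.span {x}) (y (i.succAbove j)) ∈ Ideal.span (Set.range z) :=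
            fun j => Ideal.subset_span ⟨j, rfl⟩
          rcases Fin.eq_self_or_eq_succAbove i j with rfl | ⟨j, rfl⟩
          · change Ideal.Quotient.mk (Ideal.span {x}) _ ∈ Ideal.span (Set.range z)
            have h2 : Ideal.Quotient.mk (Ideal.span {x}) x = 0 :=
              Ideal.Quotient.eq_zero_iff_mem.2 (Ideal.mem_span_singleton_self x)
            have h3 := congrArg (Ideal.Quotient.mk (Ideal.span {x})) ha
            rw [h2, map_add, map_mul] at h3
            rw [← Ideal.unit_mul_mem_iff_mem _ (hi.map (Ideal.Quotient.mk (Ideal.span {x}))), eq_neg_of_add_eq_zero_left h3]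
            apply neg_mem
            rw [map_sum]
            refine Ideal.sum_mem _ fun k _ => ?_
            rw [map_mul]
            exact Ideal.mul_mem_left _ _ (hz' k)
          · exact hz' j
        exact this hr'
      · rw [Ideal.span_le]
        rintro _ ⟨j, rfl⟩
        exact (hmax _).2 (hym _)
    have hdz : ringKrullDim (R ⧸ Ideal.span {x}) = n := by
      apply le_antisymm
      · have h1 : ringKrullDim (R ⧸ Ideal.span {x}) ≤ (maximalIdeal (R ⧸ Ideal.span {x})).spanFinrank :=
          ringKrullDim_le_spanFinrank_maximalIdeal _
        refine h1.trans ?_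
        have h2 : (maximalIdeal (R ⧸ Ideal.span {x})).spanFinrank ≤ n := by
          rw [hz]
          refine (Submodule.spanFinrank_span_le_ncard_of_finite (Set.finite_range z)).trans ?_
          rw [← Set.image_univ]
          refine (Set.ncard_image_le (Set.finite_univ)).trans ?_
          simp [Set.ncard_univ]
        exact_mod_cast h2
      · have h1 := ringKrullDim_le_ringKrullDim_quotSMulTop_succ hxm
        rw [hd, ← Submodule.ideal_span_singleton_smul, smul_eq_mul, Ideal.mul_top] at h1
        push_cast at h1
        exact ENat.WithBot.add_le_add_one_right_iff.1 h1
    obtain ⟨hdom, rs, hrs, hrm, hreg⟩ := ih (R ⧸ Ideal.span {x}) z hz hdz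
    have hprime : (Ideal.span {x}).IsPrime := (Ideal.Quotient.isDomain_iff_prime _).1 hdom
    have hD : IsDomain R := by
      obtain ⟨P, hP, hPx⟩ := Ideal.exists_minimalPrimes_le (I := ⊥) (J := Ideal.span {x}) bot_le
      have hxP : x ∉ P := hx P (Or.inr hP)
      have hPp : P.IsPrime := hP.1.1
      have hbot : P = ⊥ := Submodule.eq_bot_of_le_smul_of_le_jacobson_bot (Ideal.span {x}) P
          (IsNoetherian.noetherian _) (by
            intro w hw
            obtain ⟨v, rfl⟩ := Ideal.mem_span_singleton'.1 (hPx hw)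
            have : v ∈ P := (hPp.mem_or_mem hw).resolve_right hxP
            rw [mul_comm]
            exact Ideal.mul_mem_mul (Ideal.mem_span_singleton_self x) this)
          (by rw [IsLocalRing.jacobson_eq_maximalIdeal _ bot_ne_top, Ideal.span_le]; simpa using hxm)
      subst hbot
      exact IsDomain.of_bot_isPrime R
    refine ⟨hD, ?_⟩
    let lift : R ⧸ Ideal.span {x} → R := Function.surjInv Ideal.Quotient.mk_surjective
    have hlift : ∀ r, Ideal.Quotient.mk _ (lift r) = r := Function.surjInv_eq Ideal.Quotient.mk_surjective
    refine ⟨x :: rs.map lift, by simp [hrs], ?_, ?_⟩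
    · intro r hr
      rcases List.mem_cons.1 hr with rfl | hr
      · exact hxm
      · obtain ⟨s, hs, rfl⟩ := List.mem_map.1 hr
        rw [← hmax, hlift]
        exact hrm s hs
    · rw [isWeaklyRegular_cons_iff]
      have hx0 : x ≠ 0 := fun h => hx2 (h ▸ zero_mem _)
      refine ⟨fun a b hab => mul_left_cancel₀ hx0 hab, ?_⟩
      have hre : rs = (rs.map lift).map (algebraMap R (R ⧸ Ideal.span {x})) := by
        rw [List.map_map]
        conv_lhs => rw [← List.map_id rs]
        refine List.map_congr_left fun r _ => ?_
        exact (hlift r).symm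
      rw [hre, isWeaklyRegular_map_algebraMap_iff] at hreg
      have he : (x • ⊤ : Submodule R R) = Ideal.span {x} := by
        rw [← Submodule.ideal_span_singleton_smul, smul_eq_mul, Ideal.mul_top]
      exact ((Submodule.quotEquivOfEq _ _ he).isWeaklyRegular_congr _).2 hreg

end LCx
end

section
open scoped Pointwise
open RingTheory.Sequence IsLocalRing

universe u
namespace LCx

section
variable {R : Type u} [CommRing R] 

lemma last_reg {M : Type*} [AddCommGroup M] [Module R M] {l : List R} {a : R}
    (h : IsWeaklyRegular M (l ++ [a])) (y : M)
    (hy : a • y ∈ Ideal.ofList l • (⊤ : Submodule R M)) : y ∈ Ideal.ofList l • (⊤ : Submodule R M) := by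
  rw [isWeaklyRegular_append_iff, isWeaklyRegular_cons_iff] at h
  have h1 := h.2.1
  rw [← Submodule.Quotient.mk_eq_zero] at hy ⊢
  apply h1
  exact hy.trans (smul_zero a).symm

lemma ofList_map_range (r : ℕ → R) (n : ℕ) :
    Ideal.ofList ((List.range n).map r) = Ideal.span (r '' (Finset.range n : Set ℕ)) := by
  unfold Ideal.ofList
  congr 1
  ext x
  simp

lemma mem_span_rng {r : ℕ → R} {n : ℕ} {x : R} :
    x ∈ Ideal.span (r '' (Finset.range n : Set ℕ)) ↔ ∃ c : ℕ → R, ∑ k ∈ Finset.range n, c k * r k = x := by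
  constructor
  · intro h
    obtain ⟨c, hc⟩ := (Submodule.mem_span_image_finset_iff_exists_fun R).1 h
    refine ⟨fun k => if h : k ∈ Finset.range n then c ⟨k, h⟩ else 0, ?_⟩
    rw [← hc, ← Finset.sum_attach]
    simp
  · rintro ⟨c, rfl⟩
    exact Ideal.sum_mem _ fun k hk => Ideal.mul_mem_left _ _ (Ideal.subset_span ⟨k, hk, rfl⟩)

lemma koszul {E : Type*} [AddCommGroup E] [Module R E] (r : ℕ → R) (n : ℕ) (b : ℕ → E) :
    IsWeaklyRegular R ((List.range n).map r) →
    (∀ i < n, ∀ j < n, r i • b j = r j • b i) → ∀ c : ℕ → R,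
    ∑ k ∈ Finset.range n, c k * r k = 0 → ∑ k ∈ Finset.range n, c k • b k = 0 := by
  induction n with
  | zero => intros; simp
  | succ n ih =>
    intro hreg hb c hc
    rw [List.range_succ, List.map_append, List.map_singleton] at hreg
    rw [Finset.sum_range_succ] at hc ⊢
    have h1 := last_reg hreg (c n) (by
      rw [smul_eq_mul, Ideal.mul_top, ofList_map_range, mem_span_rng]
      refine ⟨fun k => - c k, ?_⟩
      simp only [neg_mul, Finset.sum_neg_distrib, smul_eq_mul]
      linear_combination -hc)
    rw [smul_eq_mul, Ideal.mul_top, ofList_map_range, mem_span_rng] at h1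
    obtain ⟨d, hd⟩ := h1
    have h2 := ih ((isWeaklyRegular_append_iff _ _ _).1 hreg).1
      (fun i hi j hj => hb i (by omega) j (by omega)) (fun k => c k + d k * r n) (by
        rw [← hd, Finset.sum_mul] at hc
        rw [← hc, ← Finset.sum_add_distrib]
        exact Finset.sum_congr rfl fun k _ => by ring)
    rw [← h2, ← hd, Finset.sum_smul, ← Finset.sum_add_distrib]
    refine Finset.sum_congr rfl fun k hk => ?_
    rw [add_smul, mul_smul, mul_smul, hb k (by simp at hk; omega) n (by omega)]

lemma inj_factor {E : Type u} [AddCommGroup E] [Module R E] (hE : Module.Injective R E)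
    {A B : Type u} [AddCommGroup A] [Module R A] [AddCommGroup B] [Module R B]
    (g : A →ₗ[R] B) (f : A →ₗ[R] E) (h : ∀ a, g a = 0 → f a = 0) :
    ∃ k : B →ₗ[R] E, ∀ a, k (g a) = f a := by
  have hle : LinearMap.ker g ≤ LinearMap.ker f := h
  obtain ⟨k, hk⟩ := hE.out ((LinearMap.ker g).liftQ g le_rfl) (by
    rw [← LinearMap.ker_eq_bot]; exact Submodule.ker_liftQ_eq_bot _ _ _ le_rfl) ((LinearMap.ker g).liftQ f hle)
  refine ⟨k, fun a => ?_⟩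
  have := hk (Submodule.Quotient.mk a)
  simpa using this

lemma koszul_ext {E : Type u} [AddCommGroup E] [Module R E] (hE : Module.Injective R E)
    (r : ℕ → R) (n : ℕ) (b : ℕ → E)
    (hreg : IsWeaklyRegular R ((List.range n).map r))
    (hb : ∀ i < n, ∀ j < n, r i • b j = r j • b i) : ∃ q : E, ∀ i < n, r i • q = b i := by
  classical
  let g : (ℕ → R) →ₗ[R] R := ∑ k ∈ Finset.range n, r k • LinearMap.proj k
  let f : (ℕ → R) →ₗ[R] E := ∑ k ∈ Finset.range n, (LinearMap.toSpanSingleton R E (b k)).comp (LinearMap.proj k)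
  have hg : ∀ c, g c = ∑ k ∈ Finset.range n, c k * r k := by
    intro c; simp [g, mul_comm]
  have hf : ∀ c, f c = ∑ k ∈ Finset.range n, c k • b k := by
    intro c; simp [f]
  obtain ⟨k, hk⟩ := inj_factor hE g f (by
    intro c hc
    rw [hf]
    exact koszul r n b hreg hb c (by rw [← hg, hc]))
  refine ⟨k 1, fun i hi => ?_⟩
  have h1 := hk (Pi.single i 1)
  rw [hg, hf] at h1
  simp only [Pi.single_apply, ite_mul, one_mul, zero_mul, ite_smul, one_smul, zero_smul,
    Finset.sum_ite_eq', Finset.mem_range, hi, if_true] at h1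
  rw [← h1, ← map_smul, smul_eq_mul, mul_one]

variable [IsLocalRing R] [IsNoetherianRing R]

lemma reg_gens (hreg : IsRegularLocal R) : ∃ (n : ℕ) (y : ℕ → R),
    maximalIdeal R = Ideal.span (y '' (Finset.range n : Set ℕ)) ∧
    ∀ q, 1 ≤ q → IsWeaklyRegular R ((List.range n).map (fun k => y k ^ q)) := by
  obtain ⟨n, x, hx, hd⟩ := hreg
  obtain ⟨-, rs, hl, hm, hw⟩ := reg_domain n R x hx hd
  let y : ℕ → R := fun k => if h : k < n then x ⟨k, h⟩ else 0
  have hy : maximalIdeal R = Ideal.span (y '' (Finset.range n : Set ℕ)) := by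
    rw [hx]
    congr 1
    ext z
    constructor
    · rintro ⟨i, rfl⟩
      exact ⟨i, by simp, by simp [y]⟩
    · rintro ⟨i, hi, rfl⟩
      have : i < n := by simpa using hi
      exact ⟨⟨i, this⟩, by simp [y, this]⟩
  refine ⟨n, y, hy, fun q hq => ?_⟩
  have hym : ∀ k < n, y k ∈ maximalIdeal R := by
    intro k hk; rw [hy]; exact Ideal.subset_span ⟨k, by simpa using hk, rfl⟩
  refine sop_regular R rs hw hm (by simpa using hl) ?_ ?_
  · intro r hr
    simp only [List.mem_map, List.mem_range] at hr
    obtain ⟨k, hk, rfl⟩ := hr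
    exact Ideal.pow_mem_of_mem _ (hym k hk) q hq
  · intro Q hQ _ h
    refine le_antisymm (le_maximalIdeal hQ.ne_top) ?_
    rw [hy, Ideal.span_le]
    rintro _ ⟨k, hk, rfl⟩
    refine hQ.mem_of_pow_mem q (h _ ?_)
    simp only [List.mem_map, List.mem_range]
    exact ⟨k, by simpa using hk, rfl⟩

end
end LCx
end

section
open IsLocalRing

universe u
namespace LCx

section
variable {R : Type u} [CommRing R] [IsLocalRing R] [IsNoetherianRing R]
  {E : Type u} [AddCommGroup E] [Module R E] (hE : IsInjectiveHullOfResidueField R E)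

include hE

omit [IsNoetherianRing R] in
lemma cogen {N : Type u} [AddCommGroup N] [Module R N] (n : N) (hn : n ≠ 0) :
    ∃ f : N →ₗ[R] E, f n ≠ 0 := by
  obtain ⟨hinj, ι, hι, -⟩ := hE
  obtain ⟨k, hk⟩ := inj_factor hinj (LinearMap.toSpanSingleton R N n)
    (ι.comp (Algebra.linearMap R (ResidueField R))) (by
      intro r hr
      have hr' : r • n = 0 := by simpa using hr
      have hm : r ∈ maximalIdeal R := by
        rw [mem_maximalIdeal, mem_nonunits_iff]
        intro hu
        apply hn
        obtain ⟨v, rfl⟩ := hu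
        have h2 := congrArg (fun y => (↑v⁻¹ : R) • y) hr'
        simpa [smul_smul] using h2
      have : algebraMap R (ResidueField R) r = 0 := (residue_eq_zero_iff r).2 hm
      rw [LinearMap.comp_apply, Algebra.linearMap_apply, this, map_zero])
  refine ⟨k, ?_⟩
  have h1 := hk 1
  simp only [LinearMap.toSpanSingleton_apply, one_smul, LinearMap.comp_apply,
    Algebra.linearMap_apply, map_one] at h1
  rw [h1]
  intro h2
  exact one_ne_zero (hι (h2.trans (map_zero ι).symm))

omit [IsNoetherianRing R] in
lemma ann_ann (L : Ideal R) (r : R) (h : ∀ z ∈ annIn L E, r • z = 0) : r ∈ L := by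
  by_contra hr
  obtain ⟨f, hf⟩ := cogen hE (Ideal.Quotient.mk L r) (by rwa [Ne, Ideal.Quotient.eq_zero_iff_mem])
  apply hf
  have h1 : (Ideal.Quotient.mk L r) = r • (1 : R ⧸ L) := by
    rw [Algebra.smul_def, mul_one]; rfl
  rw [h1, map_smul]
  apply h
  intro a ha
  rw [← map_smul]
  have : a • (1 : R ⧸ L) = 0 := by
    rw [Algebra.smul_def, mul_one]; exact Ideal.Quotient.eq_zero_iff_mem.2 ha
  rw [this, map_zero]

lemma E_tors (z : E) : ∃ k, ∀ r ∈ maximalIdeal R ^ k, r • z = 0 := by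
  obtain ⟨hinj, ι, hι, hess⟩ := hE
  have hx : ∀ x ∈ maximalIdeal R, ∃ k, x ^ k • z = 0 := by
    intro x hx
    let A : ℕ →o Ideal R :=
      { toFun := fun k => LinearMap.ker (LinearMap.toSpanSingleton R E (x ^ k • z))
        monotone' := by
          refine monotone_nat_of_le_succ ?_
          intro k r hr
          have hr' : r • x ^ k • z = 0 := hr
          change r • x ^ (k + 1) • z = 0
          rw [pow_succ', mul_smul, smul_comm, hr', smul_zero] }
    obtain ⟨k, hk⟩ := monotone_stabilizes_iff_noetherian.2 (inferInstanceAs (IsNoetherian R R)) A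
    refine ⟨k, ?_⟩
    by_contra hne
    obtain ⟨w, hw0, hwN, c, hc⟩ := hess (Submodule.span R {x ^ k • z}) (by simpa using hne)
    obtain ⟨r, rfl⟩ := Submodule.mem_span_singleton.1 hwN
    apply hw0
    have h1 : r ∈ A (k + 1) := by
      change r • x ^ (k + 1) • z = 0
      rw [pow_succ', mul_smul, smul_comm, ← hc, ← map_smul]
      have : x • c = 0 := by
        rw [Algebra.smul_def]
        have : algebraMap R (ResidueField R) x = 0 := (residue_eq_zero_iff x).2 hx
        rw [this, zero_mul]
      rw [this, map_zero]
    rw [← hk (k + 1) (by omega)] at h1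
    exact h1
  have hle : maximalIdeal R ≤ Ideal.radical (LinearMap.ker (LinearMap.toSpanSingleton R E z)) := by
    intro x hxm
    obtain ⟨k, hk⟩ := hx x hxm
    exact ⟨k, hk⟩
  obtain ⟨k, hk⟩ := Ideal.exists_pow_le_of_le_radical_of_fg hle (IsNoetherian.noetherian _)
  exact ⟨k, fun r hr => hk hr⟩

omit [IsNoetherianRing R] in
lemma soc_gen : ∃ s : E, s ≠ 0 ∧ (∀ r ∈ maximalIdeal R, r • s = 0) ∧
    ∀ x : E, (∀ r ∈ maximalIdeal R, r • x = 0) → ∃ c : R, x = c • s := by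
  obtain ⟨hinj, ι, hι, hess⟩ := hE
  have hk : ∀ x ∈ maximalIdeal R, ∀ c : ResidueField R, x • c = 0 := by
    intro x hx c
    rw [Algebra.smul_def]
    have : algebraMap R (ResidueField R) x = 0 := (residue_eq_zero_iff x).2 hx
    rw [this, zero_mul]
  refine ⟨ι 1, ?_, ?_, ?_⟩
  · intro h2
    exact one_ne_zero (hι (h2.trans (map_zero ι).symm))
  · intro r hr
    rw [← map_smul, hk r hr, map_zero]
  · intro x hx
    by_cases hx0 : x = 0
    · exact ⟨0, by simp [hx0]⟩
    obtain ⟨w, hw0, hwN, c, hc⟩ := hess (Submodule.span R {x}) (by simpa using hx0)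
    obtain ⟨r, rfl⟩ := Submodule.mem_span_singleton.1 hwN
    have hu : IsUnit r := by
      by_contra h
      exact hw0 (hx r h)
    obtain ⟨v, rfl⟩ := hu
    obtain ⟨c, rfl⟩ := residue_surjective c
    refine ⟨(↑v⁻¹ : R) * c, ?_⟩
    have h1 : residue R c = c • (1 : ResidueField R) := by rw [Algebra.smul_def, mul_one]; rfl
    rw [h1, map_smul] at hc
    rw [mul_smul, hc, smul_smul, Units.inv_mul, one_smul]

lemma matlis_fin (f : E →ₗ[R] E) (k : ℕ) : ∃ r : R, ∀ z ∈ annIn (maximalIdeal R ^ k) E, f z = r • z := by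
  induction k with
  | zero =>
    refine ⟨0, fun z hz => ?_⟩
    have : z = 0 := by simpa using hz 1 (by simp)
    simp [this]
  | succ k ih =>
    obtain ⟨r, hr⟩ := ih
    obtain ⟨s, hs0, hsm, hs⟩ := soc_gen hE
    obtain ⟨n, a, ha⟩ := Submodule.fg_iff_exists_fin_generating_family.1
      (IsNoetherian.noetherian (maximalIdeal R ^ k))
    let W := annIn (maximalIdeal R ^ (k + 1)) E
    let g : W →ₗ[R] (Fin n → E) := LinearMap.pi fun i => (a i) • W.subtype
    obtain ⟨h, hh⟩ := inj_factor hE.1 g ((f - r • LinearMap.id).comp W.subtype) (by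
      intro z hz
      have h1 : (z : E) ∈ annIn (maximalIdeal R ^ k) E := by
        have h2 : maximalIdeal R ^ k ≤ LinearMap.ker (LinearMap.toSpanSingleton R E z) := by
          rw [← ha, Submodule.span_le]
          rintro _ ⟨i, rfl⟩
          exact congrFun hz i
        exact fun r hr => h2 hr
      simp [hr _ h1])
    have hc : ∀ i, ∃ c : R, h (Pi.single i s) = c • s := by
      intro i
      apply hs
      intro r hr
      rw [← map_smul, ← Pi.single_smul, hsm r hr, Pi.single_zero, map_zero]
    choose c hc using hc
    refine ⟨r + ∑ i, c i * a i, fun z hz => ?_⟩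
    have h1 := hh ⟨z, hz⟩
    have h2 : ∀ i, ∃ b : R, a i • z = b • s := by
      intro i
      apply hs
      intro r hr
      rw [smul_smul]
      apply hz
      rw [pow_succ']
      exact Ideal.mul_mem_mul hr (ha ▸ Submodule.subset_span ⟨i, rfl⟩)
    choose b hb using h2
    have h3 : g ⟨z, hz⟩ = ∑ i, b i • (Pi.single i s : Fin n → E) := by
      funext j
      change a j • z = _
      rw [hb]
      simp [Finset.sum_apply, Pi.single_apply]
    rw [h3, map_sum] at h1
    have h4 : f z - r • z = ∑ i, (c i * a i) • z := by
      refine Eq.trans h1.symm (Finset.sum_congr rfl fun i _ => ?_)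
      rw [map_smul, hc, mul_smul, hb, smul_comm]
    rw [add_smul, Finset.sum_smul, ← h4]
    abel

lemma matlis_end (hcomp : IsAdicComplete (maximalIdeal R) R) (f : E →ₗ[R] E) :
    ∃ r : R, ∀ z, f z = r • z := by
  choose r hr using matlis_fin hE f
  obtain ⟨L, hL⟩ := hcomp.prec' r (by
    intro m n hmn
    rw [SModEq.sub_mem, smul_eq_mul, Ideal.mul_top]
    apply ann_ann hE
    intro z hz
    rw [sub_smul, ← hr m z hz, ← hr n z (fun a ha => hz a (Ideal.pow_le_pow_right hmn ha)), sub_self])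
  refine ⟨L, fun z => ?_⟩
  obtain ⟨k, hk⟩ := E_tors hE z
  have h1 := hL k
  rw [SModEq.sub_mem, smul_eq_mul, Ideal.mul_top] at h1
  have h2 := hk _ h1
  rw [sub_smul] at h2
  rw [hr k z hk]
  exact sub_eq_zero.1 h2

/-- annihilator ideal of a submodule -/
lemma dbl_ann (hcomp : IsAdicComplete (maximalIdeal R) R) (Z : Submodule R E) (z : E)
    (h : ∀ r : R, (∀ w ∈ Z, r • w = 0) → r • z = 0) : z ∈ Z := by
  by_contra hz
  obtain ⟨f, hf⟩ := cogen hE (Submodule.Quotient.mk z : E ⧸ Z) (by rwa [Ne, Submodule.Quotient.mk_eq_zero])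
  obtain ⟨r, hr⟩ := matlis_end hE hcomp (f.comp Z.mkQ)
  apply hf
  have h1 : f (Submodule.Quotient.mk z) = r • z := hr z
  rw [h1]
  apply h
  intro w hw
  rw [← hr w]
  change f (Submodule.Quotient.mk w) = 0
  rw [(Submodule.Quotient.mk_eq_zero _).2 hw, map_zero]

end
end LCx
end

section
open IsLocalRing

universe u
namespace LCx

section
variable {R : Type u} [CommRing R] [IsLocalRing R]

lemma ext_tors {M Q : Type u} [AddCommGroup M] [Module R M] [AddCommGroup Q] [Module R Q]
    (hM : ∀ z : M, ∃ k, ∀ r ∈ maximalIdeal R ^ k, r • z = 0)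
    (hQ : ∀ f : (maximalIdeal R) →ₗ[R] Q, ∃ q : Q, ∀ r, f r = (r : R) • q)
    (N : Submodule R M) (f : N →ₗ[R] Q) : ∃ F : M →ₗ[R] Q, ∀ x : N, F x = f x := by
  have : Fact (Function.Injective N.subtype) := ⟨N.injective_subtype⟩
  set g := Module.Baer.extensionOfMax N.subtype f with hg
  have htop : g.domain = ⊤ := by
    rw [eq_top_iff]
    intro z _
    by_contra hz
    -- replace z by an element with m z ⊆ D
    obtain ⟨z, hz, hmz⟩ : ∃ z : M, z ∉ g.domain ∧ ∀ r ∈ maximalIdeal R, r • z ∈ g.domain := by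
      obtain ⟨k, hk⟩ := hM z
      have key : ∀ k : ℕ, ∀ z : M, z ∉ g.domain →
          (∀ r ∈ maximalIdeal R ^ k, r • z ∈ g.domain) →
          ∃ z : M, z ∉ g.domain ∧ ∀ r ∈ maximalIdeal R, r • z ∈ g.domain := by
        intro k
        induction k with
        | zero =>
          intro z hz h
          exact absurd (by simpa using h 1 (by simp)) hz
        | succ k ih =>
          intro z hz h
          by_cases hc : ∀ r ∈ maximalIdeal R, r • z ∈ g.domain
          · exact ⟨z, hz, hc⟩
          · push Not at hc
            obtain ⟨r, hr, hrz⟩ := hc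
            refine ih (r • z) hrz ?_
            intro s hs
            rw [smul_smul]
            exact h _ (by rw [pow_succ]; exact Ideal.mul_mem_mul hs hr)
      exact key k z hz (fun r hr => by rw [hk r hr]; exact zero_mem _)
    have hunit : ∀ r : R, r • z ∈ g.domain → r ∈ maximalIdeal R := by
      intro r hr
      rw [mem_maximalIdeal, mem_nonunits_iff]
      rintro ⟨v, rfl⟩
      apply hz
      have := g.domain.smul_mem (↑v⁻¹ : R) hr
      simpa [smul_smul] using this
    let l : (maximalIdeal R) →ₗ[R] Q :=
      { toFun := fun r => g.toLinearPMap ⟨(r : R) • z, hmz r r.2⟩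
        map_add' := by
          intro a b
          rw [← LinearPMap.map_add]
          congr 1
          ext; simp [add_smul]
        map_smul' := by
          intro a b
          rw [RingHom.id_apply, ← LinearPMap.map_smul]
          congr 1
          ext; simp [mul_smul] }
    have hl : ∀ r (hr : r ∈ maximalIdeal R), l ⟨r, hr⟩ = g.toLinearPMap ⟨r • z, hmz r hr⟩ :=
      fun _ _ => rfl
    obtain ⟨q, hq⟩ := hQ l
    have H : ∀ c : R, c • z = 0 → c • q = 0 := by
      intro c hc
      have hcm : c ∈ maximalIdeal R := hunit c (by rw [hc]; exact zero_mem _)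
      rw [← hq ⟨c, hcm⟩, hl]
      have : (⟨c • z, hmz c hcm⟩ : g.domain) = 0 := by ext; simpa using hc
      rw [this, LinearPMap.map_zero]
    let s : M →ₗ.[R] Q := LinearPMap.mkSpanSingleton' (σ := RingHom.id R) z q H
    have hcompat : ∀ (x : g.domain) (y : s.domain), (x : M) = y →
        g.toLinearPMap x = s y := by
      rintro ⟨x, hx⟩ ⟨y, hy⟩ hxy
      obtain ⟨r, rfl⟩ := Submodule.mem_span_singleton.1 hy
      simp only at hxy
      subst hxy
      rw [LinearPMap.mkSpanSingleton'_apply, RingHom.id_apply]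
      rw [← hq ⟨r, hunit r hx⟩, hl]
    let a : Module.Baer.ExtensionOf N.subtype f :=
      { toLinearPMap := g.toLinearPMap.sup s hcompat
        le := le_trans g.le (by rw [LinearPMap.domain_sup]; exact le_sup_left)
        is_extension := by
          intro m
          rw [g.is_extension m]
          exact (LinearPMap.left_le_sup _ _ hcompat).2 rfl }
    have hle : g ≤ a := LinearPMap.left_le_sup _ _ hcompat
    have ha := Module.Baer.extensionOfMax_is_max N.subtype f a hle
    apply hz
    rw [hg, ← ha]
    change z ∈ (g.toLinearPMap.sup s hcompat).domain
    rw [LinearPMap.domain_sup]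
    exact Submodule.mem_sup_right (Submodule.mem_span_singleton_self z)
  refine ⟨g.toFun.comp ((LinearEquiv.ofTop g.domain htop).symm : M →ₗ[R] g.domain), ?_⟩
  intro x
  rw [g.is_extension x]
  rfl

/-- `E` with Frobenius-twisted action. -/
def FrE (R : Type u) (p : ℕ) (E : Type u) : Type u := (fun (_ : Type u) (_ : ℕ) => E) R p

instance {p : ℕ} {E : Type u} [AddCommGroup E] : AddCommGroup (FrE R p E) :=
  inferInstanceAs (AddCommGroup E)

noncomputable instance frMod {p : ℕ} [ExpChar R p] {E : Type u} [AddCommGroup E] [Module R E] :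
    Module R (FrE R p E) :=
  letI : Module R (FrE R p E) := inferInstanceAs (Module R E)
  Module.compHom (FrE R p E) (frobenius R p)

lemma frob_ext [IsNoetherianRing R] (hreg : IsRegularLocal R) (p : ℕ) [Fact p.Prime] [CharP R p]
    {E : Type u} [AddCommGroup E] [Module R E] (hE : Module.Injective R E)
    {M : Type u} [AddCommGroup M] [Module R M]
    (hM : ∀ z : M, ∃ k, ∀ r ∈ maximalIdeal R ^ k, r • z = 0)
    (N : Submodule R M) (θ : N → E) (hadd : ∀ x y, θ (x + y) = θ x + θ y)
    (hsmul : ∀ (r : R) x, θ (r • x) = r ^ p • θ x) :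
    ∃ Θ : M → E, (∀ x y, Θ (x + y) = Θ x + Θ y) ∧ (∀ (r : R) x, Θ (r • x) = r ^ p • Θ x) ∧
      ∀ x : N, Θ x = θ x := by
  have : ExpChar R p := ExpChar.prime Fact.out
  obtain ⟨n, y, hy, hw⟩ := reg_gens hreg
  have hp : 1 ≤ p := (Fact.out : p.Prime).one_le
  have hym : ∀ i < n, y i ∈ maximalIdeal R := by
    intro i hi; rw [hy]; exact Ideal.subset_span ⟨i, by simpa using hi, rfl⟩
  have hdef : ∀ (r : R) (x : E), (HSMul.hSMul r (show FrE R p E from x) : FrE R p E)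
      = (show FrE R p E from (r ^ p • x : E)) := fun _ _ => rfl
  obtain ⟨F, hF⟩ := ext_tors (Q := FrE R p E) hM (by
    intro f
    let b : ℕ → E := fun i => if h : i < n then f ⟨y i, hym i h⟩ else 0
    have hbi : ∀ i (h : i < n), b i = f ⟨y i, hym i h⟩ := fun i h => dif_pos h
    obtain ⟨q, hq⟩ := koszul_ext hE (fun k => y k ^ p) n b (hw p hp) (by
      intro i hi j hj
      rw [hbi i hi, hbi j hj]
      have h1 := f.map_smul (y i) ⟨y j, hym j hj⟩
      have h2 := f.map_smul (y j) ⟨y i, hym i hi⟩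
      have h3 : y i • (⟨y j, hym j hj⟩ : maximalIdeal R) = y j • ⟨y i, hym i hi⟩ := by
        ext; simp [mul_comm]
      rw [h3] at h1
      exact h1.symm.trans h2)
    refine ⟨q, ?_⟩
    have : ∀ r (hr : r ∈ maximalIdeal R) , f ⟨r, hr⟩ = (r • (show FrE R p E from q) : FrE R p E) := by
      intro r hr
      have hr' := hr
      rw [hy, mem_span_rng] at hr'
      obtain ⟨c, hc⟩ := hr'
      let v : ℕ → maximalIdeal R := fun i => if h : i < n then ⟨y i, hym i h⟩ else 0
      have hrv : (⟨r, hr⟩ : maximalIdeal R) = ∑ k ∈ Finset.range n, c k • v k := by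
        ext
        rw [Submodule.coe_sum]
        refine hc.symm.trans ?_
        refine Finset.sum_congr rfl fun k hk => ?_
        simp [v, Finset.mem_range.1 hk]
      rw [hrv, map_sum, ← hc, Finset.sum_smul]
      refine Finset.sum_congr rfl fun k hk => ?_
      rw [map_smul, mul_smul]
      congr 1
      have h1 := hq k (Finset.mem_range.1 hk)
      rw [hbi k (Finset.mem_range.1 hk)] at h1
      have h2 : v k = ⟨y k, hym k (Finset.mem_range.1 hk)⟩ := by simp [v, Finset.mem_range.1 hk]
      rw [h2]
      exact h1.symm
    intro r
    exact this r r.2) N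
    { toFun := fun x => (show FrE R p E from θ x)
      map_add' := hadd
      map_smul' := fun r x => hsmul r x }
  exact ⟨fun x => F x, fun x y => F.map_add x y, fun r x => F.map_smul r x, fun x => hF x⟩

end
end LCx
end

section
open IsLocalRing

universe u
namespace LCx

section
variable {R : Type u} [CommRing R] [IsLocalRing R] [IsNoetherianRing R]
  {p : ℕ} [Fact p.Prime] [CharP R p]
  {E : Type u} [AddCommGroup E] [Module R E]

omit [IsLocalRing R] [IsNoetherianRing R] [Fact p.Prime] [CharP R p] in
lemma nat_ex {φ : FrobeniusMap R E p} (hφ : IsNaturalFrobenius p E φ) (θ : E → E)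
    (hadd : ∀ x y, θ (x + y) = θ x + θ y) (hsmul : ∀ (r : R) x, θ (r • x) = r ^ p • θ x) :
    ∃ v : R, ∀ x, θ x = v • φ.toFun x := by
  obtain ⟨v, hv, -⟩ := hφ 1 le_rfl ⟨θ, hadd, by simpa using hsmul⟩
  exact ⟨v, by simpa using hv⟩

omit [IsLocalRing R] [IsNoetherianRing R] [Fact p.Prime] [CharP R p] in
lemma nat_un {φ : FrobeniusMap R E p} (hφ : IsNaturalFrobenius p E φ) (a b : R)
    (h : ∀ x, a • φ.toFun x = b • φ.toFun x) : a = b := by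
  obtain ⟨v, hv, hv'⟩ := hφ 1 le_rfl ⟨fun x => a • φ.toFun x,
    fun x y => by rw [φ.map_add', smul_add],
    fun r x => by rw [φ.map_smul', pow_one, smul_comm]⟩
  rw [hv' a (by simp), hv' b (by simpa using h)]

omit [IsLocalRing R] [IsNoetherianRing R] [Fact p.Prime] [CharP R p] in
lemma phi_zero (φ : FrobeniusMap R E p) : φ.toFun 0 = 0 := by
  have := φ.map_add' 0 0
  simpa using this

omit [IsLocalRing R] [IsNoetherianRing R] [Fact p.Prime] [CharP R p] in
lemma frob_kill (φ : FrobeniusMap R E p) (L : Ideal R) (r : R) (hr : r ∈ Ideal.frobPow p L) (z : E)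
    (hz : z ∈ annIn L E) : r • φ.toFun z = 0 := by
  have : Ideal.frobPow p L ≤ LinearMap.ker (LinearMap.toSpanSingleton R E (φ.toFun z)) := by
    rw [Ideal.frobPow, Ideal.span_le]
    rintro _ ⟨a, ha, rfl⟩
    change a ^ p • φ.toFun z = 0
    rw [← φ.map_smul', hz a ha, phi_zero]
  exact this hr

lemma pi_tors (hE : IsInjectiveHullOfResidueField R E) {n : ℕ} (z : Fin n → E) :
    ∃ k, ∀ r ∈ maximalIdeal R ^ k, r • z = 0 := by
  choose k hk using fun i => E_tors hE (z i)
  refine ⟨∑ i, k i, fun r hr => ?_⟩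
  ext i
  exact hk i r (Ideal.pow_le_pow_right (Finset.single_le_sum (f := k) (by simp) (Finset.mem_univ i)) hr)

lemma F4 (hreg : IsRegularLocal R) (hE : IsInjectiveHullOfResidueField R E)
    {φ : FrobeniusMap R E p} (hφ : IsNaturalFrobenius p E φ) (K : Ideal R) (r : R)
    (h : ∀ z ∈ annIn K E, r • φ.toFun z = 0) : r ∈ Ideal.frobPow p K := by
  classical
  obtain ⟨n, k, hk⟩ := Submodule.fg_iff_exists_fin_generating_family.1
    (IsNoetherian.noetherian K)
  let g : E →ₗ[R] (Fin n → E) := LinearMap.pi fun i => k i • LinearMap.id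
  have hg : ∀ z i, g z i = k i • z := fun z i => rfl
  have h0 : ∀ z, g z = 0 → r • φ.toFun z = 0 := by
    intro z hz
    apply h
    intro a ha
    have : K ≤ LinearMap.ker (LinearMap.toSpanSingleton R E z) := by
      rw [← hk, Submodule.span_le]
      rintro _ ⟨i, rfl⟩
      change k i • z = 0
      rw [← hg, hz]; rfl
    exact this ha
  have phisub : ∀ a b, φ.toFun (a - b) = φ.toFun a - φ.toFun b := by
    intro a b
    rw [eq_sub_iff_add_eq, ← φ.map_add', sub_add_cancel]
  have hwd : ∀ z z', g z = g z' → r • φ.toFun z = r • φ.toFun z' := by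
    intro z z' hzz
    have := h0 (z - z') (by rw [map_sub, hzz, sub_self])
    rw [phisub, smul_sub, sub_eq_zero] at this
    exact this
  choose pre hpre using fun x : LinearMap.range g => x.2
  obtain ⟨Θ, hadd, hsmul, hext⟩ := frob_ext hreg p hE.1 (M := Fin n → E) (pi_tors hE)
    (LinearMap.range g) (fun x => r • φ.toFun (pre x))
    (fun x y => by
      rw [← smul_add, ← φ.map_add']
      apply hwd
      rw [map_add, hpre, hpre, hpre]; rfl)
    (fun a x => by
      rw [smul_comm, ← φ.map_smul']
      apply hwd
      rw [map_smul, hpre, hpre]; rfl)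
  have hΘ : ∀ z, Θ (g z) = r • φ.toFun z := by
    intro z
    have := hext ⟨g z, z, rfl⟩
    rw [this]
    apply hwd
    rw [hpre]
  choose v hv using fun i : Fin n => nat_ex hφ (fun z => Θ (Pi.single i z))
    (fun x y => by rw [← hadd, Pi.single_add])
    (fun a x => by rw [← hsmul, Pi.single_smul])
  let Θ' : (Fin n → E) →+ E := AddMonoidHom.mk' Θ hadd
  have key : r = ∑ i, v i * k i ^ p := by
    apply nat_un hφ
    intro z
    rw [← hΘ, Finset.sum_smul]
    have : g z = ∑ i, Pi.single i (k i • z) := by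
      rw [Finset.univ_sum_single (fun i => k i • z)]; rfl
    have h2 : Θ (g z) = ∑ i, Θ (Pi.single i (k i • z)) := by
      rw [this]
      exact map_sum Θ' _ _
    rw [h2]
    refine Finset.sum_congr rfl fun i _ => ?_
    rw [hv, φ.map_smul', mul_smul]
  rw [key]
  refine Ideal.sum_mem _ fun i _ => Ideal.mul_mem_left _ _ (Ideal.subset_span ⟨k i, ?_, rfl⟩)
  rw [← hk]; exact Submodule.subset_span ⟨i, rfl⟩

lemma F5 (hreg : IsRegularLocal R) (hcomp : IsAdicComplete (maximalIdeal R) R)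
    (hE : IsInjectiveHullOfResidueField R E)
    {φ : FrobeniusMap R E p} (hφ : IsNaturalFrobenius p E φ) (A : Ideal R) :
    A ≤ Ideal.frobPow p (Ideal.tilde p A) := by
  intro r hr
  apply F4 hreg hE hφ
  intro z hz
  let W : Submodule R E := ⨆ L : { L : Ideal R // A ≤ Ideal.frobPow p L }, annIn L.1 E
  let Y : Submodule R E :=
    { carrier := {z | r • φ.toFun z = 0}
      add_mem' := by
        intro a b (ha : r • φ.toFun a = 0) (hb : r • φ.toFun b = 0)
        change r • φ.toFun (a + b) = 0
        rw [φ.map_add', smul_add, ha, hb, add_zero]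
      zero_mem' := by
        change r • φ.toFun 0 = 0
        rw [phi_zero, smul_zero]
      smul_mem' := by
        intro s a (ha : r • φ.toFun a = 0)
        change r • φ.toFun (s • a) = 0
        rw [φ.map_smul', smul_comm, ha, smul_zero] }
  have hWY : W ≤ Y := by
    refine iSup_le fun L z hz => ?_
    exact frob_kill φ L.1 r (L.2 hr) z hz
  apply hWY
  refine dbl_ann hE hcomp W z ?_
  intro s hs
  apply hz
  rw [Ideal.tilde, Submodule.mem_sInf]
  intro L hL
  apply ann_ann hE
  intro w hw
  exact hs w (Submodule.mem_iSup_of_mem ⟨L, hL⟩ hw)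

end
end LCx
end

section
open IsLocalRing RingTheory.Sequence

universe u
namespace LCx

section
variable {R : Type u} [CommRing R]

/-- The ideal generated by `I` and the powers `x i ^ a i`. -/
def XI (I : Ideal R) {d : ℕ} (x : Fin d → R) (a : Fin d → ℕ) : Ideal R :=
  Ideal.span (Set.range fun i => x i ^ a i) ⊔ I

lemma mem_XI {I : Ideal R} {d : ℕ} {x : Fin d → R} {a : Fin d → ℕ} {r : R} :
    r ∈ XI I x a ↔ ∃ (c : Fin d → R) (i : R), i ∈ I ∧ ∑ j, c j * x j ^ a j + i = r := by
  rw [XI, Submodule.mem_sup]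
  constructor
  · rintro ⟨y, hy, i, hi, rfl⟩
    obtain ⟨c, rfl⟩ := (Ideal.mem_span_range_iff_exists_fun).1 hy
    exact ⟨c, i, hi, rfl⟩
  · rintro ⟨c, i, hi, rfl⟩
    exact ⟨_, (Ideal.mem_span_range_iff_exists_fun).2 ⟨c, rfl⟩, i, hi, rfl⟩

lemma pow_mem_XI (I : Ideal R) {d : ℕ} (x : Fin d → R) (a : Fin d → ℕ) (j : Fin d) :
    x j ^ a j ∈ XI I x a :=
  Ideal.mem_sup_left (Ideal.subset_span ⟨j, rfl⟩)

lemma XI_le {I : Ideal R} {d : ℕ} {x : Fin d → R} {a : Fin d → ℕ} {K : Ideal R}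
    (h : ∀ j, x j ^ a j ∈ K) (hI : I ≤ K) : XI I x a ≤ K := by
  refine sup_le ?_ hI
  rw [Ideal.span_le]
  rintro _ ⟨j, rfl⟩
  exact h j

lemma mk_mem_smul_top {I K : Ideal R} {r : R} :
    Ideal.Quotient.mk I r ∈ (K • ⊤ : Submodule R (R ⧸ I)) ↔ r ∈ K ⊔ I := by
  have h1 : (K • ⊤ : Submodule R (R ⧸ I)) = Submodule.map (Submodule.mkQ I) K := by
    have : (⊤ : Submodule R (R ⧸ I)) = Submodule.map (Submodule.mkQ I) ⊤ := by
      rw [Submodule.map_top, Submodule.range_mkQ]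
    rw [this, ← Submodule.map_smul'', Ideal.smul_eq_mul, Ideal.mul_top]
  rw [h1]
  have h2 : r ∈ Submodule.comap (Submodule.mkQ I) (Submodule.map (Submodule.mkQ I) K) ↔ r ∈ K ⊔ I := by
    rw [Submodule.comap_map_mkQ, sup_comm]
  exact h2

variable [IsLocalRing R] [IsNoetherianRing R] {I : Ideal R} {d : ℕ} {x : Fin d → R}

section
variable
  (hcm : ∃ rs : List R, IsWeaklyRegular (R ⧸ I) rs ∧ (∀ r ∈ rs, r ∈ maximalIdeal R) ∧ rs.length = d)
  (hxm : ∀ i, x i ∈ maximalIdeal R)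
  (hx : ∀ Q : Ideal R, Q.IsPrime → I ≤ Q → (∀ i, x i ∈ Q) → Q = maximalIdeal R)
include hcm hxm hx

lemma list_reg (l : List (Fin d)) (hl : l.Nodup) (hl2 : ∀ i, i ∈ l) (a : Fin d → ℕ) (ha : ∀ i, 1 ≤ a i) :
    IsWeaklyRegular (R ⧸ I) (l.map fun i => x i ^ a i) := by
  obtain ⟨rs, h1, h2, h3⟩ := hcm
  refine sop_regular (R ⧸ I) rs h1 h2 ?_ ?_ ?_
  · rw [h3, List.length_map]
    have : l.toFinset = Finset.univ := by ext i; simp [hl2]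
    rw [← List.toFinset_card_of_nodup hl, this, Finset.card_univ, Fintype.card_fin]
  · intro r hr
    obtain ⟨i, -, rfl⟩ := List.mem_map.1 hr
    exact Ideal.pow_mem_of_mem _ (hxm i) _ (ha i)
  · intro Q hQ hIQ hall
    rw [Ideal.annihilator_quotient] at hIQ
    refine hx Q hQ hIQ fun i => hQ.mem_of_pow_mem (a i) (hall _ (List.mem_map.2 ⟨i, hl2 i, rfl⟩))

lemma C1 (i : Fin d) (b : ℕ) (a : Fin d → ℕ) (r : R)
    (h : x i ^ b * r ∈ XI I x (Function.update a i (a i + b))) : r ∈ XI I x a := by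
  classical
  by_cases h0 : ∃ j, j ≠ i ∧ a j = 0
  · obtain ⟨j, -, hj⟩ := h0
    have := pow_mem_XI I x a j
    rw [hj, pow_zero] at this
    rw [(Ideal.eq_top_iff_one _).2 this]; trivial
  push Not at h0
  rcases Nat.eq_zero_or_pos b with rfl | hb
  · simpa using h
  obtain ⟨c, i0, hi0, hc⟩ := mem_XI.1 h
  let l := (Finset.univ.erase i).toList
  have hlm : ∀ j, j ∈ l ↔ j ≠ i := by intro j; simp [l]
  have hreg := list_reg hcm hxm hx (l ++ [i])
    (by
      rw [List.nodup_append]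
      refine ⟨Finset.nodup_toList _, by simp, ?_⟩
      intro j hj k hk
      rw [List.mem_singleton] at hk
      subst hk
      exact (hlm j).1 hj)
    (by intro j; rw [List.mem_append, hlm, List.mem_singleton]; tauto)
    (Function.update a i b) (by
      intro j
      by_cases hj : j = i
      · subst hj; rw [Function.update_self]; exact hb
      · rw [Function.update_of_ne hj]; exact Nat.one_le_iff_ne_zero.2 (h0 j hj))
  rw [List.map_append, List.map_singleton, Function.update_self] at hreg
  set K := Ideal.ofList (l.map fun j => x j ^ (Function.update a i b) j) with hK
  have hKm : ∀ j, j ≠ i → x j ^ a j ∈ K := by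
    intro j hj
    refine Ideal.subset_span ?_
    refine List.mem_map.2 ⟨j, (hlm j).2 hj, ?_⟩
    rw [Function.update_of_ne hj]
  have h1 := last_reg hreg (Ideal.Quotient.mk I (r - c i * x i ^ a i)) (by
    have : x i ^ b • Ideal.Quotient.mk I (r - c i * x i ^ a i)
        = Ideal.Quotient.mk I (x i ^ b * (r - c i * x i ^ a i)) := by
      rw [Algebra.smul_def, map_mul]; rfl
    rw [this]
    refine mk_mem_smul_top.2 ?_
    have h2 : x i ^ b * (r - c i * x i ^ a i) = ∑ j ∈ Finset.univ.erase i, c j * x j ^ a j + i0 := by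
      have h3 := Finset.add_sum_erase Finset.univ
        (fun j => c j * x j ^ (Function.update a i (a i + b)) j) (Finset.mem_univ i)
      simp only [Function.update_self] at h3
      have h4 : ∑ j ∈ Finset.univ.erase i, c j * x j ^ (Function.update a i (a i + b)) j
          = ∑ j ∈ Finset.univ.erase i, c j * x j ^ a j := by
        refine Finset.sum_congr rfl fun j hj => ?_
        rw [Function.update_of_ne (Finset.ne_of_mem_erase hj)]
      rw [h4] at h3
      rw [mul_sub, ← hc, ← h3, pow_add]
      ring
    rw [h2]
    refine Ideal.add_mem _ (Ideal.mem_sup_left ?_) (Ideal.mem_sup_right hi0)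
    exact Ideal.sum_mem _ fun j hj => Ideal.mul_mem_left _ _ (hKm j (Finset.ne_of_mem_erase hj)))
  have h2 : r - c i * x i ^ a i ∈ K ⊔ I := mk_mem_smul_top.1 h1
  have h3 : K ⊔ I ≤ XI I x a := by
    refine sup_le ?_ le_sup_right
    rw [hK, Ideal.ofList, Ideal.span_le]
    intro s hs
    obtain ⟨j, hj, rfl⟩ := List.mem_map.1 hs
    rw [Function.update_of_ne ((hlm j).1 hj)]
    exact pow_mem_XI I x a j
  have := Ideal.add_mem _ (h3 h2) (Ideal.mul_mem_left _ (c i) (pow_mem_XI I x a i))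
  simpa using this

lemma C2 (s : Finset (Fin d)) (b a : Fin d → ℕ) (r : R)
    (h : (∏ i ∈ s, x i ^ b i) * r ∈ XI I x (fun i => a i + if i ∈ s then b i else 0)) :
    r ∈ XI I x a := by
  classical
  induction s using Finset.induction_on generalizing r with
  | empty => simpa using h
  | insert k s hk ih =>
    apply ih
    rw [Finset.prod_insert hk, mul_assoc] at h
    refine C1 hcm hxm hx k (b k) _ _ ?_
    convert h using 2
    ext j
    by_cases hj : j = k
    · subst hj; simp [hk]
    · simp [hj]

/-- full product version -/
lemma C3 (b t : ℕ) (r : R) (h : (∏ i, x i) ^ b * r ∈ XI I x (fun _ => t + b)) :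
    r ∈ XI I x (fun _ => t) := by
  refine C2 hcm hxm hx Finset.univ (fun _ => b) _ r ?_
  simpa [Finset.prod_pow] using h

lemma K1 (t : ℕ) (v : R) (h : ∀ i, x i ^ t * v ∈ XI I x (fun _ => t + 1)) :
    v ∈ XI I x (fun _ => t + 1) ⊔ Ideal.span {∏ i, x i} := by
  classical
  have h1 : ∀ i, v ∈ XI I x (Function.update (fun _ => t + 1) i 1) := by
    intro i
    refine C1 hcm hxm hx i t _ _ ?_
    convert h i using 2
    ext j
    by_cases hj : j = i
    · subst hj; simp [add_comm]
    · simp [hj]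
  have h2 : ∀ s : Finset (Fin d), v ∈ XI I x (fun _ => t + 1) ⊔ Ideal.span {∏ i ∈ s, x i} := by
    intro s
    induction s using Finset.induction_on with
    | empty => simp
    | insert k s hk ih =>
      obtain ⟨b, hb, y, hy, hbv⟩ := Submodule.mem_sup.1 ih
      obtain ⟨w, rfl⟩ := Ideal.mem_span_singleton.1 hy
      have h3 : (∏ i ∈ s, x i) * w ∈ XI I x (Function.update (fun _ => t + 1) k 1) := by
        have hle : XI I x (fun _ => t + 1) ≤ XI I x (Function.update (fun _ => t + 1) k 1) := by
          refine XI_le (fun j => ?_) le_sup_right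
          by_cases hj : j = k
          · subst hj
            have := pow_mem_XI I x (Function.update (fun _ => t + 1) j 1) j
            rw [Function.update_self, pow_one] at this
            exact Ideal.pow_mem_of_mem _ this _ (by omega)
          · have := pow_mem_XI I x (Function.update (fun _ => t + 1) k 1) j
            rwa [Function.update_of_ne hj] at this
        have h4 := Ideal.sub_mem _ (h1 k) (hle hb)
        rw [← hbv] at h4
        simpa using h4
      have h5 : w ∈ XI I x (Function.update (fun i => if i ∈ s then t else t + 1) k 1) := by
        refine C2 hcm hxm hx s (fun _ => 1) _ _ ?_
        simp only [pow_one]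
        convert h3 using 2
        ext j
        by_cases hj : j = k
        · subst hj; simp [hk]
        · by_cases hjs : j ∈ s <;> simp [hj, hjs]
      have h6 : XI I x (Function.update (fun i => if i ∈ s then t else t + 1) k 1) ≤
          Submodule.comap (LinearMap.mulLeft R (∏ i ∈ s, x i))
            (XI I x (fun _ => t + 1) ⊔ Ideal.span {∏ i ∈ insert k s, x i}) := by
        refine XI_le (fun j => ?_) (fun i hi => ?_)
        · rw [Submodule.mem_comap, LinearMap.mulLeft_apply]
          by_cases hj : j = k
          · subst hj
            rw [Function.update_self, pow_one, Finset.prod_insert hk, mul_comm]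
            exact Ideal.mem_sup_right (Ideal.mem_span_singleton_self _)
          · rw [Function.update_of_ne hj]
            refine Ideal.mem_sup_left ?_
            have h7 := pow_mem_XI I x (fun _ => t + 1) j
            by_cases hjs : j ∈ s
            · rw [if_pos hjs, ← Finset.mul_prod_erase s x hjs]
              have : x j * (∏ i ∈ s.erase j, x i) * x j ^ t = (∏ i ∈ s.erase j, x i) * x j ^ (t + 1) := by
                ring
              rw [this]
              exact Ideal.mul_mem_left _ _ h7
            · rw [if_neg hjs]
              exact Ideal.mul_mem_left _ _ h7
        · rw [Submodule.mem_comap, LinearMap.mulLeft_apply]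
          exact Ideal.mem_sup_left (Ideal.mem_sup_right (Ideal.mul_mem_left _ _ hi))
      have h8 := h6 h5
      rw [Submodule.mem_comap, LinearMap.mulLeft_apply] at h8
      rw [← hbv]
      exact Ideal.add_mem _ (Ideal.mem_sup_left hb) h8
  exact h2 Finset.univ

end

end
end LCx
end

section
open IsLocalRing RingTheory.Sequence

universe u
namespace LCx

/-- socle generators of level t -/
def Good {R : Type u} [CommRing R] (I : Ideal R) {d : ℕ} (x : Fin d → R) {H : Type u} [AddCommGroup H]
    [Module R H] (t : ℕ) (e : H) : Prop :=
  (∀ r : R, r • e = 0 ↔ r ∈ XI I x (fun _ => t)) ∧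
    ∀ h : H, (∀ i, x i ^ t • h = 0) → ∃ a : R, h = a • e

/-- compatible systems of socle generators -/
def IsESys {R : Type u} [CommRing R] (I : Ideal R) {d : ℕ} (x : Fin d → R) {H : Type u}
    [AddCommGroup H] [Module R H] (e : ℕ → H) : Prop :=
  (∀ t, 1 ≤ t → Good I x t (e t)) ∧ (∀ t, 1 ≤ t → e t = (∏ i, x i) • e (t + 1)) ∧
    ∀ h : H, ∃ t, 1 ≤ t ∧ ∃ a : R, h = a • e t

section
variable {R : Type u} [CommRing R] [IsLocalRing R] [IsNoetherianRing R] {I : Ideal R} {d : ℕ}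
  {x : Fin d → R}

lemma exists_pow_le_XI
    (hx : ∀ Q : Ideal R, Q.IsPrime → I ≤ Q → (∀ i, x i ∈ Q) → Q = maximalIdeal R) (a : Fin d → ℕ) :
    ∃ k, maximalIdeal R ^ k ≤ XI I x a := by
  refine Ideal.exists_pow_le_of_le_radical_of_fg ?_ (IsNoetherian.noetherian _)
  rw [Ideal.radical_eq_sInf]
  refine le_sInf ?_
  rintro Q ⟨hQ1, hQ⟩
  rw [hx Q hQ (le_trans le_sup_right hQ1) fun i => hQ.mem_of_pow_mem _ (hQ1 (pow_mem_XI I x a i))]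

lemma XI_le_max (hI : I ≠ ⊤) (hxm : ∀ i, x i ∈ maximalIdeal R) (t : ℕ) (ht : 1 ≤ t) :
    XI I x (fun _ => t) ≤ maximalIdeal R :=
  XI_le (fun j => Ideal.pow_mem_of_mem _ (hxm j) _ ht) (le_maximalIdeal hI)

variable
  (hcm : ∃ rs : List R, IsWeaklyRegular (R ⧸ I) rs ∧ (∀ r ∈ rs, r ∈ maximalIdeal R) ∧ rs.length = d)
  (hxm : ∀ i, x i ∈ maximalIdeal R)
  (hx : ∀ Q : Ideal R, Q.IsPrime → I ≤ Q → (∀ i, x i ∈ Q) → Q = maximalIdeal R)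
include hcm hxm hx

lemma exists_good (t : ℕ) (ht : 1 ≤ t) :
    ∃ e : HL (maximalIdeal R) d (ModuleCat.of R (R ⧸ I)), Good I x t e := by
  let rs := (List.finRange d).map fun i => x i ^ t
  have hK : Ideal.ofList rs ⊔ I = XI I x (fun _ => t) := by
    rw [XI, Ideal.ofList]
    congr 2
    ext r
    simp [rs]
  have h1 := socle_equiv (m := maximalIdeal R) (rs := rs) (R ⧸ I)
    (list_reg hcm hxm hx _ (List.nodup_finRange d) (List.mem_finRange) (fun _ => t) (fun _ => ht))
    (by
      intro r hr
      obtain ⟨i, -, rfl⟩ := List.mem_map.1 hr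
      exact Ideal.pow_mem_of_mem _ (hxm i) _ ht)
    (by
      obtain ⟨k, hk⟩ := exists_pow_le_XI hx (fun _ => t)
      refine ⟨k, fun r hr y => ?_⟩
      obtain ⟨y, rfl⟩ := Ideal.Quotient.mk_surjective y
      have : r • Ideal.Quotient.mk I y = Ideal.Quotient.mk I (r * y) := by
        rw [Algebra.smul_def, map_mul]; rfl
      rw [this]
      refine mk_mem_smul_top.2 ?_
      rw [hK]
      exact Ideal.mul_mem_right _ _ (hk hr))
  have hlen : rs.length = d := by simp [rs]
  rw [hlen] at h1
  obtain ⟨ε⟩ := h1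
  let one' : (R ⧸ I) ⧸ (Ideal.ofList rs • (⊤ : Submodule R (R ⧸ I))) :=
    Submodule.Quotient.mk (Ideal.Quotient.mk I 1)
  have hsm : ∀ r : R, r • one' = Submodule.Quotient.mk (Ideal.Quotient.mk I r) := by
    intro r
    have : r • Ideal.Quotient.mk I 1 = Ideal.Quotient.mk I r := by
      rw [Algebra.smul_def, map_one, mul_one]; rfl
    rw [← Submodule.Quotient.mk_smul, this]
  refine ⟨(ε one' : _), ?_, ?_⟩
  · intro r
    rw [← hK, ← mk_mem_smul_top, ← Submodule.Quotient.mk_eq_zero, ← hsm, ← Submodule.coe_smul,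
      ← map_smul, ZeroMemClass.coe_eq_zero, LinearEquiv.map_eq_zero_iff]
  · intro h hh
    have hmem : h ∈ kl rs (HL (maximalIdeal R) d (ModuleCat.of R (R ⧸ I))) := by
      intro r hr
      obtain ⟨i, -, rfl⟩ := List.mem_map.1 hr
      exact hh i
    obtain ⟨y, hy⟩ := ε.surjective ⟨h, hmem⟩
    obtain ⟨y, rfl⟩ := Submodule.Quotient.mk_surjective _ y
    obtain ⟨a, rfl⟩ := Ideal.Quotient.mk_surjective y
    refine ⟨a, ?_⟩
    rw [← Submodule.coe_smul, ← map_smul, hsm, hy]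

lemma good_step (hI : I ≠ ⊤) (t : ℕ) (ht : 1 ≤ t) (e : HL (maximalIdeal R) d (ModuleCat.of R (R ⧸ I)))
    (he : Good I x t e) :
    ∃ e' : HL (maximalIdeal R) d (ModuleCat.of R (R ⧸ I)), Good I x (t + 1) e' ∧
      e = (∏ i, x i) • e' := by
  obtain ⟨g, hg1, hg2⟩ := exists_good hcm hxm hx (t + 1) (by omega)
  have hxt : ∀ i, x i ^ t • e = 0 := fun i => (he.1 _).2 (pow_mem_XI I x (fun _ => t) i)
  obtain ⟨v, hv⟩ := hg2 e (fun i => by rw [pow_succ', mul_smul, hxt, smul_zero])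
  have hv1 := K1 hcm hxm hx t v (fun i => by
    rw [← hg1, mul_smul, ← hv]; exact hxt i)
  obtain ⟨b, hb, y, hy, rfl⟩ := Submodule.mem_sup.1 hv1
  obtain ⟨w, rfl⟩ := Ideal.mem_span_singleton.1 hy
  have hew : e = ((∏ i, x i) * w) • g := by
    rw [hv, add_smul, (hg1 b).2 hb, zero_add]
  obtain ⟨a, ha⟩ := he.2 ((∏ i, x i) • g) (by
    intro i
    rw [smul_smul, hg1, ← Finset.mul_prod_erase Finset.univ x (Finset.mem_univ i), ← mul_assoc,
      ← pow_succ]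
    exact Ideal.mul_mem_right _ _ (pow_mem_XI I x (fun _ => t + 1) i))
  have h1 : 1 - a * w ∈ XI I x (fun _ => t) := by
    refine C3 hcm hxm hx 1 t _ ?_
    rw [← hg1, pow_one, mul_sub, mul_one, sub_smul, ha, hew, smul_smul, sub_eq_zero]
    congr 1; ring
  have h2 := XI_le_max hI hxm t ht h1
  have h3 : IsUnit (a * w) := by
    by_contra hn
    have h4 : a * w ∈ maximalIdeal R := hn
    have := Ideal.add_mem _ h2 h4
    rw [sub_add_cancel] at this
    exact (Ideal.ne_top_iff_one _).1 (maximalIdeal.isMaximal R).ne_top this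
  have hw : IsUnit w := isUnit_of_mul_isUnit_right h3
  obtain ⟨w, rfl⟩ := hw
  refine ⟨(w : R) • g, ⟨?_, ?_⟩, ?_⟩
  · intro r
    rw [← hg1, smul_comm]
    constructor
    · intro h
      have h5 : (↑w⁻¹ : R) • (w : R) • r • g = 0 := by rw [h, smul_zero]
      rwa [smul_smul, Units.inv_mul, one_smul] at h5
    · intro h; rw [h, smul_zero]
  · intro h hh
    obtain ⟨c, rfl⟩ := hg2 h hh
    refine ⟨c * ↑w⁻¹, ?_⟩
    rw [smul_smul, mul_assoc, Units.inv_mul, mul_one]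
  · rw [hew, mul_smul]

lemma exists_esys (hI : I ≠ ⊤) :
    ∃ e : ℕ → HL (maximalIdeal R) d (ModuleCat.of R (R ⧸ I)), IsESys I x e := by
  obtain ⟨e0, he0⟩ := exists_good hcm hxm hx 1 le_rfl
  choose nxt hn1 hn2 using fun (t : ℕ) (e : {e : HL (maximalIdeal R) d (ModuleCat.of R (R ⧸ I)) //
    Good I x (t + 1) e}) => good_step hcm hxm hx hI (t + 1) (by omega) e.1 e.2
  let s : (t : ℕ) → {e : HL (maximalIdeal R) d (ModuleCat.of R (R ⧸ I)) // Good I x (t + 1) e} :=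
    fun t => Nat.rec ⟨e0, he0⟩ (fun t e => ⟨nxt t e, hn1 t e⟩) t
  have hs : ∀ t, (s t).1 = (∏ i, x i) • (s (t + 1)).1 := fun t => hn2 t (s t)
  have hgood : ∀ t, 1 ≤ t → Good I x t (s (t - 1)).1 := by
    intro t ht
    obtain ⟨t, rfl⟩ := Nat.exists_eq_add_of_le' ht
    exact (s t).2
  refine ⟨fun t => (s (t - 1)).1, hgood, ?_, ?_⟩
  · intro t ht
    obtain ⟨t, rfl⟩ := Nat.exists_eq_add_of_le' ht
    exact hs t
  · intro h
    obtain ⟨k, hk⟩ := HL_tors h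
    refine ⟨k + 1, by omega, ?_⟩
    refine (hgood (k + 1) (by omega)).2 h ?_
    intro i
    rw [pow_succ', mul_smul, hk _ (Ideal.pow_mem_pow (hxm i) k), smul_zero]

end
end LCx
end

section
open IsLocalRing RingTheory.Sequence

universe u
namespace LCx

section
variable {R : Type u} [CommRing R] {I : Ideal R} {d : ℕ} {x : Fin d → R}
  {H : Type u} [AddCommGroup H] [Module R H] {e : ℕ → H}

lemma ecomp (he : IsESys I x e) (t : ℕ) (ht : 1 ≤ t) (k : ℕ) :
    e t = (∏ i, x i) ^ k • e (t + k) := by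
  induction k with
  | zero => simp
  | succ k ih =>
    rw [ih, he.2.1 (t + k) (by omega), smul_smul, pow_succ, add_assoc]

lemma XI_pow {p : ℕ} [Fact p.Prime] [CharP R p] (t n : ℕ) (r : R)
    (h : r ∈ XI I x (fun _ => t)) : r ^ p ^ n ∈ XI I x (fun _ => p ^ n * t) := by
  have : ExpChar R p := ExpChar.prime Fact.out
  obtain ⟨c, i, hi, rfl⟩ := mem_XI.1 h
  rw [add_pow_expChar_pow, sum_pow_char_pow]
  refine Ideal.add_mem _ (Ideal.sum_mem _ fun j _ => ?_) (Ideal.mem_sup_right ?_)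
  · rw [mul_pow, ← pow_mul, mul_comm t]
    exact Ideal.mul_mem_left _ _ (pow_mem_XI I x (fun _ => p ^ n * t) j)
  · exact Ideal.pow_mem_of_mem _ hi _ (pow_pos (Fact.out : p.Prime).pos n)

lemma powlem {p : ℕ} [Fact p.Prime] [CharP R p] (he : IsESys I x e) (n : ℕ) (a a' : R) (t t' : ℕ)
    (ht : 1 ≤ t) (ht' : 1 ≤ t') (h : a • e t = a' • e t') :
    a ^ p ^ n • e (p ^ n * t) = a' ^ p ^ n • e (p ^ n * t') := by
  have : ExpChar R p := ExpChar.prime Fact.out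
  have hq : 1 ≤ p ^ n := Nat.one_le_iff_ne_zero.2 (pow_pos (Fact.out : p.Prime).pos n).ne'
  have h1 : a * (∏ i, x i) ^ t' - a' * (∏ i, x i) ^ t ∈ XI I x (fun _ => t + t') := by
    rw [← (he.1 _ (by omega)).1, sub_smul, sub_eq_zero, mul_smul, mul_smul, ← ecomp he t ht,
      add_comm, ← ecomp he t' ht', h]
  have h2 := XI_pow (p := p) _ n _ h1
  rw [sub_pow_expChar_pow, ← (he.1 _ (by nlinarith)).1, sub_smul, sub_eq_zero, mul_pow, mul_pow,
    ← pow_mul, ← pow_mul, mul_add, mul_smul, mul_smul, mul_comm t', mul_comm t (p ^ n),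
    ← ecomp he _ (by nlinarith), add_comm, ← ecomp he _ (by nlinarith)] at h2
  exact h2

end

section
variable {R : Type u} [CommRing R] [IsLocalRing R] [IsNoetherianRing R]
  {p : ℕ} [Fact p.Prime] [CharP R p]
  {E : Type u} [AddCommGroup E] [Module R E] {I J : Ideal R}
  {H : Type u} [AddCommGroup H] [Module R H]
  {α : J →ₗ[R] (H →ₗ[R] E)}

omit [IsLocalRing R] [IsNoetherianRing R] in
lemma exch (j w : J) (h : H) : (j : R) • α w h = α j ((w : R) • h) := by
  have h1 : (j : R) • w = (w : R) • j := by ext; simp [mul_comm]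
  have h2 := congrArg (fun y => α y h) h1
  simp only [map_smul, LinearMap.smul_apply] at h2
  rw [map_smul, h2]

omit [IsNoetherianRing R] in
lemma sepH (hE : IsInjectiveHullOfResidueField R E) (hα : Function.Surjective α) (h : H)
    (h0 : ∀ j, α j h = 0) : h = 0 := by
  by_contra hne
  obtain ⟨f, hf⟩ := cogen hE h hne
  obtain ⟨j, rfl⟩ := hα f
  exact hf (h0 j)

lemma krull_XI (hI : I ≠ ⊤) {d : ℕ} {x : Fin d → R} (hxm : ∀ i, x i ∈ maximalIdeal R) (r : R)
    (hr : ∀ t, 1 ≤ t → r ∈ XI I x (fun _ => t)) : r ∈ I := by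
  have : Nontrivial (R ⧸ I) := Ideal.Quotient.nontrivial_iff.2 hI
  have hloc : IsLocalRing (R ⧸ I) := IsLocalRing.of_surjective' _ Ideal.Quotient.mk_surjective
  let n := Ideal.map (Ideal.Quotient.mk I) (maximalIdeal R)
  have hn : n ≠ ⊤ := by
    intro h
    have h1 : Ideal.comap (Ideal.Quotient.mk I) n = ⊤ := by rw [h, Ideal.comap_top]
    rw [Ideal.comap_map_of_surjective _ Ideal.Quotient.mk_surjective, ← RingHom.ker_eq_comap_bot,
      Ideal.mk_ker, sup_eq_left.2 (le_maximalIdeal hI)] at h1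
    exact (maximalIdeal.isMaximal R).ne_top h1
  have hb := Ideal.iInf_pow_eq_bot_of_isLocalRing n hn
  rw [← Ideal.Quotient.eq_zero_iff_mem]
  have : Ideal.Quotient.mk I r ∈ (⨅ i : ℕ, n ^ i) := by
    rw [Submodule.mem_iInf]
    intro t
    have h1 := Ideal.mem_map_of_mem (Ideal.Quotient.mk I) (hr (t + 1) (by omega))
    have h2 : Ideal.map (Ideal.Quotient.mk I) (XI I x (fun _ => t + 1)) ≤ n ^ t := by
      rw [XI, Ideal.map_sup, Ideal.map_quotient_self, sup_bot_eq, Ideal.map_le_iff_le_comap,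
        Ideal.span_le]
      rintro _ ⟨j, rfl⟩
      change Ideal.Quotient.mk I (x j ^ (t + 1)) ∈ n ^ t
      rw [map_pow, pow_succ]
      exact Ideal.mul_mem_right _ _ (Ideal.pow_mem_pow (Ideal.mem_map_of_mem _ (hxm j)) t)
    exact h2 h1
  rw [hb] at this
  exact this

variable {d : ℕ} {x : Fin d → R} {e : ℕ → H}

omit [IsLocalRing R] [IsNoetherianRing R] in
lemma alpha_lift (he : IsESys I x e) (w : J) (t : ℕ) (ht : 1 ≤ t) (k : ℕ) :
    α w (e t) = α ((∏ i, x i) ^ k • w) (e (t + k)) := by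
  rw [ecomp he t ht k, map_smul, map_smul, LinearMap.smul_apply]

lemma rep (hI : I ≠ ⊤) (hE : IsInjectiveHullOfResidueField R E)
    (hcomp : IsAdicComplete (maximalIdeal R) R)
    (hα : Function.Surjective α)
    (hxm : ∀ i, x i ∈ maximalIdeal R) (he : IsESys I x e) (z : E) (hz : z ∈ annIn I E) :
    ∃ (w : J) (t : ℕ), 1 ≤ t ∧ z = α w (e t) := by
  let N : Submodule R E :=
    { carrier := {z | ∃ (w : J) (t : ℕ), 1 ≤ t ∧ z = α w (e t)}
      add_mem' := by
        rintro _ _ ⟨w, t, ht, rfl⟩ ⟨w', t', ht', rfl⟩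
        refine ⟨(∏ i, x i) ^ t' • w + (∏ i, x i) ^ t • w', t + t', by omega, ?_⟩
        rw [map_add, LinearMap.add_apply, alpha_lift he w t ht t', alpha_lift he w' t' ht' t,
          add_comm t']
      zero_mem' := ⟨0, 1, le_rfl, by simp⟩
      smul_mem' := by
        rintro r _ ⟨w, t, ht, rfl⟩
        exact ⟨r • w, t, ht, by simp⟩ }
  refine dbl_ann hE hcomp N z ?_
  intro r hr
  apply hz
  apply krull_XI hI hxm
  intro t ht
  rw [← (he.1 t ht).1]
  apply sepH hE hα
  intro j
  rw [map_smul]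
  exact hr _ ⟨j, t, ht, rfl⟩

omit [IsLocalRing R] [IsNoetherianRing R] in
lemma alpha_ann (hα0 : ∀ j : J, α j = 0 ↔ (j : R) ∈ I) (w : J) (h : H) : α w h ∈ annIn I E := by
  intro i hi
  rw [← LinearMap.smul_apply, ← map_smul, (hα0 (i • w)).2 (Ideal.mul_mem_right _ _ hi)]
  rfl

omit [IsLocalRing R] [IsNoetherianRing R] in
lemma divide (hE : Module.Injective R E)
    (hα : Function.Surjective α) (hα0 : ∀ j : J, α j = 0 ↔ (j : R) ∈ I)
    (he : IsESys I x e) (w : J) (t : ℕ) (ht : 1 ≤ t) (h : α w (e t) = 0) :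
    ∃ v : Fin d → J, (w : R) - ∑ i, x i ^ t * (v i : R) ∈ I := by
  classical
  let g : H →ₗ[R] (Fin d → H) := LinearMap.pi fun i => x i ^ t • LinearMap.id
  have hg : ∀ z i, g z i = x i ^ t • z := fun z i => rfl
  obtain ⟨k, hk⟩ := inj_factor hE g (α w) (by
    intro y hy
    obtain ⟨a, rfl⟩ := (he.1 t ht).2 y (fun i => by rw [← hg, hy]; rfl)
    rw [map_smul, h, smul_zero])
  choose v hv using fun i : Fin d => hα (k.comp (LinearMap.single R (fun _ => H) i))
  refine ⟨v, ?_⟩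
  have h1 : α (w - ∑ i, x i ^ t • v i) = 0 := by
    ext y
    rw [map_sub, map_sum, LinearMap.sub_apply, LinearMap.sum_apply, ← hk, LinearMap.zero_apply,
      sub_eq_zero]
    have : g y = ∑ i, Pi.single i (x i ^ t • y) := by
      rw [Finset.univ_sum_single (fun i => x i ^ t • y)]; rfl
    rw [this, map_sum]
    refine Finset.sum_congr rfl fun i _ => ?_
    rw [map_smul, LinearMap.smul_apply, hv, LinearMap.comp_apply, ← map_smul, ← map_smul]
    rfl
  have := (hα0 _).1 h1
  simpa using this

/-- Frobenius on `J`. -/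
def Jp (p : ℕ) [Fact p.Prime] (w : J) (n : ℕ) : J :=
  ⟨(w : R) ^ p ^ n, Ideal.pow_mem_of_mem _ w.2 _ (pow_pos (Fact.out : p.Prime).pos n)⟩

omit [IsLocalRing R] [IsNoetherianRing R] in
lemma alpha_pow_zero (hE : Module.Injective R E)
    (hα : Function.Surjective α) (hα0 : ∀ j : J, α j = 0 ↔ (j : R) ∈ I)
    (he : IsESys I x e) (w : J) (t : ℕ) (ht : 1 ≤ t) (h : α w (e t) = 0) :
    α (Jp p w 1) (e (p * t)) = 0 := by
  have : ExpChar R p := ExpChar.prime Fact.out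
  have hp := (Fact.out : p.Prime).pos
  obtain ⟨v, hv⟩ := divide hE hα hα0 he w t ht h
  have h1 : ((Jp p w 1 - ∑ i, x i ^ (p * t) • Jp p (v i) 1 : J) : R) ∈ I := by
    have h2 := Ideal.pow_mem_of_mem _ hv p hp
    rw [sub_pow_expChar, sum_pow_char] at h2
    simp only [Submodule.coe_sub, Submodule.coe_sum, Submodule.coe_smul, Jp, pow_one]
    convert h2 using 3 with i
    rw [smul_eq_mul, mul_pow, ← pow_mul, mul_comm t]
  have h3 := (hα0 _).2 h1
  rw [map_sub, sub_eq_zero] at h3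
  rw [h3, map_sum, LinearMap.sum_apply]
  refine Finset.sum_eq_zero fun i _ => ?_
  rw [map_smul, LinearMap.smul_apply, ← map_smul,
    ((he.1 (p * t) (by nlinarith)).1 _).2 (pow_mem_XI I x (fun _ => p * t) i), map_zero]

omit [IsLocalRing R] [IsNoetherianRing R] in
lemma G_wd (hE : Module.Injective R E)
    (hα : Function.Surjective α) (hα0 : ∀ j : J, α j = 0 ↔ (j : R) ∈ I)
    (he : IsESys I x e) (w w' : J) (t t' : ℕ) (ht : 1 ≤ t) (ht' : 1 ≤ t')
    (h : α w (e t) = α w' (e t')) :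
    α (Jp p w 1) (e (p * t)) = α (Jp p w' 1) (e (p * t')) := by
  have : ExpChar R p := ExpChar.prime Fact.out
  have hp := (Fact.out : p.Prime).pos
  have h1 : α ((∏ i, x i) ^ t' • w - (∏ i, x i) ^ t • w') (e (t + t')) = 0 := by
    rw [map_sub, LinearMap.sub_apply, ← alpha_lift he w t ht, add_comm t, ← alpha_lift he w' t' ht',
      h, sub_self]
  have h2 := alpha_pow_zero (p := p) hE hα hα0 he _ _ (by omega) h1
  have h3 : Jp p ((∏ i, x i) ^ t' • w - (∏ i, x i) ^ t • w') 1
      = (∏ i, x i) ^ (p * t') • Jp p w 1 - (∏ i, x i) ^ (p * t) • Jp p w' 1 := by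
    ext
    simp only [Submodule.coe_sub, Submodule.coe_smul, Jp, pow_one, smul_eq_mul]
    rw [sub_pow_expChar, mul_pow, mul_pow, ← pow_mul, ← pow_mul, mul_comm t', mul_comm t]
  rw [h3, map_sub, LinearMap.sub_apply, mul_add, ← alpha_lift he _ _ (by nlinarith),
    add_comm (p * t), ← alpha_lift he _ _ (by nlinarith), sub_eq_zero] at h2
  exact h2

lemma exists_v (hI : I ≠ ⊤) (hreg : IsRegularLocal R) (hcomp : IsAdicComplete (maximalIdeal R) R)
    (hE : IsInjectiveHullOfResidueField R E)
    {φ : FrobeniusMap R E p} (hφ : IsNaturalFrobenius p E φ)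
    (hα : Function.Surjective α) (hα0 : ∀ j : J, α j = 0 ↔ (j : R) ∈ I)
    (hxm : ∀ i, x i ∈ maximalIdeal R) (he : IsESys I x e) :
    ∃ v : R, ∀ (w : J) (t : ℕ), 1 ≤ t → α (Jp p w 1) (e (p * t)) = v • φ.toFun (α w (e t)) := by
  have : ExpChar R p := ExpChar.prime Fact.out
  have hp := (Fact.out : p.Prime).pos
  choose W τ hτ hW using fun z : annIn I E => rep hI hE hcomp hα hxm he z z.2
  let G : annIn I E → E := fun z => α (Jp p (W z) 1) (e (p * τ z))
  have hG : ∀ (z : annIn I E) (w : J) (t : ℕ), 1 ≤ t → (z : E) = α w (e t) →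
      G z = α (Jp p w 1) (e (p * t)) := by
    intro z w t ht hz
    exact G_wd hE.1 hα hα0 he _ _ _ _ (hτ z) ht ((hW z).symm.trans hz)
  obtain ⟨Θ, hadd, hsmul, hext⟩ := frob_ext hreg p hE.1 (E_tors hE) (annIn I E) G
    (by
      intro z z'
      have h1 := hW z
      have h2 := hW z'
      rw [alpha_lift he _ _ (hτ z) (τ z')] at h1
      rw [alpha_lift he _ _ (hτ z') (τ z), add_comm (τ z')] at h2
      have hT : 1 ≤ τ z + τ z' := by have := hτ z; omega
      rw [hG z _ _ hT h1, hG z' _ _ hT h2, hG (z + z') _ _ hT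
        (show ((z + z' : annIn I E) : E) = α ((∏ i, x i) ^ τ z' • W z + (∏ i, x i) ^ τ z • W z') _ by
          rw [Submodule.coe_add, map_add, LinearMap.add_apply, ← h1, ← h2]),
        ← LinearMap.add_apply, ← map_add]
      congr 2
      ext
      simp only [Submodule.coe_add, Jp, pow_one]
      rw [add_pow_expChar])
    (by
      intro r z
      rw [hG (r • z) (r • W z) (τ z) (hτ z) (by
        rw [Submodule.coe_smul, map_smul, LinearMap.smul_apply, ← hW])]
      change _ = r ^ p • α (Jp p (W z) 1) (e (p * τ z))
      rw [← LinearMap.smul_apply, ← map_smul]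
      congr 2
      ext
      simp only [Submodule.coe_smul, Jp, pow_one, smul_eq_mul, mul_pow])
  obtain ⟨v, hv⟩ := nat_ex hφ Θ hadd hsmul
  refine ⟨v, fun w t ht => ?_⟩
  rw [← hv, ← hG ⟨α w (e t), alpha_ann hα0 w _⟩ w t ht rfl]
  exact (hext _).symm

end
end LCx
end

section
open IsLocalRing RingTheory.Sequence

universe u
namespace LCx

section
variable {R : Type u} [CommRing R] [IsLocalRing R] [IsNoetherianRing R]
  {p : ℕ} [Fact p.Prime] [CharP R p]
  {E : Type u} [AddCommGroup E] [Module R E] {I J : Ideal R}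
  {φ : FrobeniusMap R E p} {u : R}

omit [IsLocalRing R] [IsNoetherianRing R] [Fact p.Prime] [CharP R p] in
/-- stability of the annihilator under `u φ` -/
lemma T_ann {K : Ideal R} (hu : ∀ k ∈ K, k * u ∈ Ideal.frobPow p K) (z : E) (hz : z ∈ annIn K E) :
    u • φ.toFun z ∈ annIn K E := by
  intro k hk
  rw [smul_smul]
  exact frob_kill φ K _ (hu k hk) z hz

section
variable {H : Type u} [AddCommGroup H] [Module R H]
  {α : J →ₗ[R] (H →ₗ[R] E)} {d : ℕ} {x : Fin d → R} {e : ℕ → H}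

lemma exists_unit (hI : I ≠ ⊤) (hIJ : I ≤ J) (hreg : IsRegularLocal R)
    (hcomp : IsAdicComplete (maximalIdeal R) R)
    (hE : IsInjectiveHullOfResidueField R E) (hφ : IsNaturalFrobenius p E φ)
    (hα : Function.Surjective α) (hα0 : ∀ j : J, α j = 0 ↔ (j : R) ∈ I)
    (hxm : ∀ i, x i ∈ maximalIdeal R) (he : IsESys I x e)
    (hu1 : ∀ k ∈ I, k * u ∈ Ideal.frobPow p I) (hu2 : ∀ k ∈ J, k * u ∈ Ideal.frobPow p J)
    (hu3 : ∀ v, (∀ k ∈ I, k * v ∈ Ideal.frobPow p I) → (∀ k ∈ J, k * v ∈ Ideal.frobPow p J) →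
      ∃ s, v - s * u ∈ Ideal.frobPow p I) :
    ∃ s : R, IsUnit s ∧ ∀ (w : J) (t : ℕ), 1 ≤ t →
      α (Jp p w 1) (e (p * t)) = s • u • φ.toFun (α w (e t)) := by
  have hp := (Fact.out : p.Prime).pos
  obtain ⟨v, hv⟩ := exists_v hI hreg hcomp hE hφ hα hα0 hxm he
  obtain ⟨s, hs⟩ := hu3 v
    (by
      intro k hk
      apply F4 hreg hE hφ
      intro z hz
      obtain ⟨w, t, ht, rfl⟩ := rep hI hE hcomp hα hxm he z hz
      rw [mul_smul, ← hv w t ht]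
      exact alpha_ann hα0 _ _ k hk)
    (by
      intro k hk
      apply F4 hreg hE hφ
      intro z hz
      obtain ⟨w, t, ht, rfl⟩ := rep hI hE hcomp hα hxm he z (fun i hi => hz i (hIJ hi))
      rw [mul_smul, ← hv w t ht]
      have h0 : (w : R) • e t = 0 := by
        apply sepH hE hα
        intro j
        rw [← exch]
        exact hz j j.2
      have h1 := XI_pow (p := p) t 1 _ (((he.1 t ht).1 _).1 h0)
      rw [pow_one] at h1
      have h2 := ((he.1 (p * t) (by nlinarith)).1 _).2 h1
      have h3 := exch (α := α) ⟨k, hk⟩ (Jp p w 1) (e (p * t))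
      rw [show ((Jp p w 1 : J) : R) = (w : R) ^ p by simp [Jp], h2, map_zero] at h3
      exact h3)
  have hS : ∀ (w : J) (t : ℕ), 1 ≤ t →
      α (Jp p w 1) (e (p * t)) = s • u • φ.toFun (α w (e t)) := by
    intro w t ht
    have h1 := frob_kill φ I _ hs _ (alpha_ann hα0 w (e t))
    rw [sub_smul, sub_eq_zero, mul_smul] at h1
    rw [hv w t ht, h1]
  refine ⟨s, ?_, hS⟩
  obtain ⟨k, hk⟩ := inj_factor hE.1 J.subtype (α.flip (e 1)) (by
    intro a ha
    have : a = 0 := by simpa using ha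
    rw [this, map_zero])
  have hz : ∀ j : J, (j : R) • k 1 = α j (e 1) := by
    intro j
    rw [← map_smul, smul_eq_mul, mul_one]
    exact hk j
  have hzI : k 1 ∈ annIn I E := by
    intro i hi
    have := hz ⟨i, hIJ hi⟩
    rw [(hα0 ⟨i, hIJ hi⟩).2 hi] at this
    exact this
  obtain ⟨w, t, ht, hwt⟩ := rep hI hE hcomp hα hxm he _ hzI
  have hsep : ∀ h h' : H, (∀ j : J, α j h = α j h') → h = h' := by
    intro h h' hh
    rw [← sub_eq_zero]
    apply sepH hE hα
    intro j
    rw [map_sub, hh, sub_self]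
  have hwe : (w : R) • e t = (1 : R) • e 1 := by
    apply hsep
    intro j
    rw [← exch, ← hwt, hz, one_smul]
  obtain ⟨w', t', ht', hwt'⟩ := rep hI hE hcomp hα hxm he _ (T_ann (φ := φ) hu1 _ hzI)
  have h4 := powlem (p := p) he 1 _ _ _ _ ht le_rfl hwe
  rw [pow_one, one_pow, one_smul, mul_one] at h4
  have h5 : e p = s • (w' : R) • e t' := by
    apply hsep
    intro j
    rw [map_smul, ← exch, ← hwt', hwt, smul_comm, ← hS w t ht, exch, ← h4]
    simp [Jp]
  obtain ⟨b, hb⟩ := (he.1 p hp).2 ((w' : R) • e t') (by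
    intro i
    apply sepH hE hα
    intro j
    rw [map_smul, ← exch, ← hwt', smul_comm, smul_comm (x i ^ p), ← φ.map_smul']
    refine T_ann (φ := φ) hu2 (x i • k 1) ?_ j j.2
    intro j' hj'
    rw [smul_comm, hz ⟨j', hj'⟩, ← map_smul,
      ((he.1 1 le_rfl).1 _).2 (by simpa using pow_mem_XI I x (fun _ => 1) i), map_zero])
  rw [hb, smul_smul] at h5
  have h6 : 1 - s * b ∈ XI I x (fun _ => p) := by
    rw [← (he.1 p hp).1, sub_smul, one_smul, ← h5, sub_self]
  have h7 := XI_le_max hI hxm p hp h6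
  by_contra hn
  have h8 : s * b ∈ maximalIdeal R := Ideal.mul_mem_right _ _ hn
  have := Ideal.add_mem _ h7 h8
  rw [sub_add_cancel] at this
  exact (Ideal.ne_top_iff_one _).1 (maximalIdeal.isMaximal R).ne_top this

lemma iter_unit (hI : I ≠ ⊤) (hIJ : I ≤ J) (hreg : IsRegularLocal R)
    (hcomp : IsAdicComplete (maximalIdeal R) R)
    (hE : IsInjectiveHullOfResidueField R E) (hφ : IsNaturalFrobenius p E φ)
    (hα : Function.Surjective α) (hα0 : ∀ j : J, α j = 0 ↔ (j : R) ∈ I)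
    (hxm : ∀ i, x i ∈ maximalIdeal R) (he : IsESys I x e)
    (hu1 : ∀ k ∈ I, k * u ∈ Ideal.frobPow p I) (hu2 : ∀ k ∈ J, k * u ∈ Ideal.frobPow p J)
    (hu3 : ∀ v, (∀ k ∈ I, k * v ∈ Ideal.frobPow p I) → (∀ k ∈ J, k * v ∈ Ideal.frobPow p J) →
      ∃ s, v - s * u ∈ Ideal.frobPow p I) (n : ℕ) :
    ∃ s : R, IsUnit s ∧ ∀ (w : J) (t : ℕ), 1 ≤ t →
      α (Jp p w n) (e (p ^ n * t)) = s • (fun y => u • φ.toFun y)^[n] (α w (e t)) := by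
  have hp := (Fact.out : p.Prime).pos
  obtain ⟨s, hs, hS⟩ := exists_unit hI hIJ hreg hcomp hE hφ hα hα0 hxm he hu1 hu2 hu3
  induction n with
  | zero => exact ⟨1, isUnit_one, fun w t ht => by simp [Jp]⟩
  | succ n ih =>
    obtain ⟨s', hs', hS'⟩ := ih
    refine ⟨s * s' ^ p, hs.mul (hs'.pow p), fun w t ht => ?_⟩
    have hq : 0 < p ^ n := pow_pos hp n
    have h1 := hS (Jp p w n) (p ^ n * t) (by nlinarith)
    rw [hS' w t ht, φ.map_smul', smul_comm u, smul_smul] at h1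
    rw [Function.iterate_succ', Function.comp_apply, ← h1]
    have h2 : Jp p (Jp p w n) 1 = Jp p w (n + 1) := by
      ext; simp [Jp, pow_succ, pow_mul]
    rw [h2, ← mul_assoc, ← pow_succ']

/-- The key equivalence. -/
lemma key_equiv (hI : I ≠ ⊤) (hIJ : I ≤ J) (hreg : IsRegularLocal R)
    (hcomp : IsAdicComplete (maximalIdeal R) R)
    (hE : IsInjectiveHullOfResidueField R E) (hφ : IsNaturalFrobenius p E φ)
    (hα : Function.Surjective α) (hα0 : ∀ j : J, α j = 0 ↔ (j : R) ∈ I)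
    (hxm : ∀ i, x i ∈ maximalIdeal R) (he : IsESys I x e)
    (hu1 : ∀ k ∈ I, k * u ∈ Ideal.frobPow p I) (hu2 : ∀ k ∈ J, k * u ∈ Ideal.frobPow p J)
    (hu3 : ∀ v, (∀ k ∈ I, k * v ∈ Ideal.frobPow p I) → (∀ k ∈ J, k * v ∈ Ideal.frobPow p J) →
      ∃ s, v - s * u ∈ Ideal.frobPow p I) (c : R) (w : J) (t : ℕ) (ht : 1 ≤ t) (n : ℕ) :
    (∀ j ∈ J, (c * j) • (fun y => u • φ.toFun y)^[n] (α w (e t)) = 0) ↔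
      c * (w : R) ^ p ^ n ∈ XI I x (fun _ => p ^ n * t) := by
  have hp := (Fact.out : p.Prime).pos
  have hq : 0 < p ^ n := pow_pos hp n
  obtain ⟨s, hs, hS⟩ := iter_unit hI hIJ hreg hcomp hE hφ hα hα0 hxm he hu1 hu2 hu3 n
  rw [← (he.1 _ (by nlinarith)).1]
  have h1 : ∀ j : J, α j ((c * (w : R) ^ p ^ n) • e (p ^ n * t)) =
      s • ((c * j) • (fun y => u • φ.toFun y)^[n] (α w (e t))) := by
    intro j
    rw [smul_comm s, ← hS w t ht, mul_smul, mul_smul, map_smul, exch]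
    rfl
  constructor
  · intro h
    apply sepH hE hα
    intro j
    rw [h1, h j j.2, smul_zero]
  · intro h j hj
    have h2 := h1 ⟨j, hj⟩
    rw [h, map_zero] at h2
    obtain ⟨s, rfl⟩ := hs
    have h3 := congrArg (fun y => (↑s⁻¹ : R) • y) h2
    simp only [smul_zero, smul_smul, ← mul_assoc, Units.inv_mul, one_mul] at h3
    exact h3.symm

end

/-- The star closure as an annihilator. -/
lemma star_ann (hreg : IsRegularLocal R) (hcomp : IsAdicComplete (maximalIdeal R) R)
    (hE : IsInjectiveHullOfResidueField R E) (hφ : IsNaturalFrobenius p E φ)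
    (hu1 : ∀ k ∈ I, k * u ∈ Ideal.frobPow p I) (c : R) (z : E) :
    z ∈ annIn (Ideal.starClosure u p (Ideal.span {c} * J + I)) E ↔
      z ∈ annIn I E ∧ ∀ n : ℕ, ∀ j ∈ J, (c * j) • (fun y => u • φ.toFun y)^[n] z = 0 := by
  set A := Ideal.span {c} * J + I with hA
  set T : E → E := fun y => u • φ.toFun y with hT
  have hTadd : ∀ n a b, T^[n] (a + b) = T^[n] a + T^[n] b := by
    intro n
    induction n with
    | zero => intro a b; rfl
    | succ n ih =>
      intro a b
      rw [Function.iterate_succ_apply, Function.iterate_succ_apply, Function.iterate_succ_apply, ← ih]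
      congr 1
      simp only [hT, φ.map_add', smul_add]
  have hTsmul : ∀ n (r : R) b, T^[n] (r • b) = r ^ p ^ n • T^[n] b := by
    intro n
    induction n with
    | zero => intro a b; simp
    | succ n ih =>
      intro a b
      rw [Function.iterate_succ_apply', Function.iterate_succ_apply', ih]
      simp only [hT, φ.map_smul']
      rw [smul_comm, ← pow_mul, pow_succ]
  let Z : Submodule R E :=
    { carrier := {z | z ∈ annIn I E ∧ ∀ n : ℕ, ∀ j ∈ J, (c * j) • T^[n] z = 0}
      add_mem' := by
        rintro a b ⟨ha, ha'⟩ ⟨hb, hb'⟩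
        refine ⟨add_mem ha hb, fun n j hj => ?_⟩
        rw [hTadd, smul_add, ha' n j hj, hb' n j hj, add_zero]
      zero_mem' := by
        refine ⟨zero_mem _, fun n j hj => ?_⟩
        have : T^[n] 0 = 0 := by
          have := hTadd n 0 0
          simpa using this
        rw [this, smul_zero]
      smul_mem' := by
        rintro r b ⟨hb, hb'⟩
        refine ⟨Submodule.smul_mem _ r hb, fun n j hj => ?_⟩
        rw [hTsmul, smul_comm, hb' n j hj, smul_zero] }
  have hTZ : ∀ z ∈ Z, T z ∈ Z := by
    rintro z ⟨hz, hz'⟩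
    refine ⟨T_ann hu1 z hz, fun n j hj => ?_⟩
    rw [← Function.iterate_succ_apply]
    exact hz' (n + 1) j hj
  have hstar_le : ∀ i, Ideal.starChain u p A i ≤ Ideal.starClosure u p A := fun i => le_iSup _ i
  constructor
  · intro hz
    have hmono : Monotone (Ideal.starChain u p A) := by
      refine monotone_nat_of_le_succ fun n => ?_
      rw [Ideal.starChain]
      exact le_sup_right
    have huL : ∀ k ∈ Ideal.starClosure u p A, k * u ∈ Ideal.frobPow p (Ideal.starClosure u p A) := by
      intro k hk
      rw [Ideal.starClosure, Submodule.mem_iSup_of_directed _ hmono.directed_le] at hk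
      obtain ⟨i, hi⟩ := hk
      have h1 : k * u ∈ Ideal.span {u} * Ideal.starChain u p A i := by
        rw [mul_comm k u]
        exact Ideal.mul_mem_mul (Ideal.mem_span_singleton_self u) hi
      have h2 := F5 hreg hcomp hE hφ _ h1
      have h3 : Ideal.tilde p (Ideal.span {u} * Ideal.starChain u p A i) ≤ Ideal.starClosure u p A := by
        refine le_trans ?_ (hstar_le (i + 1))
        rw [Ideal.starChain]
        exact le_sup_left
      exact Ideal.span_mono (Set.image_mono h3) h2
    have hAL : A ≤ Ideal.starClosure u p A := hstar_le 0
    have hzn : ∀ n, T^[n] z ∈ annIn (Ideal.starClosure u p A) E := by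
      intro n
      induction n with
      | zero => exact hz
      | succ n ih =>
        rw [Function.iterate_succ_apply']
        exact T_ann huL _ ih
    refine ⟨fun i hi => hz i (hAL ?_), fun n j hj => hzn n _ (hAL ?_)⟩
    · exact Ideal.mem_sup_right hi
    · exact Ideal.mem_sup_left (Ideal.mul_mem_mul (Ideal.mem_span_singleton_self c) hj)
  · intro hz
    let K : Ideal R :=
      { carrier := {r | ∀ z ∈ Z, r • z = 0}
        add_mem' := fun {a b} ha hb z hz => by rw [add_smul, ha z hz, hb z hz, add_zero]
        zero_mem' := fun z _ => zero_smul R z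
        smul_mem' := fun r a ha z hz => by rw [smul_eq_mul, mul_smul, ha z hz, smul_zero] }
    have hZK : ∀ z ∈ annIn K E, z ∈ Z := by
      intro z hz
      refine dbl_ann hE hcomp Z z (fun r hr => hz r hr)
    have hAK : ∀ i, Ideal.starChain u p A i ≤ K := by
      intro i
      induction i with
      | zero =>
        rw [Ideal.starChain]
        refine sup_le ?_ ?_
        · rw [Ideal.mul_le]
          intro r hr j hj z hz
          obtain ⟨r, rfl⟩ := Ideal.mem_span_singleton.1 hr
          have := hz.2 0 (r * j) (Ideal.mul_mem_left _ _ hj)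
          rw [mul_assoc]
          exact this
        · intro i hi z hz
          exact hz.1 i hi
      | succ i ih =>
        rw [Ideal.starChain]
        refine sup_le ?_ ih
        refine sInf_le ?_
        change Ideal.span {u} * Ideal.starChain u p A i ≤ Ideal.frobPow p K
        rw [Ideal.mul_le]
        intro r hr a ha
        obtain ⟨r, rfl⟩ := Ideal.mem_span_singleton.1 hr
        apply F4 hreg hE hφ
        intro z hz
        have h1 := ih ha (T z) (hTZ z (hZK z hz))
        have h2 : (u * r * a) • φ.toFun z = r • a • T z := by
          simp only [hT, smul_smul]; congr 1; ring
        rw [h2, h1, smul_zero]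
    have hLK : Ideal.starClosure u p A ≤ K := iSup_le hAK
    exact fun l hl => hLK hl z hz

end
end LCx
end

section
open IsLocalRing RingTheory.Sequence

universe u
namespace LCx

section
variable {S : Type*} [CommRing S] {p : ℕ} [Fact p.Prime] [CharP S p]

lemma frobPow_span {d : ℕ} (y : Fin d → S) (n : ℕ) :
    Ideal.frobPow (p ^ n) (Ideal.span (Set.range y)) =
      Ideal.span (Set.range fun i => y i ^ p ^ n) := by
  apply le_antisymm
  · refine Ideal.span_le.2 ?_
    rintro _ ⟨a, ha, rfl⟩
    obtain ⟨c, rfl⟩ := Ideal.mem_span_range_iff_exists_fun.1 ha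
    show (∑ i, c i * y i) ^ p ^ n ∈ _
    rw [sum_pow_char_pow]
    refine Ideal.sum_mem _ fun i _ => ?_
    rw [mul_pow]
    exact Ideal.mul_mem_left _ _ (Ideal.subset_span ⟨i, rfl⟩)
  · refine Ideal.span_le.2 ?_
    rintro _ ⟨i, rfl⟩
    exact Ideal.subset_span ⟨y i, Ideal.subset_span ⟨i, rfl⟩, rfl⟩

lemma frobPow_span_span {d : ℕ} (y : Fin d → S) (n m : ℕ) :
    Ideal.frobPow (p ^ m) (Ideal.frobPow (p ^ n) (Ideal.span (Set.range y))) =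
      Ideal.frobPow (p ^ (n + m)) (Ideal.span (Set.range y)) := by
  rw [frobPow_span, frobPow_span, frobPow_span]
  simp only [← pow_mul, ← pow_add]

lemma span_pow_radical {d : ℕ} (y : Fin d → S) (t : ℕ) (ht : 1 ≤ t) :
    (Ideal.span (Set.range fun i => y i ^ t)).radical = (Ideal.span (Set.range y)).radical := by
  apply le_antisymm
  · apply Ideal.radical_mono
    refine Ideal.span_le.2 ?_
    rintro _ ⟨i, rfl⟩
    have hi : y i ∈ Ideal.span (Set.range y) := Ideal.subset_span ⟨i, rfl⟩
    exact Ideal.pow_mem_of_mem _ hi _ ht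
  · rw [Ideal.radical_le_radical_iff]
    refine Ideal.span_le.2 ?_
    rintro _ ⟨i, rfl⟩
    exact ⟨t, Ideal.subset_span ⟨i, rfl⟩⟩

variable [IsLocalRing S]

lemma sop_frob {A : Ideal S} (hA : IsSOPIdeal S A) (n : ℕ) :
    IsSOPIdeal S (Ideal.frobPow (p ^ n) A) := by
  obtain ⟨d, y, hd, rfl, hr⟩ := hA
  refine ⟨d, fun i => y i ^ p ^ n, hd, frobPow_span y n, ?_⟩
  rw [frobPow_span, span_pow_radical _ _ (Nat.pos_of_ne_zero (pow_ne_zero _ (Fact.out : p.Prime).ne_zero)), hr]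

lemma tc_pow {A : Ideal S} (hA : IsSOPIdeal S A) (n : ℕ) {a : S} (h : InTightClosure p A a) :
    InTightClosure p (Ideal.frobPow (p ^ n) A) (a ^ p ^ n) := by
  obtain ⟨d, y, hd, rfl, hr⟩ := hA
  obtain ⟨c, hc, E₀, h⟩ := h
  refine ⟨c, hc, E₀, fun e he => ?_⟩
  rw [frobPow_span_span, ← pow_mul, ← pow_add]
  exact h _ (by omega)

/-- The ideal of elements multiplying parameter tight closures into the ideals. -/
def TT (p : ℕ) (S : Type*) [CommRing S] [IsLocalRing S] : Ideal S where
  carrier := {s | ∀ A, IsSOPIdeal S A → ∀ a, InTightClosure p A a → s * a ∈ A}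
  add_mem' h1 h2 A hA a ha := by
    rw [add_mul]; exact A.add_mem (h1 A hA a ha) (h2 A hA a ha)
  zero_mem' A hA a ha := by rw [zero_mul]; exact A.zero_mem
  smul_mem' r s hs A hA a ha := by
    rw [smul_eq_mul, mul_assoc]; exact A.mul_mem_left _ (hs A hA a ha)

omit [Fact p.Prime] [CharP S p] [IsLocalRing S] in
lemma frobPow_one (A : Ideal S) : Ideal.frobPow 1 A = A := by
  simp [Ideal.frobPow]

lemma test_iff (c : S) : IsParamTestElement p c ↔ (∀ P ∈ minimalPrimes S, c ∉ P) ∧ c ∈ TT p S := by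
  constructor
  · rintro ⟨h1, h2⟩
    refine ⟨h1, fun A hA a ha => ?_⟩
    have := (h2 A hA a).1 ha 0
    simpa [frobPow_one] using this
  · rintro ⟨h1, h2⟩
    refine ⟨h1, fun A hA a => ⟨fun ha e => ?_, fun h => ⟨c, h1, 0, fun e _ => h e⟩⟩⟩
    exact h2 _ (sop_frob hA e) _ (tc_pow hA e ha)

lemma paramTestIdeal_eq [IsNoetherianRing S] (c : S) (hc : IsParamTestElement p c) :
    paramTestIdeal p S = TT p S := by
  apply le_antisymm
  · refine Ideal.span_le.2 fun s hs => ((test_iff s).1 hs).2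
  · have hfin : (insert (paramTestIdeal p S) (minimalPrimes S)).Finite :=
      (minimalPrimes.finite_of_isNoetherianRing S).insert _
    have hsub := (Ideal.subset_union_prime_finite hfin (f := id) (paramTestIdeal p S)
      (paramTestIdeal p S) (by
        intro i hi h1 _
        rcases hi with rfl | hi
        · exact absurd rfl h1
        · exact hi.1.1) (I := TT p S)).1 (by
        intro s hs
        simp only [Set.mem_iUnion]
        by_cases h : ∀ P ∈ minimalPrimes S, s ∉ P
        · exact ⟨_, Set.mem_insert _ _, Ideal.subset_span ((test_iff s).2 ⟨h, hs⟩)⟩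
        · push Not at h
          obtain ⟨P, hP, hsP⟩ := h
          exact ⟨P, Set.mem_insert_of_mem _ hP, hsP⟩)
    obtain ⟨P, hP, hle⟩ := hsub
    rcases hP with rfl | hP
    · exact hle
    · exact absurd (hle ((test_iff c).1 hc).2) (hc.1 P hP)

omit [Fact p.Prime] [CharP S p] in
lemma exists_sop [IsNoetherianRing S] (d : ℕ) (hd : ringKrullDim S = d) :
    ∃ y : Fin d → S, (Ideal.span (Set.range y)).radical = maximalIdeal S := by
  obtain ⟨s, hs, hcard⟩ := Ideal.exists_finset_card_eq_height_of_isNoetherianRing (maximalIdeal S)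
  have h1 : s.card = d := by
    have := IsLocalRing.maximalIdeal_height_eq_ringKrullDim (R := S)
    rw [← hcard, hd] at this
    exact_mod_cast this
  refine ⟨fun i => (s.equivFin.symm (Fin.cast h1.symm i) : S), ?_⟩
  have hr : Set.range (fun i : Fin d => (s.equivFin.symm (Fin.cast h1.symm i) : S)) = s := by
    ext z
    constructor
    · rintro ⟨i, rfl⟩
      exact (s.equivFin.symm (Fin.cast h1.symm i)).2
    · intro hz
      exact ⟨Fin.cast h1 (s.equivFin ⟨z, hz⟩), by simp⟩
  rw [hr, Ideal.radical_eq_sInf]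
  apply le_antisymm
  · exact sInf_le ⟨hs.1.2, hs.1.1⟩
  · refine le_sInf ?_
    rintro Q ⟨hQ, hQp⟩
    exact hs.2 ⟨hQp, hQ⟩ (IsLocalRing.le_maximalIdeal hQp.ne_top)

end

section
variable {R : Type u} [CommRing R] [IsLocalRing R] [IsNoetherianRing R]
  {p : ℕ} [Fact p.Prime] {I : Ideal R}

omit [IsLocalRing R] [IsNoetherianRing R] in
lemma mk_mem_frob [CharP (R ⧸ I) p] {d : ℕ} (x : Fin d → R) (t n : ℕ) (a : R) :
    Ideal.Quotient.mk I a ∈ Ideal.frobPow (p ^ n)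
      (Ideal.span (Set.range fun i => Ideal.Quotient.mk I (x i) ^ t)) ↔
      a ∈ XI I x (fun _ => p ^ n * t) := by
  rw [frobPow_span]
  have : Ideal.span (Set.range fun i => (Ideal.Quotient.mk I (x i) ^ t) ^ p ^ n) =
      (Ideal.span (Set.range fun i => x i ^ (p ^ n * t))).map (Ideal.Quotient.mk I) := by
    rw [Ideal.map_span, ← Set.range_comp]
    congr 2
    ext i
    simp [← pow_mul, mul_comm]
  rw [this, Ideal.mem_quotient_iff_mem_sup]
  rfl

omit [IsNoetherianRing R] in
lemma mk_max [IsLocalRing (R ⧸ I)] (r : R) :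
    Ideal.Quotient.mk I r ∈ maximalIdeal (R ⧸ I) ↔ r ∈ maximalIdeal R := by
  have : IsLocalHom (Ideal.Quotient.mk I) := IsLocalHom.of_surjective _ Ideal.Quotient.mk_surjective
  simp only [mem_maximalIdeal, map_mem_nonunits_iff]

omit [IsNoetherianRing R] in
lemma lift_sop [IsLocalRing (R ⧸ I)] {d : ℕ} (y : Fin d → R ⧸ I)
    (hy : (Ideal.span (Set.range y)).radical = maximalIdeal (R ⧸ I)) :
    ∃ x : Fin d → R, (∀ i, Ideal.Quotient.mk I (x i) = y i) ∧ (∀ i, x i ∈ maximalIdeal R) ∧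
      ∀ Q : Ideal R, Q.IsPrime → I ≤ Q → (∀ i, x i ∈ Q) → Q = maximalIdeal R := by
  choose x hx using fun i => Ideal.Quotient.mk_surjective (y i)
  refine ⟨x, hx, fun i => ?_, fun Q hQ hIQ hxQ => ?_⟩
  · rw [← mk_max (I := I), hx, ← hy]
    exact Ideal.le_radical (Ideal.subset_span ⟨i, rfl⟩)
  · apply le_antisymm (IsLocalRing.le_maximalIdeal hQ.ne_top)
    intro r hr
    rw [← mk_max (I := I), ← hy] at hr
    obtain ⟨n, hn⟩ := hr
    have h1 : Ideal.span (Set.range y) ≤ Q.map (Ideal.Quotient.mk I) := by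
      refine Ideal.span_le.2 ?_
      rintro _ ⟨i, rfl⟩
      rw [← hx]
      exact Ideal.mem_map_of_mem _ (hxQ i)
    have h2 := h1 hn
    rw [← map_pow, Ideal.mem_quotient_iff_mem_sup, sup_eq_left.2 hIQ] at h2
    exact hQ.mem_of_pow_mem _ h2

omit [IsNoetherianRing R] in
lemma hcm_of [IsLocalRing (R ⧸ I)] (hCM : IsCMLocal (R ⧸ I)) (d : ℕ)
    (hd : ringKrullDim (R ⧸ I) = d) :
    ∃ rs : List R, IsWeaklyRegular (R ⧸ I) rs ∧ (∀ r ∈ rs, r ∈ maximalIdeal R) ∧ rs.length = d := by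
  obtain ⟨d', rs, hd', hl, hm, hr⟩ := hCM
  have hdd : d' = d := by
    rw [hd'] at hd; exact_mod_cast hd
  let lift : R ⧸ I → R := Function.surjInv Ideal.Quotient.mk_surjective
  have hlift : ∀ r, Ideal.Quotient.mk _ (lift r) = r := Function.surjInv_eq Ideal.Quotient.mk_surjective
  refine ⟨rs.map lift, ?_, ?_, by simp [hl, hdd]⟩
  · have hre : rs = (rs.map lift).map (algebraMap R (R ⧸ I)) := by
      rw [List.map_map]
      conv_lhs => rw [← List.map_id rs]
      refine List.map_congr_left fun r _ => ?_
      exact (hlift r).symm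
    have h := hr.toIsWeaklyRegular
    rw [hre, isWeaklyRegular_map_algebraMap_iff] at h
    exact h
  · intro r hr'
    obtain ⟨s, hs, rfl⟩ := List.mem_map.1 hr'
    rw [← mk_max (I := I), hlift]
    exact hm s hs

end

section
variable {R : Type u} [CommRing R] [IsLocalRing R] [IsNoetherianRing R]
  {E : Type u} [AddCommGroup E] [Module R E] {I J : Ideal R}
  {H : Type u} [AddCommGroup H] [Module R H]
  {α : J →ₗ[R] (H →ₗ[R] E)} {d : ℕ} {x : Fin d → R} {e : ℕ → H}

lemma rep2 (hI : I ≠ ⊤) (hIJ : I ≤ J)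
    (hcomp : IsAdicComplete (maximalIdeal R) R)
    (hE : IsInjectiveHullOfResidueField R E)
    (hα : Function.Surjective α) (hα0 : ∀ j : J, α j = 0 ↔ (j : R) ∈ I)
    (hxm : ∀ i, x i ∈ maximalIdeal R) (he : IsESys I x e) (h : H) :
    ∃ (w : J) (t : ℕ), 1 ≤ t ∧ h = (w : R) • e t := by
  obtain ⟨k, hk⟩ := inj_factor hE.1 J.subtype (α.flip h) (by
    intro a ha
    have : a = 0 := by simpa using ha
    rw [this, map_zero])
  have hz : ∀ j : J, (j : R) • k 1 = α j h := by
    intro j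
    rw [← map_smul, smul_eq_mul, mul_one]
    exact hk j
  have hzI : k 1 ∈ annIn I E := by
    intro i hi
    have := hz ⟨i, hIJ hi⟩
    rw [(hα0 ⟨i, hIJ hi⟩).2 hi] at this
    exact this
  obtain ⟨w, t, ht, hwt⟩ := rep hI hE hcomp hα hxm he _ hzI
  refine ⟨w, t, ht, ?_⟩
  rw [← sub_eq_zero]
  apply sepH hE hα
  intro j
  rw [map_sub, sub_eq_zero, ← exch, ← hwt, hz]

end

section
variable {R : Type u} [CommRing R] [IsLocalRing R] [IsNoetherianRing R]
  {p : ℕ} [Fact p.Prime] [CharP R p]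
  {E : Type u} [AddCommGroup E] [Module R E] {I J : Ideal R}
  {φ : FrobeniusMap R E p} {u : R} {d : ℕ}
  {α : J →ₗ[R] (HL (maximalIdeal R) d (ModuleCat.of R (R ⧸ I)) →ₗ[R] E)}

lemma main (hreg : IsRegularLocal R) (hcomp : IsAdicComplete (maximalIdeal R) R)
    (hE : IsInjectiveHullOfResidueField R E) (hφ : IsNaturalFrobenius p E φ)
    [IsLocalRing (R ⧸ I)] (hCM : IsCMLocal (R ⧸ I))
    (hd : ringKrullDim (R ⧸ I) = d) (hIJ : I ≤ J)
    (hα : Function.Surjective α) (hα0 : ∀ j : J, α j = 0 ↔ (j : R) ∈ I)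
    (hu1 : ∀ k ∈ I, k * u ∈ Ideal.frobPow p I) (hu2 : ∀ k ∈ J, k * u ∈ Ideal.frobPow p J)
    (hu3 : ∀ v, (∀ k ∈ I, k * v ∈ Ideal.frobPow p I) → (∀ k ∈ J, k * v ∈ Ideal.frobPow p J) →
      ∃ s, v - s * u ∈ Ideal.frobPow p I)
    (c : R) (hc : IsParamTestElement p (Ideal.Quotient.mk I c)) :
    Ideal.map (Ideal.Quotient.mk I)
        (Submodule.colon (Ideal.starClosure u p (Ideal.span {c} * J + I)) J) =
      paramTestIdeal p (R ⧸ I) := by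
  have hI : I ≠ ⊤ := Ideal.Quotient.nontrivial_iff.1 inferInstance
  have hchar : CharP (R ⧸ I) p := by
    rw [CharP.charP_iff_prime_eq_zero Fact.out, ← map_natCast (Ideal.Quotient.mk I), CharP.cast_eq_zero,
      map_zero]
  have hcm := hcm_of hCM d hd
  rw [paramTestIdeal_eq _ hc]
  have hkey : ∀ s : R, s ∈ Submodule.colon (Ideal.starClosure u p (Ideal.span {c} * J + I)) (J : Set R) ↔
      Ideal.Quotient.mk I s ∈ TT p (R ⧸ I) := by
    intro s
    constructor
    · intro hs A hA a' ha
      rw [Submodule.mem_colon] at hs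
      obtain ⟨a, rfl⟩ := Ideal.Quotient.mk_surjective a'
      have hca := (hc.2 A hA _).1 ha
      obtain ⟨d', y, hd', rfl, hr⟩ := hA
      obtain rfl : d' = d := by rw [hd'] at hd; exact_mod_cast hd
      obtain ⟨x, hxy, hxm, hx⟩ := lift_sop y hr
      obtain ⟨e, he⟩ := exists_esys hcm hxm hx hI
      have hy : y = fun i => Ideal.Quotient.mk I (x i) ^ 1 := by
        funext i; rw [pow_one, hxy]
      rw [hy] at hca ⊢
      obtain ⟨w, t, ht, hw⟩ := rep2 hI hIJ hcomp hE hα hα0 hxm he (a • e 1)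
      have hz : α w (e t) ∈ annIn (Ideal.starClosure u p (Ideal.span {c} * J + I)) E := by
        rw [star_ann hreg hcomp hE hφ hu1]
        refine ⟨alpha_ann hα0 _ _, fun n => ?_⟩
        rw [key_equiv hI hIJ hreg hcomp hE hφ hα hα0 hxm he hu1 hu2 hu3 c w t ht n]
        have hp1 : 1 ≤ p ^ n := Nat.pos_of_ne_zero (pow_ne_zero _ (Fact.out : p.Prime).ne_zero)
        have h1 := hca n
        rw [← map_pow, ← map_mul, mk_mem_frob] at h1
        rw [← (he.1 (p ^ n * t) (Nat.mul_pos hp1 ht)).1, mul_smul,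
          ← powlem (p := p) he n _ _ _ _ le_rfl ht hw, ← mul_smul,
          (he.1 (p ^ n * 1) (Nat.mul_pos hp1 one_pos)).1]
        exact h1
      have h2 : (s * a) • e 1 = 0 := by
        rw [mul_smul, hw]
        apply sepH hE hα
        intro j
        rw [map_smul, ← exch, smul_smul]
        exact hz _ (hs j j.2)
      have h3 := ((he.1 1 le_rfl).1 _).1 h2
      have h4 := (mk_mem_frob (p := p) (I := I) x 1 0 (s * a)).2 (by simpa using h3)
      rw [pow_zero, frobPow_one, map_mul] at h4
      exact h4
    · intro hs
      rw [Submodule.mem_colon]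
      intro j hj
      obtain ⟨y, hr⟩ := exists_sop d hd
      obtain ⟨x, hxy, hxm, hx⟩ := lift_sop y hr
      obtain ⟨e, he⟩ := exists_esys hcm hxm hx hI
      apply ann_ann hE
      intro z hz
      rw [star_ann hreg hcomp hE hφ hu1] at hz
      obtain ⟨hzI, hz⟩ := hz
      obtain ⟨w, t, ht, rfl⟩ := rep hI hE hcomp hα hxm he z hzI
      have hsop : IsSOPIdeal (R ⧸ I) (Ideal.span (Set.range fun i => Ideal.Quotient.mk I (x i) ^ t)) := by
        refine ⟨d, _, hd, rfl, ?_⟩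
        rw [span_pow_radical _ _ ht, ← hr]
        simp only [hxy]
      have h1 := hs _ hsop (Ideal.Quotient.mk I w) ⟨_, hc.1, 0, fun n _ => by
        rw [← map_pow, ← map_mul, mk_mem_frob]
        exact (key_equiv hI hIJ hreg hcomp hE hφ hα hα0 hxm he hu1 hu2 hu3 c w t ht n).1 (hz n)⟩
      rw [← map_mul, ← frobPow_one (Ideal.span _), ← pow_zero p, mk_mem_frob] at h1
      have h2 := ((he.1 t ht).1 _).2 (by simpa using h1)
      have h3 := exch (α := α) ⟨j, hj⟩ w (e t)
      rw [smul_eq_mul, mul_smul, h3, ← map_smul, smul_smul, h2, map_zero]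
  ext q
  obtain ⟨s, rfl⟩ := Ideal.Quotient.mk_surjective q
  rw [← hkey, Ideal.mem_map_iff_of_surjective _ Ideal.Quotient.mk_surjective]
  constructor
  · rintro ⟨r, hr, hrs⟩
    rw [hkey, ← hrs, ← hkey]
    exact hr
  · intro h
    exact ⟨s, h, rfl⟩

end
end LCx
end

/-- Let `(R,m)` be a complete regular local ring of characteristic `p`,
`I ⊆ R` an ideal with `S = R/I` Cohen–Macaulay, and let `E_S = Ann_E I` carry the
`S[T;f]`-structure induced by the natural Frobenius on `H := H^{dim S}_{mS}(S)`, with `T`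
acting as the restriction of `u • φ`; here `J ⊆ R` is the ideal containing `I` with
`J/I ≅ H^∨` (Matlis dual of the top local cohomology), and `u` generates
`((I^{[p]} :_R I) ∩ (J^{[p]} :_R J))/I^{[p]}`.  Assume `E_S` is `T`-torsion-free and let
`c ∈ R` have image in `S` a parameter test element.  Then the parameter test ideal `τ̄` of
`S` equals `((cJ + I)^{⋆u} :_R J)·S`. -/
theorem stmt18 {R : Type u} [CommRing R] [IsLocalRing R] [IsNoetherianRing R]
    (p : ℕ) [Fact p.Prime] [CharP R p]
    (hreg : IsRegularLocal R) (hcomp : IsAdicComplete (maximalIdeal R) R)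
    (E : Type u) [AddCommGroup E] [Module R E]
    (hE : IsInjectiveHullOfResidueField R E)
    (φ : FrobeniusMap R E p) (hφ : IsNaturalFrobenius p E φ)
    (I : Ideal R) [IsLocalRing (R ⧸ I)] (hCM : IsCMLocal (R ⧸ I))
    (d : ℕ) (hd : ringKrullDim (R ⧸ I) = d)
    (J : Ideal R) (hJI : I ≤ J)
    (hJH : Nonempty ((↥J ⧸ (Submodule.comap J.subtype I)) ≃ₗ[R]
      (((localCohomology (IsLocalRing.maximalIdeal R) d).obj
          (ModuleCat.of R (R ⧸ I))) →ₗ[R] E)))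
    (u : R)
    (hu : Ideal.span {u} + Ideal.frobPow p I =
      Submodule.colon (Ideal.frobPow p I) I ⊓ Submodule.colon (Ideal.frobPow p J) J)
    (htf : ∀ x ∈ annIn I E, (∃ m, (fun y => u • φ.toFun y)^[m] x = 0) → x = 0)
    (c : R) (hc : IsParamTestElement p (Ideal.Quotient.mk I c)) :
    Ideal.map (Ideal.Quotient.mk I)
        (Submodule.colon (Ideal.starClosure u p (Ideal.span {c} * J + I)) J) =
      paramTestIdeal p (R ⧸ I) := by
  obtain ⟨Φ⟩ := hJH
  have hmem : ∀ v : R, v ∈ Ideal.span {u} + Ideal.frobPow p I ↔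
      (∀ k ∈ I, k * v ∈ Ideal.frobPow p I) ∧ (∀ k ∈ J, k * v ∈ Ideal.frobPow p J) := by
    intro v
    rw [hu, Submodule.mem_inf, Submodule.mem_colon, Submodule.mem_colon]
    simp only [smul_eq_mul, SetLike.mem_coe, mul_comm v]
  have hu0 := (hmem u).1 (Ideal.mem_sup_left (Ideal.mem_span_singleton_self u))
  refine LCx.main (α := Φ.toLinearMap ∘ₗ Submodule.mkQ _) hreg hcomp hE hφ hCM hd hJI
    (Φ.surjective.comp (Submodule.mkQ_surjective _)) ?_ hu0.1 hu0.2 ?_ c hc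
  · intro j
    rw [LinearMap.comp_apply, LinearEquiv.coe_coe, LinearEquiv.map_eq_zero_iff, Submodule.mkQ_apply,
      Submodule.Quotient.mk_eq_zero]
    rfl
  · intro v h1 h2
    obtain ⟨a, ha, b, hb, hab⟩ := Submodule.mem_sup.1 ((hmem v).2 ⟨h1, h2⟩)
    obtain ⟨s, rfl⟩ := Ideal.mem_span_singleton'.1 ha
    refine ⟨s, ?_⟩
    rw [← hab, add_sub_cancel_left]
    exact hb
end

section
/- Let K be a field of prime characteristic p, R = K[[x_1,…,x_n]], and let g ∈ R be nonzero. For e ≥ 1 let I_e(h) denote the smallest ideal L of R with h ∈ L^{[p^e]}. Then { I_e(g^{p^e − 1}) }_{e ≥ 1} is a descending chain of ideals of R which stabilizes: there exists e_0 ≥ 1 such that I_e(g^{p^e − 1}) = I_{e_0}(g^{p^{e_0} − 1}) for all e ≥ e_0. -/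
theorem aux_local_stab {S : Type*} [CommRing S] [IsNoetherianRing S] [IsLocalRing S]
    (I : Ideal S) (k : ℕ) (hI : IsLocalRing.maximalIdeal S ^ k ≤ I)
    (J : ℕ → Ideal S) (hJ : Antitone J) (hIJ : ∀ k, I * J 0 ≤ J k) :
    ∃ k, J k = J (k + 1) := by
  by_cases hT : I = ⊤
  · refine ⟨0, le_antisymm ?_ (hJ (by simp))⟩
    simpa [hT] using hIJ 1
  have : Nontrivial (S ⧸ I) := Ideal.Quotient.nontrivial_iff.2 hT
  have : IsLocalRing (S ⧸ I) :=
    IsLocalRing.of_surjective' (Ideal.Quotient.mk I) Ideal.Quotient.mk_surjective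
  have hart : IsArtinianRing (S ⧸ I) := by
    rw [isArtinianRing_iff_isNilpotent_maximalIdeal]
    refine ⟨k, ?_⟩
    have h1 : IsLocalRing.maximalIdeal (S ⧸ I) ≤
        (IsLocalRing.maximalIdeal S).map (Ideal.Quotient.mk I) := by
      intro x hx
      obtain ⟨y, rfl⟩ := Ideal.Quotient.mk_surjective x
      refine Ideal.mem_map_of_mem _ ?_
      rw [IsLocalRing.mem_maximalIdeal] at hx ⊢
      exact fun hu => hx (hu.map _)
    rw [Ideal.zero_eq_bot, eq_bot_iff]
    refine (Ideal.pow_right_mono h1 k).trans ?_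
    rw [← Ideal.map_pow, Ideal.map_le_iff_le_comap]
    refine hI.trans ?_
    intro x hx
    simpa [Ideal.Quotient.eq_zero_iff_mem] using hx
  let N : Submodule S (J 0) := I • ⊤
  have h2 : IsArtinian S ((J 0) ⧸ N) := by
    have : Module.Finite (S ⧸ I) ((J 0) ⧸ N) := Module.Finite.of_restrictScalars_finite S _ _
    have h3 : IsArtinian (S ⧸ I) ((J 0) ⧸ N) := inferInstance
    let e : ((J 0) ⧸ N) →ₛₗ[Ideal.Quotient.mk I] ((J 0) ⧸ N) := ⟨.id _, fun _ _ ↦ rfl⟩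
    rwa [e.isArtinian_iff_of_bijective Function.bijective_id]
  let f : ℕ →o (Submodule S ((J 0) ⧸ N))ᵒᵈ :=
    ⟨fun k => OrderDual.toDual ((Submodule.comap (J 0).subtype (J k)).map N.mkQ), fun a b hab => by
      rw [OrderDual.toDual_le_toDual]
      exact Submodule.map_mono (Submodule.comap_mono (hJ hab))⟩
  obtain ⟨n, hn⟩ := IsArtinian.monotone_stabilizes f
  have h4 := hn (n+1) (by simp)
  refine ⟨n, ?_⟩
  have h5 : (Submodule.comap (J 0).subtype (J n)).map N.mkQ = (Submodule.comap (J 0).subtype (J (n+1))).map N.mkQ :=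
    OrderDual.toDual.injective h4
  have h6 : ∀ k, N ≤ Submodule.comap (J 0).subtype (J k) := by
    intro k
    rw [← Submodule.map_le_iff_le_comap, Submodule.map_smul'']
    simpa using hIJ k
  have h7 := congrArg (Submodule.comap N.mkQ) h5
  rw [Submodule.comap_map_mkQ, Submodule.comap_map_mkQ, sup_eq_right.2 (h6 _),
    sup_eq_right.2 (h6 _)] at h7
  have h8 := congrArg (Submodule.map (J 0).subtype) h7
  rw [Submodule.map_comap_subtype, Submodule.map_comap_subtype,
    inf_eq_right.2 (hJ (by simp)), inf_eq_right.2 (hJ (by simp))] at h8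
  exact h8

theorem aux_stab {R : Type*} [CommRing R] [IsNoetherianRing R] (a : Ideal R) (m : ℕ)
    (J : ℕ → Ideal R) (hJ : Antitone J) (h1 : ∀ k, a ^ m * J 0 ≤ J k)
    (h2 : ∀ k s, (∀ x ∈ J k, s * x ∈ J (k+1)) → s ∈ a) : a = ⊤ := by
  by_contra ha
  obtain ⟨P, hP⟩ := Ideal.nonempty_minimalPrimes ha
  have hPp : P.IsPrime := hP.1.1
  let S := Localization.AtPrime P
  have hrad := IsLocalization.AtPrime.radical_map_of_mem_minimalPrimes S P a hP
  rw [IsLocalization.AtPrime.map_eq_maximalIdeal P S] at hrad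
  have hN : IsNoetherianRing S := IsLocalization.isNoetherianRing P.primeCompl S inferInstance
  obtain ⟨k, hk⟩ := Ideal.exists_radical_pow_le_of_fg (a.map (algebraMap R S))
    (IsNoetherian.noetherian _)
  rw [hrad] at hk
  obtain ⟨n, hn⟩ := aux_local_stab ((a.map (algebraMap R S))^m) (k * m)
    (by rw [pow_mul]; exact Ideal.pow_right_mono hk m)
    (fun i => (J i).map (algebraMap R S)) (fun i j hij => Ideal.map_mono (hJ hij))
    (fun i => by
      rw [← Ideal.map_pow, ← Ideal.map_mul]; exact Ideal.map_mono (h1 i))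
  have h3 : ∀ x ∈ J n, ∃ s ∉ P, s * x ∈ J (n+1) := by
    intro x hx
    have : algebraMap R S x ∈ (J (n+1)).map (algebraMap R S) := by
      rw [← hn]; exact Ideal.mem_map_of_mem _ hx
    rw [IsLocalization.algebraMap_mem_map_algebraMap_iff P.primeCompl] at this
    obtain ⟨s, hs, h⟩ := this
    exact ⟨s, hs, h⟩
  choose! s hs hs' using h3
  obtain ⟨T, hT⟩ := (IsNoetherian.noetherian (J n) : (J n).FG)
  have hTm : ∀ t ∈ T, t ∈ J n := fun t ht => hT ▸ Ideal.subset_span ht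
  have h4 : (∏ t ∈ T, s t) ∉ P := by
    intro h
    obtain ⟨t, ht, h⟩ := (Ideal.IsPrime.prod_mem_iff).1 h
    exact hs t (hTm t ht) h
  apply h4
  apply hP.1.2
  apply h2 n
  intro x hx
  rw [← hT] at hx
  induction hx using Submodule.span_induction with
  | mem x hx =>
    obtain ⟨c, hc⟩ := Finset.dvd_prod_of_mem s hx
    rw [hc, mul_right_comm]
    exact Ideal.mul_mem_right _ _ (hs' x (hTm x hx))
  | zero => simp
  | add x y _ _ hx hy => rw [mul_add]; exact add_mem hx hy
  | smul c x _ hx => rw [smul_eq_mul, mul_left_comm]; exact Ideal.mul_mem_left _ _ hx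

/-- The ideal generated by the images of `A` under a family of additive maps. -/
def cartierIdeal {R ι : Type*} [CommRing R] (π : ι → R →+ R) (A : Ideal R) : Ideal R :=
  Ideal.span {x | ∃ i, ∃ a ∈ A, x = π i a}

theorem cartierIdeal_le_iff {R ι : Type*} [CommRing R] (π : ι → R →+ R) (f : R →+* R)
    (h2 : ∀ (L : Ideal R) h, h ∈ L.map f ↔ ∀ i, π i h ∈ L) (A L : Ideal R) :
    cartierIdeal π A ≤ L ↔ A ≤ L.map f := by
  rw [cartierIdeal, Ideal.span_le]
  constructor
  · intro h a ha
    rw [h2]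
    exact fun i => h ⟨i, a, ha, rfl⟩
  · rintro h _ ⟨i, a, ha, rfl⟩
    exact (h2 _ _).1 (h ha) i

theorem cartierIdeal_mono {R ι : Type*} [CommRing R] (π : ι → R →+ R) {A B : Ideal R}
    (h : A ≤ B) : cartierIdeal π A ≤ cartierIdeal π B := by
  refine Ideal.span_mono ?_
  rintro _ ⟨i, a, ha, rfl⟩
  exact ⟨i, a, h ha, rfl⟩

theorem cartierIdeal_mul {R ι : Type*} [CommRing R] (π : ι → R →+ R) (p : ℕ)
    (h1 : ∀ i r h, π i (r ^ p * h) = r * π i h) (x : R) (A : Ideal R) :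
    cartierIdeal π (Ideal.span {x ^ p} * A) = Ideal.span {x} * cartierIdeal π A := by
  apply le_antisymm
  · rw [cartierIdeal, Ideal.span_le]
    rintro _ ⟨i, a, ha, rfl⟩
    obtain ⟨b, hb, rfl⟩ := Ideal.mem_span_singleton_mul.1 ha
    rw [h1]
    exact Ideal.mul_mem_mul (Ideal.mem_span_singleton_self x) (Ideal.subset_span ⟨i, b, hb, rfl⟩)
  · rw [Ideal.span_singleton_mul_le_iff]
    intro s hs
    rw [cartierIdeal] at hs
    induction hs using Submodule.span_induction with
    | mem y hy =>
      obtain ⟨i, a, ha, rfl⟩ := hy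
      rw [← h1]
      exact Ideal.subset_span ⟨i, _,
        Ideal.mul_mem_mul (Ideal.mem_span_singleton_self _) ha, rfl⟩
    | zero => simp
    | add x y _ _ hx hy => rw [mul_add]; exact add_mem hx hy
    | smul c x _ hx => rw [smul_eq_mul, mul_left_comm]; exact Ideal.mul_mem_left _ _ hx

theorem cartier_stab {R : Type*} [CommRing R] [IsNoetherianRing R] (p : ℕ) (hp : 2 ≤ p)
    (Φ : Ideal R → Ideal R) (hmono : Monotone Φ)
    (hmul : ∀ x A, Φ (Ideal.span {x ^ p} * A) = Ideal.span {x} * Φ A)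
    (J : ℕ → Ideal R) (hJ : Antitone J) (hJs : ∀ e, J (e + 1) = Φ (J e)) :
    ∃ e₀, 1 ≤ e₀ ∧ ∀ e, e₀ ≤ e → J e = J e₀ := by
  let a : ℕ → Ideal R := fun e => (J (e + 1)).colon (J e : Set R)
  have ha : ∀ e s, s ∈ a e ↔ Ideal.span {s} * J e ≤ J (e + 1) := by
    intro e s
    rw [Ideal.span_singleton_mul_le_iff]
    simp [a, Submodule.mem_colon]
  have hxp : ∀ (x : R) (k : ℕ) (A : Ideal R), k ≤ p →
      Ideal.span {x ^ p} * A ≤ Ideal.span {x ^ k} * A := by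
    intro x k A hk
    refine Ideal.mul_mono_left ?_
    rw [Ideal.span_singleton_le_span_singleton]
    exact pow_dvd_pow _ hk
  have hamono : Monotone a := by
    apply monotone_nat_of_le_succ
    intro e s hs
    rw [ha] at hs ⊢
    calc Ideal.span {s} * J (e + 1) = Φ (Ideal.span {s ^ p} * J e) := by rw [hmul, hJs]
      _ ≤ Φ (J (e + 1)) := by
        refine hmono (le_trans ?_ hs)
        simpa using hxp s 1 (J e) (by omega)
      _ = J (e + 1 + 1) := (hJs _).symm
  obtain ⟨e₀, he₀⟩ := monotone_stabilizes_iff_noetherian.mpr ‹IsNoetherianRing R› ⟨a, hamono⟩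
  have he₀ : ∀ m, e₀ ≤ m → a e₀ = a m := he₀
  have hB : ∀ x ∈ a e₀, ∀ k, Ideal.span {x ^ 2} * J e₀ ≤ J (e₀ + k) := by
    intro x hx k
    have hB1 : Ideal.span {x ^ 2} * J e₀ ≤ Φ (Ideal.span {x ^ 2} * J e₀) := by
      calc Ideal.span {x ^ 2} * J e₀ = Ideal.span {x} * (Ideal.span {x} * J e₀) := by
            rw [← mul_assoc, Ideal.span_singleton_mul_span_singleton, sq]
        _ ≤ Ideal.span {x} * J (e₀ + 1) := Ideal.mul_mono_right ((ha _ _).1 hx)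
        _ = Φ (Ideal.span {x ^ p} * J e₀) := by rw [hmul, hJs]
        _ ≤ _ := hmono (hxp x 2 _ hp)
    induction k with
    | zero => exact Ideal.mul_le_right
    | succ k ih => exact hB1.trans ((hmono ih).trans (hJs _).ge)
  let b : Ideal R := ⨅ k, (J (e₀ + k)).colon (J e₀ : Set R)
  have hab : a e₀ ≤ b.radical := by
    intro x hx
    refine ⟨2, ?_⟩
    simp only [b, Submodule.mem_iInf]
    intro k
    have := Ideal.span_singleton_mul_le_iff.1 (hB x hx k)
    simpa [Submodule.mem_colon] using this
  obtain ⟨m, hm⟩ := Ideal.exists_pow_le_of_le_radical_of_fg hab (IsNoetherian.noetherian _)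
  have htop : a e₀ = ⊤ := by
    refine aux_stab (a e₀) m (fun k => J (e₀ + k)) (fun i j hij => hJ (by omega)) ?_ ?_
    · intro k
      rw [Ideal.mul_le]
      intro r hr s hs
      have h3 := hm hr
      simp only [b, Submodule.mem_iInf, Submodule.mem_colon] at h3
      exact h3 k s hs
    · intro k s hs
      rw [he₀ (e₀ + k) (by omega), ha, Ideal.span_singleton_mul_le_iff]
      exact hs
  have hst : ∀ e, e₀ ≤ e → J e = J e₀ := by
    intro e he
    induction e, he using Nat.le_induction with
    | base => rfl
    | succ e he ih =>
      rw [← ih]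
      refine le_antisymm (hJ (by omega)) ?_
      have h1 : (1 : R) ∈ a e := by rw [← he₀ e he, htop]; trivial
      rw [ha] at h1
      simpa using h1
  exact ⟨e₀ + 1, by omega, fun e he => by rw [hst e (by omega), hst (e₀ + 1) (by omega)]⟩

theorem cartier_iter_le_iff {R ι : Type*} [CommRing R] (p : ℕ) [ExpChar R p] (π : ι → R →+ R)
    (h2 : ∀ (L : Ideal R) h, h ∈ L.map (frobenius R p) ↔ ∀ i, π i h ∈ L) (e : ℕ)
    (A L : Ideal R) :
    (cartierIdeal π)^[e] A ≤ L ↔ A ≤ L.map (iterateFrobenius R p e) := by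
  induction e generalizing A with
  | zero => 
    have : iterateFrobenius R p 0 = RingHom.id R := by ext; simp
    rw [this, Ideal.map_id]; rfl
  | succ e ih =>
    rw [Function.iterate_succ_apply, ih, cartierIdeal_le_iff π _ h2, Ideal.map_map]
    have : (frobenius R p).comp (iterateFrobenius R p e) = iterateFrobenius R p (e + 1) := by
      ext x
      simp [iterateFrobenius_def, frobenius_def, pow_succ, pow_mul]
    rw [this]

theorem cartier_iter_mul {R ι : Type*} [CommRing R] (π : ι → R →+ R) (p : ℕ)
    (h1 : ∀ i r h, π i (r ^ p * h) = r * π i h) (x : R) (e : ℕ) (A : Ideal R) :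
    (cartierIdeal π)^[e] (Ideal.span {x ^ p ^ e} * A) =
      Ideal.span {x} * (cartierIdeal π)^[e] A := by
  induction e generalizing A with
  | zero => simp
  | succ e ih =>
    rw [Function.iterate_succ_apply, Function.iterate_succ_apply, pow_succ, pow_mul,
      cartierIdeal_mul π p h1, ih]

theorem frobPow_eq_map {R : Type*} [CommRing R] (p : ℕ) [ExpChar R p] (e : ℕ) (L : Ideal R) :
    Ideal.span ((fun a => a ^ (p ^ e)) '' (L : Set R)) = L.map (iterateFrobenius R p e) := by
  rw [Ideal.map]
  congr 1

theorem main_abstract {R ι : Type*} [CommRing R] [IsNoetherianRing R] (p : ℕ) (hp : 2 ≤ p)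
    [ExpChar R p] (π : ι → R →+ R)
    (h1 : ∀ i r h, π i (r ^ p * h) = r * π i h)
    (h2 : ∀ (L : Ideal R) h, h ∈ L.map (frobenius R p) ↔ ∀ i, π i h ∈ L)
    (g : R) (Ie : ℕ → R → Ideal R)
    (hIe : ∀ (e : ℕ) (h : R),
      Ie e h = sInf { L : Ideal R | h ∈ L.map (iterateFrobenius R p e) }) :
    (∀ e, 1 ≤ e → Ie (e + 1) (g ^ (p ^ (e + 1) - 1)) ≤ Ie e (g ^ (p ^ e - 1))) ∧
    (∃ e₀, 1 ≤ e₀ ∧ ∀ e, e₀ ≤ e → Ie e (g ^ (p ^ e - 1)) = Ie e₀ (g ^ (p ^ e₀ - 1))) := by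
  have hI : ∀ e h, Ie e h = (cartierIdeal π)^[e] (Ideal.span {h}) := by
    intro e h
    have key : ∀ L : Ideal R, (cartierIdeal π)^[e] (Ideal.span {h}) ≤ L ↔
        h ∈ L.map (iterateFrobenius R p e) := by
      intro L
      rw [cartier_iter_le_iff p π h2, Ideal.span_singleton_le_iff_mem]
    rw [hIe]
    apply le_antisymm
    · exact sInf_le ((key _).1 le_rfl)
    · exact le_sInf fun L hL => (key L).2 hL
  let Φ : Ideal R → Ideal R := fun A => cartierIdeal π (Ideal.span {g ^ (p - 1)} * A)
  have hmono : Monotone Φ := fun A B h => cartierIdeal_mono π (Ideal.mul_mono_right h)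
  have hmul : ∀ x A, Φ (Ideal.span {x ^ p} * A) = Ideal.span {x} * Φ A := by
    intro x A
    simp only [Φ]
    rw [mul_left_comm, cartierIdeal_mul π p h1]
  let J : ℕ → Ideal R := fun e => Ie e (g ^ (p ^ e - 1))
  have hJs : ∀ e, J (e + 1) = Φ (J e) := by
    intro e
    simp only [J, Φ, hI]
    rw [← cartier_iter_mul π p h1, Function.iterate_succ_apply',
      Ideal.span_singleton_mul_span_singleton, ← pow_mul, ← pow_add]
    congr 5
    have : 1 ≤ p ^ e := Nat.one_le_pow _ _ (by omega)
    rw [pow_succ', Nat.sub_mul]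
    have : p ^ e ≤ p * p ^ e := Nat.le_mul_of_pos_left _ (by omega)
    omega
  have hJ0 : J 0 = ⊤ := by simp [J, hI]
  have hJ : Antitone J := by
    apply antitone_nat_of_succ_le
    intro e
    induction e with
    | zero => rw [hJ0]; exact le_top
    | succ e ih => rw [hJs (e + 1)]; conv_rhs => rw [hJs e]
                   exact hmono ih
  exact ⟨fun e _ => hJ (Nat.le_succ e), cartier_stab p hp Φ hmono hmul J hJ hJs⟩

theorem exists_field_coords_aux {K M : Type u} [Field K] [Field M] (f : K →+* M) :
    ∃ (ι : Type u) (b : ι → M) (l : ι → M →+ K),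
      (∀ i c a, l i (f c * a) = c * l i a) ∧
      ∀ a, ∃ s : Finset ι, ∀ t, s ⊆ t → ∑ i ∈ t, f (l i a) * b i = a := by
  let _ := f.toAlgebra
  let b := Module.Basis.ofVectorSpace K M
  refine ⟨_, b, fun i => (b.coord i).toAddMonoidHom, ?_, ?_⟩
  · intro i c a
    have : f c * a = c • a := rfl
    simp [this]
  · intro a
    refine ⟨(b.repr a).support, fun t ht => ?_⟩
    have h := b.linearCombination_repr a
    rw [Finsupp.linearCombination_apply, Finsupp.sum_of_support_subset _ ht _ (by simp)] at h
    exact h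

theorem exists_field_coords (K : Type u) [Field K] (p : ℕ) [ExpChar K p] :
    ∃ (ι : Type u) (b : ι → K) (l : ι → K →+ K),
      (∀ i c a, l i (c ^ p * a) = c * l i a) ∧
      ∀ a, ∃ s : Finset ι, ∀ t, s ⊆ t → ∑ i ∈ t, (l i a) ^ p * b i = a :=
  exists_field_coords_aux (frobenius K p)

/-- A residue vector, as an exponent vector. -/
noncomputable def resExp {n p : ℕ} (α : Fin n → Fin p) : Fin n →₀ ℕ :=
  Finsupp.equivFunOnFinite.symm (fun i => (α i : ℕ))

@[simp] theorem resExp_apply {n p : ℕ} (α : Fin n → Fin p) (i : Fin n) :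
    resExp α i = (α i : ℕ) := rfl

/-- Coordinate maps on power series. -/
noncomputable def psCoord {K : Type*} [Field K] {n p : ℕ} (l : K →+ K) (α : Fin n → Fin p) :
    MvPowerSeries (Fin n) K →+ MvPowerSeries (Fin n) K where
  toFun h := fun d => l (MvPowerSeries.coeff (p • d + resExp α) h)
  map_zero' := by
    funext d
    simp
    rfl
  map_add' x y := by
    funext d
    simp only [map_add]
    rfl

theorem coeff_psCoord {K : Type*} [Field K] {n p : ℕ} (l : K →+ K) (α : Fin n → Fin p)
    (h : MvPowerSeries (Fin n) K) (d : Fin n →₀ ℕ) :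
    MvPowerSeries.coeff d (psCoord l α h) = l (MvPowerSeries.coeff (p • d + resExp α) h) := rfl

theorem coeff_pow_smul {K : Type*} [Field K] {n p : ℕ} [ExpChar K p]
    (r : MvPowerSeries (Fin n) K) (d : Fin n →₀ ℕ) :
    MvPowerSeries.coeff (p • d) (r ^ p) = (MvPowerSeries.coeff d r) ^ p := by
  rw [← MvPowerSeries.map_frobenius_expand p (expChar_ne_zero K p), MvPowerSeries.coeff_map,
    MvPowerSeries.coeff_expand_smul, frobenius_def]

theorem coeff_pow_of_not_dvd {K : Type*} [Field K] {n p : ℕ} [ExpChar K p]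
    (r : MvPowerSeries (Fin n) K) (d : Fin n →₀ ℕ) (i : Fin n) (h : ¬ p ∣ d i) :
    MvPowerSeries.coeff d (r ^ p) = 0 := by
  rw [← MvPowerSeries.map_frobenius_expand p (expChar_ne_zero K p), MvPowerSeries.coeff_map,
    MvPowerSeries.coeff_expand_of_not_dvd p _ _ h, map_zero]

theorem exists_smul_of_dvd {n p : ℕ} (d : Fin n →₀ ℕ) (h : ∀ i, p ∣ d i) :
    ∃ d' : Fin n →₀ ℕ, d = p • d' := by
  choose c hc using h
  refine ⟨Finsupp.equivFunOnFinite.symm c, ?_⟩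
  ext i
  simp [hc]

theorem psCoord_semilinear {K : Type*} [Field K] {n p : ℕ} [ExpChar K p]
    (l : K →+ K) (hl : ∀ c a, l (c ^ p * a) = c * l a) (α : Fin n → Fin p)
    (r h : MvPowerSeries (Fin n) K) : psCoord l α (r ^ p * h) = r * psCoord l α h := by
  classical
  have hp : 0 < p := Nat.pos_of_ne_zero (expChar_ne_zero K p)
  ext d
  rw [coeff_psCoord, MvPowerSeries.coeff_mul, MvPowerSeries.coeff_mul, map_sum]
  symm
  refine Finset.sum_of_injOn (fun u => (p • u.1, p • u.2 + resExp α)) ?_ ?_ ?_ ?_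
  · rintro ⟨u, v⟩ - ⟨u', v'⟩ - huv
    simp only [Prod.mk.injEq, add_left_inj] at huv
    have hinj : ∀ x y : Fin n →₀ ℕ, p • x = p • y → x = y := by
      intro x y hxy
      ext i
      have := DFunLike.congr_fun hxy i
      simpa [hp.ne'] using this
    simp [hinj _ _ huv.1, hinj _ _ huv.2]
  · rintro ⟨u, v⟩ huv
    simp only [Finset.mem_coe, Finset.HasAntidiagonal.mem_antidiagonal] at huv ⊢
    rw [← huv, smul_add, add_assoc]
  · rintro ⟨u, v⟩ huv hne
    rw [Finset.HasAntidiagonal.mem_antidiagonal] at huv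
    simp only at huv ⊢
    by_cases hdvd : ∀ i, p ∣ u i
    · exfalso
      obtain ⟨u', rfl⟩ := exists_smul_of_dvd u hdvd
      apply hne
      have hle : u' ≤ d := by
        intro i
        have h1 := DFunLike.congr_fun huv i
        simp only [Finsupp.add_apply, Finsupp.smul_apply, smul_eq_mul, resExp_apply] at h1
        have h2 := (α i).2
        by_contra hlt
        have h3 : p * (d i + 1) ≤ p * u' i := Nat.mul_le_mul_left _ (by omega)
        rw [mul_add] at h3
        omega
      obtain ⟨v', rfl⟩ := exists_add_of_le hle
      refine ⟨(u', v'), by simp, ?_⟩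
      rw [smul_add, add_assoc] at huv
      simp [add_left_cancel huv]
    · push Not at hdvd
      obtain ⟨i, hi⟩ := hdvd
      rw [coeff_pow_of_not_dvd r u i hi]
      simp
  · rintro ⟨u, v⟩ -
    simp only
    rw [coeff_pow_smul, hl, coeff_psCoord]

theorem coeff_pow_mul_monomial {K : Type*} [Field K] {n p : ℕ} [ExpChar K p]
    (r : MvPowerSeries (Fin n) K) (d : Fin n →₀ ℕ) (α β : Fin n → Fin p) (b : K) :
    MvPowerSeries.coeff (p • d + resExp β) (r ^ p * MvPowerSeries.monomial (resExp α) b) =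
      if α = β then (MvPowerSeries.coeff d r) ^ p * b else 0 := by
  classical
  rw [MvPowerSeries.coeff_mul_monomial]
  by_cases h : α = β
  · subst h
    rw [if_pos (by simp), if_pos rfl, add_tsub_cancel_right, coeff_pow_smul]
  · rw [if_neg h]
    split_ifs with hle
    · have : ∃ i, α i ≠ β i := by
        by_contra hc
        push Not at hc
        exact h (funext hc)
      obtain ⟨i, hi⟩ := this
      rw [coeff_pow_of_not_dvd r _ i, zero_mul]
      intro hdvd
      apply hi
      have h1 := hle i
      simp only [Finsupp.coe_tsub, Finsupp.coe_add, Finsupp.coe_smul, Pi.sub_apply, Pi.add_apply,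
        Pi.smul_apply, smul_eq_mul, resExp_apply, Finsupp.add_apply, Finsupp.smul_apply] at hdvd h1
      have h2 := (Nat.modEq_iff_dvd' h1).2 hdvd
      have h3 : (α i : ℕ) % p = (p * d i + β i) % p := h2
      rw [Nat.mul_add_mod, Nat.mod_eq_of_lt (α i).2, Nat.mod_eq_of_lt (β i).2] at h3
      exact Fin.ext h3
    · rfl

theorem mem_pow_of_coeff {K : Type*} [Field K] {n : ℕ} (N : ℕ) (φ : MvPowerSeries (Fin n) K)
    (h : ∀ d : Fin n →₀ ℕ, (∀ i, d i < N) → MvPowerSeries.coeff d φ = 0) :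
    φ ∈ IsLocalRing.maximalIdeal (MvPowerSeries (Fin n) K) ^ N := by
  classical
  have hX : ∀ i : Fin n, (MvPowerSeries.X i : MvPowerSeries (Fin n) K) ∈
      IsLocalRing.maximalIdeal (MvPowerSeries (Fin n) K) := by
    intro i
    rw [IsLocalRing.mem_maximalIdeal, mem_nonunits_iff, MvPowerSeries.isUnit_iff_constantCoeff]
    simp
  have ho : ∀ d : Fin n →₀ ℕ, ∃ o : Option (Fin n), (∀ i, o = some i → N ≤ d i) ∧
      (o = none → MvPowerSeries.coeff d φ = 0) := by
    intro d
    by_cases hd : ∀ i, d i < N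
    · exact ⟨none, by simp, fun _ => h d hd⟩
    · push Not at hd
      obtain ⟨i, hi⟩ := hd
      exact ⟨some i, by simpa using hi, by simp⟩
  choose o ho1 ho2 using ho
  let ψ : Fin n → MvPowerSeries (Fin n) K := fun i d =>
    if o d = some i then MvPowerSeries.coeff d φ else 0
  have hψ : ∀ i d, MvPowerSeries.coeff d (ψ i) =
    if o d = some i then MvPowerSeries.coeff d φ else 0 := fun i d => rfl
  have hsum : φ = ∑ i, ψ i := by
    ext d
    rw [map_sum]
    simp only [hψ]
    cases hod : o d with
    | none => simp [ho2 d hod]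
    | some j => simp
  rw [hsum]
  refine Ideal.sum_mem _ fun i _ => ?_
  have : (MvPowerSeries.X i : MvPowerSeries (Fin n) K) ^ N ∣ ψ i := by
    rw [MvPowerSeries.X_pow_dvd_iff]
    intro m hm
    rw [hψ, if_neg]
    intro hc
    have := ho1 m i hc
    omega
  obtain ⟨c, hc⟩ := this
  rw [hc]
  exact Ideal.mul_mem_right _ _ (Ideal.pow_mem_pow (hX i) N)

theorem krull_closed {S : Type*} [CommRing S] [IsNoetherianRing S] [IsLocalRing S]
    (M : Ideal S) (h : S) (hh : ∀ N, ∃ y ∈ M, h - y ∈ IsLocalRing.maximalIdeal S ^ N) :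
    h ∈ M := by
  have key := Ideal.iInf_pow_smul_eq_bot_of_isLocalRing (R := S) (M := S ⧸ M)
    (IsLocalRing.maximalIdeal S) (Ideal.IsPrime.ne_top inferInstance)
  have : Ideal.Quotient.mk M h ∈
      (⨅ i : ℕ, IsLocalRing.maximalIdeal S ^ i • ⊤ : Submodule S (S ⧸ M)) := by
    rw [Submodule.mem_iInf]
    intro N
    obtain ⟨y, hy, hN⟩ := hh N
    have h1 : Ideal.Quotient.mk M h = (h - y) • (1 : S ⧸ M) := by
      rw [Algebra.smul_def, mul_one]
      change _ = Ideal.Quotient.mk M (h - y)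
      rw [map_sub, Ideal.Quotient.eq_zero_iff_mem.2 hy, sub_zero]
    rw [h1]
    exact Submodule.smul_mem_smul hN trivial
  rw [key, Submodule.mem_bot] at this
  exact Ideal.Quotient.eq_zero_iff_mem.1 this

theorem exists_ps_coords (K : Type u) [Field K] (p n : ℕ) [ExpChar K p]
    [ExpChar (MvPowerSeries (Fin n) K) p] :
    ∃ (ι : Type u) (π : ι → MvPowerSeries (Fin n) K →+ MvPowerSeries (Fin n) K),
      (∀ i r h, π i (r ^ p * h) = r * π i h) ∧
      (∀ (L : Ideal (MvPowerSeries (Fin n) K)) h,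
        h ∈ L.map (frobenius (MvPowerSeries (Fin n) K) p) ↔ ∀ i, π i h ∈ L) := by
  classical
  obtain ⟨ι, b, l, hl, hb⟩ := exists_field_coords K p
  have hp : 0 < p := Nat.pos_of_ne_zero (expChar_ne_zero K p)
  refine ⟨ι × (Fin n → Fin p), fun j => psCoord (l j.1) j.2,
    fun j r h => psCoord_semilinear _ (hl j.1) _ _ _, fun L h => ⟨?_, ?_⟩⟩
  · intro hh j
    rw [Ideal.map] at hh
    induction hh using Submodule.span_induction with
    | mem x hx =>
      obtain ⟨y, hy, rfl⟩ := hx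
      have := psCoord_semilinear _ (hl j.1) j.2 y 1
      rw [mul_one] at this
      rw [frobenius_def, this]
      exact Ideal.mul_mem_right _ _ hy
    | zero => simp
    | add x y _ _ hx hy => rw [map_add]; exact add_mem hx hy
    | smul c x hx' _ =>
      have : ∀ x ∈ Submodule.span (MvPowerSeries (Fin n) K)
          ((frobenius (MvPowerSeries (Fin n) K) p) '' (L : Set (MvPowerSeries (Fin n) K))),
          ∀ c, psCoord (l j.1) j.2 (c * x) ∈ L := by
        intro x hx
        induction hx using Submodule.span_induction with
        | mem x hx =>
          obtain ⟨y, hy, rfl⟩ := hx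
          intro c
          rw [frobenius_def, mul_comm, psCoord_semilinear _ (hl j.1)]
          exact Ideal.mul_mem_right _ _ hy
        | zero => simp
        | add x y _ _ hx hy => intro c; rw [mul_add, map_add]; exact add_mem (hx c) (hy c)
        | smul a x _ hx => intro c; rw [smul_eq_mul, ← mul_assoc]; exact hx _
      exact this x hx' c
  · intro hL
    apply krull_closed
    intro N
    choose s hs using hb
    let c : Fin n →₀ ℕ := Finsupp.equivFunOnFinite.symm (fun _ => N)
    let t : Finset ι := (Finset.Iic c).biUnion (fun d => s (MvPowerSeries.coeff d h))
    refine ⟨∑ i ∈ t, ∑ α : Fin n → Fin p,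
      (psCoord (l i) α h) ^ p * MvPowerSeries.monomial (resExp α) (b i), ?_, ?_⟩
    · refine Ideal.sum_mem _ fun i _ => Ideal.sum_mem _ fun α _ => Ideal.mul_mem_right _ _ ?_
      rw [← frobenius_def]
      exact Ideal.mem_map_of_mem _ (hL (i, α))
    · apply mem_pow_of_coeff
      intro d hd
      have hdc : d ∈ Finset.Iic c := by
        rw [Finset.mem_Iic]
        intro i
        exact (hd i).le
      have hst : s (MvPowerSeries.coeff d h) ⊆ t := Finset.subset_biUnion_of_mem (fun d => s (MvPowerSeries.coeff d h)) hdc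
      let β : Fin n → Fin p := fun i => ⟨d i % p, Nat.mod_lt _ hp⟩
      let d' : Fin n →₀ ℕ := Finsupp.equivFunOnFinite.symm (fun i => d i / p)
      have hd' : d = p • d' + resExp β := by
        ext i
        simp [β, d', Nat.div_add_mod]
      rw [map_sub, sub_eq_zero]
      conv_lhs => rw [← hs (MvPowerSeries.coeff d h) t hst]
      rw [map_sum]
      refine Finset.sum_congr rfl fun i _ => ?_
      rw [map_sum, hd']
      simp only [coeff_pow_mul_monomial]
      simp [coeff_psCoord]

/-- Let `K` be a field of prime characteristic `p`,
`R = K[[x_1,…,x_n]]`, and `g ∈ R` nonzero.  For `e ≥ 1` let `I_e(h)` be the smallest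
ideal `L` of `R` with `h ∈ L^{[p^e]}`.  Then `{I_e(g^{p^e - 1})}_{e ≥ 1}` is a descending
chain of ideals of `R` which stabilizes. -/
theorem stmt19 (K : Type u) [Field K] (p : ℕ) [Fact p.Prime] [CharP K p] (n : ℕ)
    (g : MvPowerSeries (Fin n) K) (hg : g ≠ 0)
    (Ie : ℕ → MvPowerSeries (Fin n) K → Ideal (MvPowerSeries (Fin n) K))
    (hIe : ∀ (e : ℕ) (h : MvPowerSeries (Fin n) K),
      Ie e h = sInf { L : Ideal (MvPowerSeries (Fin n) K) | h ∈ Ideal.frobPow (p ^ e) L }) :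
    (∀ e, 1 ≤ e → Ie (e + 1) (g ^ (p ^ (e + 1) - 1)) ≤ Ie e (g ^ (p ^ e - 1))) ∧
    (∃ e₀, 1 ≤ e₀ ∧ ∀ e, e₀ ≤ e → Ie e (g ^ (p ^ e - 1)) = Ie e₀ (g ^ (p ^ e₀ - 1))) := by
  have hp : p.Prime := Fact.out
  have : ExpChar K p := ExpChar.prime hp
  have : CharP (MvPowerSeries (Fin n) K) p :=
    charP_of_injective_algebraMap (algebraMap K (MvPowerSeries (Fin n) K)).injective p
  have : ExpChar (MvPowerSeries (Fin n) K) p := ExpChar.prime hp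
  obtain ⟨ι, π, h1, h2⟩ := exists_ps_coords K p n
  refine main_abstract p hp.two_le π h1 h2 g Ie ?_
  intro e h
  rw [hIe]
  congr 1
end
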